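/- Let K be an algebraically closed field of arbitrary characteristic and n, m positive integers. The ring of matrix semi-invariants R(n,m) = K[Mat_{n,n}^m]^{SL_n × SL_n} is a Cohen-Macaulay ring. -/

import Mathlib

open MvPolynomial Matrix

/-- The depth of a local ring: the supremum of lengths of regular sequences contained
in the maximal ideal. -/
noncomputable def localRingDepth (R : Type) [CommRing R] [IsLocalRing R] :
    WithBot (WithTop ℕ) :=
  sSup { n : WithBot (WithTop ℕ) | ∃ rs : List R, (rs.length : WithBot (WithTop ℕ)) = n ∧
    RingTheory.Sequence.IsRegular R rs ∧ ∀ r ∈ rs, r ∈ IsLocalRing.maximalIdeal R }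

/-- A commutative ring is Cohen-Macaulay if the localization at every maximal ideal
has depth equal to its Krull dimension. -/
def IsCohenMacaulayRing (R : Type) [CommRing R] : Prop :=
  ∀ (p : Ideal R) (hp : p.IsMaximal),
    haveI := hp.isPrime
    localRingDepth (Localization.AtPrime p) = ringKrullDim (Localization.AtPrime p)

open MvPolynomial Matrix

/-- Coordinate functions of an `m`-tuple of `n × n` matrices. -/
def matCoords {K : Type} [Field K] {n m : ℕ} (X : Fin m → Matrix (Fin n) (Fin n) K) :
    Fin m × Fin n × Fin n → K :=
  fun p => X p.1 p.2.1 p.2.2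

/-- The ring of matrix semi-invariants `R(n,m) = K[Mat_{n,n}^m]^{SL_n × SL_n}`, where
`(A,B)` acts by `(X_1, …, X_m) ↦ (A X_1 B⁻¹, …, A X_m B⁻¹)`. -/
noncomputable def matrixSemiInvariants (K : Type) [Field K] (n m : ℕ) :
    Subalgebra K (MvPolynomial (Fin m × Fin n × Fin n) K) :=
  ⨅ (A : SpecialLinearGroup (Fin n) K) (B : SpecialLinearGroup (Fin n) K)
    (X : Fin m → Matrix (Fin n) (Fin n) K),
      AlgHom.equalizer
        (aeval (matCoords fun i => A.val * X i * (B⁻¹).val))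
        (aeval (matCoords X))

/-- The ring of matrix invariants `S(n,m) = K[Mat_{n,n}^m]^{GL_n}`, where `A` acts by
simultaneous conjugation. -/
noncomputable def matrixInvariants (K : Type) [Field K] (n m : ℕ) :
    Subalgebra K (MvPolynomial (Fin m × Fin n × Fin n) K) :=
  ⨅ (A : GeneralLinearGroup (Fin n) K) (X : Fin m → Matrix (Fin n) (Fin n) K),
      AlgHom.equalizer
        (aeval (matCoords fun i => A.val * X i * (A⁻¹).val))
        (aeval (matCoords X))

set_option linter.all false
notation:max "Mt" n:max T:max => Matrix (Fin n) (Fin n) T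
notation:35 b:36 "⊠ₙ" n:max => b × Fin n × Fin n
theorem slGen {F : Type} [Field F] (n : ℕ) (P : Mt n F → Prop) (h1 : P 1)
    (hmul : ∀ A B, P A → P B → P (A * B))
    (hadj : ∀ i j : Fin n, (i.val + 1 = j.val ∨ j.val + 1 = i.val) → ∀ t, P (transvection i j t)) :
    ∀ A : Mt n F, A.det = 1 → P A := by
  have comm : ∀ i j k : Fin n, i ≠ j → j ≠ k → i ≠ k → ∀ t : F, transvection i k t =
      transvection i j t * transvection j k 1 * transvection i j (-t) * transvection j k (-1) := by
    intro i j k hij hjk hik t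
    simp [transvection, add_mul, mul_add, single_mul_single_of_ne, hij, hjk, hik, hij.symm,
      hjk.symm, hik.symm]
    simp only [← single_neg]
    abel
  have htr : ∀ d : ℕ, ∀ i j : Fin n, i ≠ j → (i.val = j.val + d ∨ j.val = i.val + d) → ∀ t,
      P (transvection i j t) := by
    intro d
    induction d with
    | zero => intro i j hij h; exact absurd (Fin.ext (by omega)) hij
    | succ d ih =>
      intro i j hij h t
      rcases Nat.eq_zero_or_pos d with rfl | hd
      · exact hadj i j (by omega) t
      obtain ⟨k, hk, hk2⟩ : ∃ k : Fin n, (i.val = k.val + d ∨ k.val = i.val + d) ∧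
          (k.val + 1 = j.val ∨ j.val + 1 = k.val) := by
        rcases h with h | h
        · exact ⟨⟨j.val + 1, by omega⟩, by simp; omega, by simp⟩
        · exact ⟨⟨j.val - 1, by omega⟩, by simp; omega, by simp; omega⟩
      have hik : i ≠ k := by rintro rfl; omega
      have hkj : k ≠ j := by rintro rfl; omega
      rw [comm i k j hik hkj hij]
      exact hmul _ _ (hmul _ _ (hmul _ _ (ih i k hik hk _) (hadj _ _ hk2 _)) (ih i k hik hk _))
        (hadj _ _ hk2 _)
  have htr' : ∀ i j : Fin n, i ≠ j → ∀ t, P (transvection i j t) := fun i j hij t =>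
    htr (max i.val j.val - min i.val j.val) i j hij (by omega) t
  intro A hA
  rcases subsingleton_or_nontrivial (Fin n) with hs | hs
  · have : A = 1 := by
      ext i j
      have : i = j := Subsingleton.elim _ _
      subst this
      have : Unique (Fin n) := { default := i, uniq := fun _ => Subsingleton.elim _ _ }
      rw [det_unique] at hA
      rw [one_apply_eq, ← hA]; congr 1 <;> exact Subsingleton.elim _ _
    rw [this]; exact h1
  · refine SpecialLinearGroup.diagonal_transvection_induction' (fun M => P M.1) ⟨A, hA⟩ ?_
      (fun i j hij a => htr' i j hij a) (fun A B => hmul A.1 B.1)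
    intro i j hij c hc
    have : (SpecialLinearGroup.diag2n hij c hc).1 = transvection i j c * transvection j i (-c⁻¹) *
        transvection i j c * (transvection i j (-1) * transvection j i 1 * transvection i j (-1)) := by
      rw [SpecialLinearGroup.diag2n_coe]
      have e1 : diagonal (fun k ↦ if k = i then c else if k = j then c⁻¹ else 1) =
          1 + single i i (c - 1) + single j j (c⁻¹ - 1) := by
        ext a b
        simp only [diagonal_apply, Matrix.add_apply, one_apply, single_apply]
        split_ifs <;> grind
      rw [e1]
      simp only [transvection, add_mul, mul_add, single_mul_single_of_ne _ _ _ _ hij,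
        single_mul_single_of_ne _ _ _ _ hij.symm, single_mul_single_same, one_mul, mul_one,
        zero_mul, mul_zero, add_zero, zero_add]
      have hne := hij.symm
      ext a b
      simp only [Matrix.add_apply]
      by_cases hai : i = a
      · subst hai
        by_cases hbi : i = b
        · subst hbi; simp [single_apply, hne, hij]; field_simp; ring
        · by_cases hbj : j = b
          · subst hbj; simp [single_apply, hne, hij]; field_simp; ring
          · simp [single_apply, hne, hij, hbi, hbj]
      · by_cases haj : j = a
        · subst haj
          by_cases hbi : i = b
          · subst hbi; simp [single_apply, hne, hij]; field_simp; ring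
          · by_cases hbj : j = b
            · subst hbj; simp [single_apply, hne, hij]; field_simp; ring
            · simp [single_apply, hne, hij, hbi, hbj]
        · simp [single_apply, hai, haj]
    rw [this]
    exact hmul _ _ (hmul _ _ (hmul _ _ (htr' _ _ hij _) (htr' _ _ hij.symm _)) (htr' _ _ hij _))
      (hmul _ _ (hmul _ _ (htr' _ _ hij _) (htr' _ _ hij.symm _)) (htr' _ _ hij _))
/-! ### Leading terms -/
section lead
variable {σ : Type} {K : Type} [CommRing K]
noncomputable def wt (w : σ → ℕ) (u : σ →₀ ℕ) : ℕ := u.sum fun v k => k * w v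
lemma wt_add (w : σ → ℕ) (u v : σ →₀ ℕ) : wt w (u + v) = wt w u + wt w v :=
  Finsupp.sum_add_index' (by simp) (by intros; ring)
lemma wt_zero (w : σ → ℕ) : wt w 0 = 0 := Finsupp.sum_zero_index
lemma wt_single (w : σ → ℕ) (v : σ) : wt w (Finsupp.single v 1) = w v := by
  simp [wt]
def Lead (w : σ → ℕ) (f : MvPolynomial σ K) (u : σ →₀ ℕ) : Prop :=
  coeff u f = 1 ∧ ∀ v, coeff v f ≠ 0 → v ≠ u → wt w v < wt w u
lemma Lead.one (w : σ → ℕ) : Lead w (1 : MvPolynomial σ K) 0 := by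
  classical
  refine ⟨by simp, fun v hv hv0 => ?_⟩
  rw [coeff_one, if_neg (Ne.symm hv0)] at hv
  exact absurd rfl hv
lemma Lead.X (w : σ → ℕ) (v : σ) : Lead w (X v : MvPolynomial σ K) (Finsupp.single v 1) := by
  classical
  refine ⟨by simp, fun u hu hu0 => ?_⟩
  rw [coeff_X', if_neg (Ne.symm hu0)] at hu
  exact absurd rfl hu
lemma Lead.mul {w : σ → ℕ} {f g : MvPolynomial σ K} {u v : σ →₀ ℕ} (hf : Lead w f u)
    (hg : Lead w g v) : Lead w (f * g) (u + v) := by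
  classical
  have key : ∀ a b, coeff a f * coeff b g ≠ 0 → (a, b) ≠ (u, v) → wt w (a + b) < wt w (u + v) := by
    intro a b hab hne
    have ha : coeff a f ≠ 0 := left_ne_zero_of_mul hab
    have hb : coeff b g ≠ 0 := right_ne_zero_of_mul hab
    rw [wt_add, wt_add]
    by_cases h1 : a = u
    · have h2 : b ≠ v := fun h => hne (by rw [h1, h])
      have := hg.2 b hb h2
      rw [h1]; omega
    · have := hf.2 a ha h1
      by_cases h2 : b = v
      · rw [h2]; omega
      · have := hg.2 b hb h2; omega
  constructor
  · rw [coeff_mul, Finset.sum_eq_single (u, v)]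
    · simp [hf.1, hg.1]
    · intro b hb hne
      by_contra h
      have := key b.1 b.2 h hne
      rw [Finset.HasAntidiagonal.mem_antidiagonal.1 hb] at this
      omega
    · intro h; simp at h
  · intro a ha hne
    rw [coeff_mul] at ha
    obtain ⟨b, hb, h⟩ := Finset.exists_ne_zero_of_sum_ne_zero ha
    rw [← Finset.HasAntidiagonal.mem_antidiagonal.1 hb]
    refine key b.1 b.2 h ?_
    intro hE
    simp only [Prod.mk.injEq] at hE
    rw [← hE.1, ← hE.2] at hne
    exact hne (Finset.HasAntidiagonal.mem_antidiagonal.1 hb).symm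
lemma Lead.pow {w : σ → ℕ} {f : MvPolynomial σ K} {u : σ →₀ ℕ} (hf : Lead w f u) (k : ℕ) :
    Lead w (f ^ k) (k • u) := by
  induction k with
  | zero => simpa using Lead.one w
  | succ k ih => rw [pow_succ, succ_nsmul]; exact ih.mul hf
lemma Lead.prod {ι : Type} {w : σ → ℕ} (s : Finset ι) {f : ι → MvPolynomial σ K}
    {u : ι → σ →₀ ℕ} (hf : ∀ i ∈ s, Lead w (f i) (u i)) :
    Lead w (∏ i ∈ s, f i) (∑ i ∈ s, u i) := by
  classical
  induction s using Finset.induction_on with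
  | empty => simpa using Lead.one w
  | insert a s ha ih =>
    rw [Finset.prod_insert ha, Finset.sum_insert ha]
    exact (hf a (by simp)).mul (ih fun i hi => hf i (by simp [hi]))
lemma Lead.add {w : σ → ℕ} {f g : MvPolynomial σ K} {u : σ →₀ ℕ} (hf : Lead w f u)
    (hg : ∀ v, coeff v g ≠ 0 → wt w v < wt w u) : Lead w (f + g) u := by
  constructor
  · have : coeff u g = 0 := by
      by_contra h; exact lt_irrefl _ (hg u h)
    rw [coeff_add, hf.1, this, add_zero]
  · intro v hv hne
    by_cases h : coeff v g = 0
    · exact hf.2 v (by simpa [h] using hv) hne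
    · exact hg v h
end lead
/-! ### The trace map -/
section tau
variable {σ : Type} [Fintype σ] {K : Type} [Field K]
noncomputable def cst (σ : Type) [Fintype σ] (k : ℕ) : σ →₀ ℕ :=
  Finsupp.equivFunOnFinite.symm fun _ => k
@[simp] lemma cst_apply (k : ℕ) (v : σ) : cst σ k v = k := rfl
variable (p : ℕ) [Fact p.Prime] [CharP K p] [PerfectRing K p] (e : ℕ)
noncomputable def tau (f : MvPolynomial σ K) : MvPolynomial σ K := by
  classical exact
  ∑ α ∈ f.support, if h : ∃ β, α = cst σ (p ^ e - 1) + p ^ e • β then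
    monomial h.choose ((iterateFrobeniusEquiv K p e).symm (coeff α f)) else 0
lemma q_pos : 0 < p ^ e := pow_pos (Nat.Prime.pos Fact.out) e
lemma qinj {a b : σ →₀ ℕ} (h : cst σ (p ^ e - 1) + p ^ e • a = cst σ (p ^ e - 1) + p ^ e • b) :
    a = b := by
  have := add_left_cancel h
  ext v
  have h2 := DFunLike.congr_fun this v
  exact Nat.eq_of_mul_eq_mul_left (q_pos p e) (by simpa only [Finsupp.smul_apply, smul_eq_mul] using h2)
lemma coeff_tau (f : MvPolynomial σ K) (β : σ →₀ ℕ) : coeff β (tau p e f) =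
    (iterateFrobeniusEquiv K p e).symm (coeff (cst σ (p ^ e - 1) + p ^ e • β) f) := by
  classical
  unfold tau
  rw [coeff_sum, Finset.sum_eq_single (cst σ (p ^ e - 1) + p ^ e • β)]
  · have h : ∃ β', cst σ (p ^ e - 1) + p ^ e • β = cst σ (p ^ e - 1) + p ^ e • β' := ⟨β, rfl⟩
    rw [dif_pos h, ← qinj p e h.choose_spec]
    simp
  · intro α _ hne
    split_ifs with h
    · rw [coeff_monomial, if_neg]
      intro h2
      exact hne (by rw [← h2]; exact h.choose_spec)
    · simp
  · intro h
    have : coeff (cst σ (p ^ e - 1) + p ^ e • β) f = 0 := by simpa using h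
    split_ifs <;> simp [this]
lemma tau_add (f g : MvPolynomial σ K) : tau p e (f + g) = tau p e f + tau p e g := by
  ext β; simp [coeff_tau]
lemma tau_zero : tau p e (0 : MvPolynomial σ K) = 0 := by
  ext β; simp [coeff_tau]
lemma tau_sum {ι : Type} (s : Finset ι) (f : ι → MvPolynomial σ K) :
    tau p e (∑ i ∈ s, f i) = ∑ i ∈ s, tau p e (f i) := by
  classical
  induction s using Finset.induction_on with
  | empty => simp [tau_zero]
  | insert a s ha ih => rw [Finset.sum_insert ha, Finset.sum_insert ha, tau_add, ih]
lemma add_pow_q (f g : MvPolynomial σ K) : (f + g) ^ p ^ e = f ^ p ^ e + g ^ p ^ e :=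
  add_pow_char_pow ..
lemma tau_pow_mul (a b : MvPolynomial σ K) : tau p e (a ^ p ^ e * b) = a * tau p e b := by
  classical
  have hq := q_pos p e
  induction a using MvPolynomial.induction_on' with
  | add f g h1 h2 => rw [add_pow_q, add_mul, add_mul, tau_add, h1, h2]
  | monomial α r =>
    ext β
    rw [monomial_pow, coeff_tau, coeff_monomial_mul', coeff_monomial_mul', coeff_tau]
    have hiff : p ^ e • α ≤ cst σ (p ^ e - 1) + p ^ e • β ↔ α ≤ β := by
      rw [Finsupp.le_def, Finsupp.le_def]
      refine forall_congr' fun v => ?_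
      simp only [Finsupp.smul_apply, Finsupp.add_apply, cst_apply, smul_eq_mul]
      constructor
      · intro h
        by_contra h'
        push Not at h'
        have : p ^ e * (β v + 1) ≤ p ^ e * α v := Nat.mul_le_mul_left _ h'
        rw [mul_add] at this; omega
      · intro h
        have : p ^ e * α v ≤ p ^ e * β v := Nat.mul_le_mul_left _ h
        omega
    by_cases hαβ : α ≤ β
    · rw [if_pos hαβ, if_pos (hiff.2 hαβ), map_mul]
      congr 1
      · rw [RingEquiv.symm_apply_eq, iterateFrobeniusEquiv_apply, iterateFrobenius_def]
      · congr 2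
        obtain ⟨δ, rfl⟩ := le_iff_exists_add.1 hαβ
        rw [add_tsub_cancel_left, smul_add, add_left_comm, add_tsub_cancel_left]
    · rw [if_neg hαβ, if_neg (fun h => hαβ (hiff.1 h)), map_zero]
lemma tau_eq_zero {f : MvPolynomial σ K}
    (h : ∀ α, coeff α f ≠ 0 → ¬ cst σ (p ^ e - 1) ≤ α) : tau p e f = 0 := by
  ext β
  rw [coeff_tau, coeff_zero, EmbeddingLike.map_eq_zero_iff]
  by_contra h2
  exact h _ h2 le_self_add
lemma wt_mono (w : σ → ℕ) {a b : σ →₀ ℕ} (h : a ≤ b) : wt w a ≤ wt w b := by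
  obtain ⟨d, rfl⟩ := le_iff_exists_add.1 h
  rw [wt_add]; omega
lemma tau_lead {w : σ → ℕ} {f : MvPolynomial σ K} (h : Lead w f (cst σ (p ^ e - 1))) :
    tau p e f = 1 := by
  classical
  ext β
  rw [coeff_tau, coeff_one]
  split_ifs with h0
  · subst h0; simp [h.1]
  · rw [EmbeddingLike.map_eq_zero_iff]
    by_contra h2
    have := h.2 _ h2 (by
      intro h3
      apply h0
      have : p ^ e • β = 0 := by simpa using h3
      ext v
      have h2 := DFunLike.congr_fun this v
      simp only [Finsupp.smul_apply, smul_eq_mul, Finsupp.coe_zero, Pi.zero_apply, mul_eq_zero] at h2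
      simpa using (h2.resolve_left (q_pos p e).ne').symm)
    have h4 := wt_mono w (le_self_add : cst σ (p ^ e - 1) ≤ cst σ (p ^ e - 1) + p ^ e • β)
    omega
lemma tau_comm (φ : MvPolynomial σ K →ₐ[K] MvPolynomial σ K) (w : σ → ℕ)
    (hh : ∀ v, (φ (X v)).IsHomogeneous 1) (hl : ∀ v, Lead w (φ (X v)) (Finsupp.single v 1))
    (f : MvPolynomial σ K) : tau p e (φ f) = φ (tau p e f) := by
  classical
  have hq := q_pos p e
  have small : ∀ α : σ →₀ ℕ, α ≤ cst σ (p ^ e - 1) →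
      tau p e (φ (monomial α 1)) = φ (tau p e (monomial α 1)) := by
    intro α hα
    have hprod : φ (monomial α 1) = ∏ v, φ (X v) ^ α v := by
      rw [monomial_eq, C_1, one_mul, Finsupp.prod_fintype _ _ (by simp), map_prod]
      simp
    have hsum : ∑ v, α v • Finsupp.single v 1 = α := by
      ext v; simp [Finsupp.finset_sum_apply, Finsupp.single_apply]
    have hL : Lead w (φ (monomial α 1)) α := by
      rw [hprod]
      have := Lead.prod (w := w) Finset.univ (f := fun v => φ (X v) ^ α v)
        (u := fun v => α v • Finsupp.single v 1) (fun v _ => (hl v).pow _)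
      rwa [hsum] at this
    by_cases hc : α = cst σ (p ^ e - 1)
    · subst hc
      rw [tau_lead p e hL, tau_lead p e (w := w), map_one]
      constructor
      · simp
      · intro v hv hne
        rw [coeff_monomial, if_neg (Ne.symm hne)] at hv
        exact absurd rfl hv
    · have hdeg : α.degree < (cst σ (p ^ e - 1)).degree := by
        obtain ⟨d, hd⟩ := le_iff_exists_add.1 hα
        rw [hd, map_add]
        have : d.degree ≠ 0 := by
          intro h; rw [Finsupp.degree_eq_zero_iff] at h
          exact hc (by rw [hd, h, add_zero])
        omega
      have hnle : ∀ β : σ →₀ ℕ, β.degree = α.degree → ¬ cst σ (p ^ e - 1) ≤ β := by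
        intro β hβ hle
        have := Finsupp.degree_mono hle
        omega
      rw [tau_eq_zero, tau_eq_zero, map_zero]
      · intro β hβ
        rw [coeff_monomial] at hβ
        split_ifs at hβ with h
        · exact hnle β (by rw [h])
        · exact absurd rfl hβ
      · intro β hβ
        apply hnle
        have hom : (φ (monomial α 1)).IsHomogeneous α.degree := by
          rw [hprod, Finsupp.degree_eq_sum]
          refine IsHomogeneous.prod _ _ _ fun v _ => ?_
          simpa using (hh v).pow (α v)
        have := hom hβ
        rw [← this]; exact DFunLike.congr_fun Finsupp.degree_eq_weight_one β
  induction f using MvPolynomial.induction_on' with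
  | add a b ha hb => rw [map_add, tau_add, tau_add, map_add, ha, hb]
  | monomial u r =>
    set b : σ →₀ ℕ := u.mapRange (fun k => k % p ^ e) (by simp)
    set a : σ →₀ ℕ := u.mapRange (fun k => k / p ^ e) (by simp)
    have hu : monomial u r = (monomial a ((iterateFrobeniusEquiv K p e).symm r)) ^ p ^ e *
        monomial b 1 := by
      rw [monomial_pow, monomial_mul, mul_one]
      congr 1
      · congr 1
        ext v
        exact (Nat.div_add_mod (u v) (p ^ e)).symm
      · rw [← iterateFrobenius_def, ← iterateFrobeniusEquiv_apply, RingEquiv.apply_symm_apply]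
    rw [hu, map_mul, map_pow, tau_pow_mul, tau_pow_mul, map_mul, small b]
    intro v
    have := Nat.mod_lt (u v) hq
    change u v % p ^ e ≤ p ^ e - 1; omega
end tau
/-! ### Shears -/
section shear
variable {σ : Type} {K : Type} [Field K]
def IsShear (D : σ → Option σ) : Prop := ∀ v w, D v = some w → D w = none
noncomputable def shPt (D : σ → Option σ) {B : Type} [CommRing B] (t : B) (x : σ → B) : σ → B :=
  fun v => x v + t * (D v).elim 0 x
noncomputable def shear (D : σ → Option σ) (t : K) : MvPolynomial σ K →ₐ[K] MvPolynomial σ K :=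
  aeval (shPt D (C t) X)
noncomputable def gshear (D : σ → Option σ) :
    MvPolynomial σ K →ₐ[K] Polynomial (MvPolynomial σ K) :=
  aeval (shPt D Polynomial.X fun v => Polynomial.C (X v))
def Sinv (D : σ → Option σ) (f : MvPolynomial σ K) : Prop := ∀ t : K, shear D t f = f
lemma gshear_eval (D : σ → Option σ) (f : MvPolynomial σ K) (t : K) :
    (gshear D f).eval (C t) = shear D t f := by
  have : ((Polynomial.aeval (R := MvPolynomial σ K) (C t : MvPolynomial σ K)).restrictScalars K).comp
      (gshear D) = shear D t := by
    apply MvPolynomial.algHom_ext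
    intro v
    simp only [gshear, shear, AlgHom.comp_apply, aeval_X, shPt]
    cases D v with
    | none => simp
    | some w => simp; ring
  rw [← this]
  simp [Polynomial.aeval_def, Polynomial.eval₂_eq_eval_map]
lemma shear_zero (D : σ → Option σ) (f : MvPolynomial σ K) : shear D 0 f = f := by
  have : shear D (0 : K) = AlgHom.id K _ := by
    apply MvPolynomial.algHom_ext
    intro v; simp [shear, shPt]
  rw [this]; rfl
lemma poly_ext_C [Infinite K] {F G : Polynomial (MvPolynomial σ K)}
    (h : ∀ t : K, F.eval (C t) = G.eval (C t)) : F = G := by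
  refine Polynomial.eq_of_infinite_eval_eq F G ?_
  refine (Set.infinite_range_of_injective (C_injective σ K)).mono ?_
  rintro _ ⟨t, rfl⟩
  exact h t
lemma Sinv.gshear_eq [Infinite K] {D : σ → Option σ} {f : MvPolynomial σ K} (h : Sinv D f) :
    gshear D f = Polynomial.C f :=
  poly_ext_C fun t => by rw [gshear_eval, h t, Polynomial.eval_C]
lemma Sinv.of_gshear {D : σ → Option σ} {f : MvPolynomial σ K} (h : (gshear D f).natDegree = 0) :
    Sinv D f := by
  rw [Polynomial.natDegree_eq_zero] at h
  obtain ⟨a, ha⟩ := h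
  have h0 := gshear_eval D f 0
  rw [← ha, Polynomial.eval_C, shear_zero] at h0
  intro t
  rw [← gshear_eval, ← ha, Polynomial.eval_C, h0]
variable [Fintype σ] (p : ℕ) [Fact p.Prime] [CharP K p] [PerfectRing K p] (e : ℕ)
lemma tau_shear {D : σ → Option σ} (hD : IsShear D) (t : K) (f : MvPolynomial σ K) :
    tau p e (shear D t f) = shear D t (tau p e f) := by
  classical
  refine tau_comm p e _ (fun v => if D v = none then 0 else 1) ?_ ?_ f
  · intro v
    simp only [shear, aeval_X, shPt]
    refine (isHomogeneous_X K v).add ?_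
    cases D v with
    | none => simpa using isHomogeneous_zero σ K 1
    | some w => simpa using (isHomogeneous_C σ t).mul (isHomogeneous_X K w)
  · intro v
    simp only [shear, aeval_X, shPt]
    refine (Lead.X _ v).add ?_
    intro u hu
    cases h : D v with
    | none => simp [h] at hu
    | some w =>
      simp only [h, Option.elim, coeff_C_mul, coeff_X'] at hu
      split_ifs at hu with h2
      · rw [← h2, wt_single, wt_single]
        simp [h, hD v w h]
      · simp at hu
theorem tau_inv [Infinite K] {D : σ → Option σ} (hD : IsShear D) (f : MvPolynomial σ K)
    (hdeg : (gshear D f).natDegree < p ^ e) : Sinv D (tau p e f) := by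
  have hq := q_pos p e
  set F := gshear D f
  set H : Polynomial (MvPolynomial σ K) :=
    ∑ k ∈ Finset.range (F.natDegree + 1), Polynomial.C (tau p e (F.coeff k)) * Polynomial.X ^ k
  have key : Polynomial.expand _ (p ^ e) (gshear D (tau p e f)) = H := by
    apply poly_ext_C
    intro s
    rw [Polynomial.expand_eval, ← C_pow, gshear_eval, ← tau_shear p e hD, ← gshear_eval,
      Polynomial.eval_eq_sum_range, tau_sum, Polynomial.eval_finset_sum]
    refine Finset.sum_congr rfl fun k _ => ?_
    rw [C_pow, ← pow_mul, mul_comm (p ^ e) k, pow_mul, mul_comm, tau_pow_mul,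
      Polynomial.eval_mul, Polynomial.eval_C, Polynomial.eval_pow, Polynomial.eval_X, mul_comm]
  have h1 := congrArg Polynomial.natDegree key
  rw [Polynomial.natDegree_expand] at h1
  have h2 : H.natDegree ≤ F.natDegree := by
    refine Polynomial.natDegree_sum_le_of_forall_le _ _ fun k hk => ?_
    refine (Polynomial.natDegree_C_mul_X_pow_le _ _).trans ?_
    have := Finset.mem_range.1 hk; omega
  apply Sinv.of_gshear
  by_contra h
  have : p ^ e ≤ (gshear D (tau p e f)).natDegree * p ^ e := Nat.le_mul_of_pos_left _ (by omega)
  omega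
end shear
section vdet
variable {σ : Type} {K : Type} [Field K] {ι : Type} [Fintype ι] [DecidableEq ι]
noncomputable def vdet (K : Type) [Field K] (v : ι → ι → Option σ) : MvPolynomial σ K :=
  (of fun a b => (v a b).elim 0 X : Matrix ι ι (MvPolynomial σ K)).det
noncomputable def gdeg (D : σ → Option σ) (f : MvPolynomial σ K) : ℕ := (gshear D f).natDegree
lemma gdeg_mul (D : σ → Option σ) (f g : MvPolynomial σ K) : gdeg D (f * g) ≤ gdeg D f + gdeg D g := by
  unfold gdeg; rw [map_mul]; exact Polynomial.natDegree_mul_le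
lemma gdeg_pow (D : σ → Option σ) (f : MvPolynomial σ K) (k : ℕ) : gdeg D (f ^ k) ≤ k * gdeg D f := by
  unfold gdeg; rw [map_pow]; exact Polynomial.natDegree_pow_le
lemma gdeg_prod (D : σ → Option σ) {κ : Type} (s : Finset κ) (f : κ → MvPolynomial σ K) :
    gdeg D (∏ i ∈ s, f i) ≤ ∑ i ∈ s, gdeg D (f i) := by
  unfold gdeg; rw [map_prod]; exact Polynomial.natDegree_prod_le _ _
lemma gdeg_zero_iff [Infinite K] (D : σ → Option σ) (f : MvPolynomial σ K) :
    gdeg D f = 0 ↔ Sinv D f :=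
  ⟨Sinv.of_gshear, fun h => by unfold gdeg; rw [h.gshear_eq]; simp⟩
lemma vdet_transpose (v : ι → ι → Option σ) : vdet K (fun a b => v b a) = vdet K v := by
  unfold vdet; rw [← det_transpose]; rfl
lemma gshear_entry (D : σ → Option σ) (o : Option σ) :
    gshear D (o.elim 0 X : MvPolynomial σ K) = Polynomial.C (o.elim 0 X) +
      Polynomial.X * Polynomial.C ((o.bind D).elim 0 X) := by
  cases o with
  | none => simp
  | some v =>
    simp only [Option.elim, gshear, aeval_X, shPt, Option.bind]
    cases D v <;> simp
lemma gshear_vdet (D : σ → Option σ) (v : ι → ι → Option σ) : gshear D (vdet K v) =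
    (of fun a b => Polynomial.C ((v a b).elim 0 X : MvPolynomial σ K) +
      Polynomial.X * Polynomial.C (((v a b).bind D).elim 0 X)).det := by
  unfold vdet
  rw [← AlgHom.coe_toRingHom, RingHom.map_det]
  congr 1
  ext a b
  simp [gshear_entry]
lemma C_vdet (v : ι → ι → Option σ) : Polynomial.C (vdet K v) =
    (of fun a b => Polynomial.C ((v a b).elim 0 X : MvPolynomial σ K)).det := by
  unfold vdet
  rw [RingHom.map_det]; rfl
lemma gdeg_row_inv {D : σ → Option σ} {v : ι → ι → Option σ} (i j : ι) (hij : i ≠ j)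
    (h : ∀ a b, (v a b).bind D = if a = i then v j b else none) : gdeg D (vdet K v) = 0 := by
  have : gshear D (vdet K v) = Polynomial.C (vdet K v) := by
    rw [gshear_vdet, C_vdet]
    refine Eq.trans ?_ (det_updateRow_add_smul_self (of fun a b => Polynomial.C
      ((v a b).elim 0 X : MvPolynomial σ K)) hij Polynomial.X)
    congr 1
    refine Matrix.ext fun a b => ?_
    simp only [of_apply, h]
    by_cases ha : a = i
    · subst ha; simp
    · simp [ha]
  unfold gdeg; rw [this]; simp
lemma gdeg_untouched {D : σ → Option σ} {v : ι → ι → Option σ}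
    (h : ∀ a b, (v a b).bind D = none) : gdeg D (vdet K v) = 0 := by
  have : gshear D (vdet K v) = Polynomial.C (vdet K v) := by
    rw [gshear_vdet, C_vdet]; simp [h]
  unfold gdeg; rw [this]; simp
lemma gdeg_row_le {D : σ → Option σ} {v : ι → ι → Option σ} (i : ι)
    (h : ∀ a b, a ≠ i → (v a b).bind D = none) : gdeg D (vdet K v) ≤ 1 := by
  set M : Matrix ι ι (MvPolynomial σ K) := of fun a b => (v a b).elim 0 X
  set r : ι → MvPolynomial σ K := fun b => ((v i b).bind D).elim 0 X
  have : gshear D (vdet K v) = Polynomial.C M.det + Polynomial.X * Polynomial.C (M.updateRow i r).det := by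
    rw [gshear_vdet]
    have h1 : (of fun a b => Polynomial.C ((v a b).elim 0 X : MvPolynomial σ K) +
      Polynomial.X * Polynomial.C (((v a b).bind D).elim 0 X)) =
      (M.map Polynomial.C).updateRow i ((M.map Polynomial.C) i + (Polynomial.X : Polynomial (MvPolynomial σ K)) • fun b => Polynomial.C (r b)) := by
      ext a b : 2
      by_cases ha : a = i
      · subst ha; simp [M, r]
      · simp [ha, h a b ha, M]
    rw [h1, det_updateRow_add, det_updateRow_smul, updateRow_eq_self, RingHom.map_det, RingHom.map_det]
    congr 3
    ext a b : 2
    by_cases ha : a = i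
    · subst ha; simp
    · simp [ha]
  unfold gdeg
  rw [this]
  refine Polynomial.natDegree_add_le_of_degree_le (by simp) ?_
  refine Polynomial.natDegree_mul_le.trans ?_
  simp [Polynomial.natDegree_X_le]
lemma vdet_lead {w : σ → ℕ} {v : ι → ι → Option σ} (u : ι → σ) (hd : ∀ a, v a a = some (u a))
    (r c : ι → ℤ) (ρ κ : ι → ℤ)
    (hw : ∀ a b x, v a b = some x → (w x : ℤ) = r a * c b + ρ a + κ b)
    (hrc : ∀ a b, r a < r b ↔ c a < c b) (hinj : ∀ a b, r a = r b → a = b) :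
    Lead w (vdet K v) (∑ a, Finsupp.single (u a) 1) := by
  classical
  unfold vdet
  rw [det_apply, ← Finset.add_sum_erase _ _ (Finset.mem_univ (1 : Equiv.Perm ι))]
  have h1 : Lead w ((Equiv.Perm.sign (1 : Equiv.Perm ι) : ℤˣ) • ∏ a, (of fun a b => ((v a b).elim 0 X : MvPolynomial σ K)) ((1 : Equiv.Perm ι) a) a) (∑ a, Finsupp.single (u a) 1) := by
    have := Lead.prod (K := K) (w := w) Finset.univ (f := fun a => X (u a))
      (u := fun a => Finsupp.single (u a) 1) (fun a _ => Lead.X w (u a))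
    simpa [hd] using this
  refine h1.add ?_
  intro y hy
  rw [coeff_sum] at hy
  obtain ⟨g, hg, hy⟩ := Finset.exists_ne_zero_of_sum_ne_zero hy
  have hg1 : g ≠ 1 := (Finset.mem_erase.1 hg).1
  have hsome : ∀ a, ∃ x, v (g a) a = some x := by
    intro a
    by_contra hno
    have : v (g a) a = none := by
      cases hh : v (g a) a with
      | none => rfl
      | some x => exact absurd ⟨x, hh⟩ hno
    apply hy
    rw [Finset.prod_eq_zero (Finset.mem_univ a) (by simp [this])]
    simp
  choose x hx using hsome
  have hprod : ∏ a, (of fun a b => ((v a b).elim 0 X : MvPolynomial σ K)) (g a) a =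
      monomial (∑ a, Finsupp.single (x a) 1) 1 := by
    rw [monomial_sum_one]
    refine Finset.prod_congr rfl fun a _ => ?_
    simp [hx]; rfl
  rw [hprod] at hy
  have hyx : y = ∑ a, Finsupp.single (x a) 1 := by
    by_contra hne
    apply hy
    rw [Units.smul_def, zsmul_eq_mul, ← map_intCast (C : K →+* MvPolynomial σ K), coeff_C_mul, coeff_monomial, if_neg (Ne.symm hne), mul_zero]
  have wsum : ∀ z : ι → σ, wt w (∑ a, Finsupp.single (z a) 1) = ∑ a, w (z a) := by
    intro z
    have : ∀ s : Finset ι, wt w (∑ a ∈ s, Finsupp.single (z a) 1) = ∑ a ∈ s, w (z a) := by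
      intro s
      induction s using Finset.induction_on with
      | empty => simp [wt_zero]
      | insert a s ha ih => rw [Finset.sum_insert ha, Finset.sum_insert ha, wt_add, wt_single, ih]
    exact this _
  rw [hyx, wsum, wsum]
  zify
  simp_rw [hw _ _ _ (hx _), hw _ _ _ (hd _), Finset.sum_add_distrib]
  rw [Equiv.sum_comp g ρ]
  simp only [add_lt_add_iff_right]
  have hmono : Monovary c r := fun a b hab => ((hrc a b).1 hab).le
  have := hmono.sum_comp_perm_mul_lt_sum_mul_iff (σ := g⁻¹)
  have h3 : ∑ a, r (g a) * c a = ∑ a, c (g⁻¹ a) * r a := by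
    rw [← Equiv.sum_comp g (fun a => c (g⁻¹ a) * r a)]
    simp [mul_comm]
  have h4 : ∑ a, r a * c a = ∑ a, c a * r a := by simp [mul_comm]
  rw [h3, h4, this]
  intro hm
  have hmono2 : ∀ a b, r a < r b → r (g⁻¹ a) ≤ r (g⁻¹ b) := by
    intro a b hab
    have := hm hab
    by_contra hlt
    exact absurd this (not_le.2 ((hrc _ _).1 (not_le.1 hlt)))
  apply hg1
  letI : LinearOrder ι := LinearOrder.lift' r (fun a b h => hinj a b h)
  have hlt : ∀ a b : ι, a < b ↔ r a < r b := fun a b => Iff.rfl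
  have hle : ∀ a b : ι, a ≤ b ↔ r a ≤ r b := fun a b => Iff.rfl
  have hsm : StrictMono (g⁻¹ : Equiv.Perm ι) := by
    intro a b hab
    refine lt_of_le_of_ne ((hle _ _).2 (hmono2 a b ((hlt a b).1 hab))) ?_
    intro h; exact hab.ne ((g⁻¹).injective h)
  let iso : ι ≃o ι := hsm.orderIsoOfSurjective _ (g⁻¹).surjective
  have : iso = OrderIso.refl ι := Subsingleton.elim _ _
  have h5 : g⁻¹ = 1 := by
    ext a
    have := DFunLike.congr_fun this a
    simpa [iso] using this
  simpa using h5
end vdet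
section rename
variable {σ σ' : Type} {K : Type} [Field K]
lemma gshear_rename (τ : σ → σ') {D' : σ → Option σ} {D : σ' → Option σ'}
    (h : ∀ x, D (τ x) = (D' x).map τ) (f : MvPolynomial σ K) :
    gshear D (rename τ f) = (gshear D' f).map (rename τ).toRingHom := by
  have : (gshear D).comp (rename τ) =
      (Polynomial.mapAlgHom (rename (R := K) τ)).comp (gshear D') := by
    apply MvPolynomial.algHom_ext
    intro v
    simp only [AlgHom.comp_apply, rename_X, gshear, aeval_X, shPt, h]
    cases D' v <;> simp
  exact DFunLike.congr_fun this f
lemma gdeg_rename (τ : σ → σ') (hτ : Function.Injective τ) {D' : σ → Option σ}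
    {D : σ' → Option σ'} (h : ∀ x, D (τ x) = (D' x).map τ) (f : MvPolynomial σ K) :
    gdeg D (rename τ f) = gdeg D' f := by
  unfold gdeg
  rw [gshear_rename τ h, Polynomial.natDegree_map_eq_of_injective]
  exact rename_injective τ hτ
lemma Lead.rename {w : σ' → ℕ} (τ : σ → σ') (hτ : Function.Injective τ) {f : MvPolynomial σ K}
    {u : σ →₀ ℕ} (h : Lead (w ∘ τ) f u) : Lead w (rename τ f) (u.mapDomain τ) := by
  have hwt : ∀ v : σ →₀ ℕ, wt w (v.mapDomain τ) = wt (w ∘ τ) v := by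
    intro v
    unfold wt
    rw [Finsupp.sum_mapDomain_index (by simp) (by intros; ring)]
    rfl
  refine ⟨by rw [coeff_rename_mapDomain _ hτ]; exact h.1, fun v hv hne => ?_⟩
  obtain ⟨v', rfl, hv'⟩ := coeff_rename_ne_zero _ _ _ hv
  rw [hwt, hwt]
  exact h.2 v' hv' (fun h => hne (by rw [h]))
end rename
section blocks
variable {β : Type} {n : ℕ} {K : Type} [Field K]
def adj (i j : Fin n) : Prop := i.val + 1 = j.val ∨ j.val + 1 = i.val
def Ld (la : β → Bool) (i j : Fin n) : β ⊠ₙ n → Option (β ⊠ₙ n) :=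
  fun x => if la x.1 = true ∧ x.2.1 = i then some (x.1, j, x.2.2) else none
def Rd (ra : β → Bool) (i j : Fin n) : β ⊠ₙ n → Option (β ⊠ₙ n) :=
  fun x => if ra x.1 = true ∧ x.2.2 = i then some (x.1, x.2.1, j) else none
def tr : β ⊠ₙ n → β ⊠ₙ n := fun x => (x.1, x.2.2, x.2.1)
lemma tr_tr (x : β ⊠ₙ n) : tr (tr x) = x := rfl
lemma tr_inj : Function.Injective (tr : β ⊠ₙ n → _) :=
  Function.LeftInverse.injective tr_tr
lemma Ld_tr (la : β → Bool) (i j : Fin n) (x) : Ld la i j (tr x) = (Rd la i j x).map tr := by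
  by_cases h : la x.1 = true ∧ x.2.2 = i <;> simp [Ld, Rd, tr, h]
lemma Rd_tr (la : β → Bool) (i j : Fin n) (x) : Rd la i j (tr x) = (Ld la i j x).map tr := by
  by_cases h : la x.1 = true ∧ x.2.1 = i <;> simp [Ld, Rd, tr, h]
lemma gdeg_Ld_tr (la : β → Bool) (i j : Fin n) (f : MvPolynomial (β ⊠ₙ n) K) :
    gdeg (Ld la i j) (rename tr f) = gdeg (Rd la i j) f := gdeg_rename tr tr_inj (Ld_tr la i j) f
lemma gdeg_Rd_tr (la : β → Bool) (i j : Fin n) (f : MvPolynomial (β ⊠ₙ n) K) :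
    gdeg (Rd la i j) (rename tr f) = gdeg (Ld la i j) f := gdeg_rename tr tr_inj (Rd_tr la i j) f
lemma adj.ne {i j : Fin n} (h : adj i j) : i ≠ j := by
  rintro rfl; rcases h with h | h <;> omega
lemma isShear_Ld (la : β → Bool) {i j : Fin n} (h : i ≠ j) : IsShear (Ld la i j) := by
  intro v w hv
  simp only [Ld] at hv ⊢
  split_ifs at hv with h1
  cases hv
  simp [h.symm]
lemma isShear_Rd (la : β → Bool) {i j : Fin n} (h : i ≠ j) : IsShear (Rd la i j) := by
  intro v w hv
  simp only [Rd] at hv ⊢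
  split_ifs at hv with h1
  cases hv
  simp [h.symm]
variable (K)
noncomputable def pD (y : β) : MvPolynomial (β ⊠ₙ n) K :=
  vdet K fun a b : Fin n => some (y, a, b)
noncomputable def pU (y : β) (d : Fin n) : MvPolynomial (β ⊠ₙ n) K :=
  vdet K fun k l : Fin (n - d) => some (y, (⟨k, by omega⟩ : Fin n), (⟨l + d, by omega⟩ : Fin n))
noncomputable def pL (y : β) (d : Fin n) : MvPolynomial (β ⊠ₙ n) K :=
  rename tr (pU K y d)
def cRow (d : Fin n) : Fin (n - d) ⊕ Fin d ⊕ Fin (n - d) → Bool × Fin n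
  | .inl j => (false, ⟨j, by omega⟩)
  | .inr (.inl j) => (false, ⟨n - d + j, by omega⟩)
  | .inr (.inr j) => (true, ⟨j, by omega⟩)
def cCol (d : Fin n) : Fin (n - d) ⊕ Fin d ⊕ Fin (n - d) → Bool × Fin n
  | .inl j => (false, ⟨j + d, by omega⟩)
  | .inr (.inl j) => (true, ⟨j, by omega⟩)
  | .inr (.inr j) => (true, ⟨j + d, by omega⟩)
def cEnt (z x w : β) (r c : Bool × Fin n) : Option (β ⊠ₙ n) :=
  if r.1 then (if c.1 then some (w, r.2, c.2) else none)
  else (if c.1 then some (x, r.2, c.2) else some (z, r.2, c.2))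
noncomputable def pC (z x w : β) (d : Fin n) : MvPolynomial (β ⊠ₙ n) K :=
  vdet K fun k l => cEnt z x w (cRow d k) (cCol d l)
noncomputable def pC' (z x w : β) (d : Fin n) : MvPolynomial (β ⊠ₙ n) K :=
  rename tr (pC K z x w d)
variable (la : β → Bool)
lemma gdeg_pD_L (y : β) {i j : Fin n} (h : i ≠ j) : gdeg (Ld la i j) (pD K y) = 0 := by
  unfold pD
  by_cases hy : la y = true
  · refine gdeg_row_inv i j h fun a b => ?_
    simp [Ld, hy]
  · exact gdeg_untouched fun a b => by simp [Ld, hy]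
lemma pD_tr (y : β) : rename tr (pD K y : MvPolynomial (β ⊠ₙ n) K) = pD K y := by
  conv_rhs => rw [pD, ← vdet_transpose]
  unfold pD vdet
  rw [← AlgHom.coe_toRingHom, RingHom.map_det]
  congr 1
  ext a b : 2
  simp [tr]
lemma gdeg_pD_R (y : β) {i j : Fin n} (h : i ≠ j) : gdeg (Rd la i j) (pD K y) = 0 := by
  rw [← pD_tr, gdeg_Rd_tr, gdeg_pD_L K la y h]
lemma gdeg_pU_L (y : β) (d : Fin n) {i j : Fin n} (h : adj i j) :
    gdeg (Ld la i j) (pU K y d) ≤ if i.val + 1 = j.val ∧ j.val + d.val = n then 1 else 0 := by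
  unfold pU
  have hne := h.ne
  by_cases hy : la y = true
  · by_cases hi : i.val < n - d
    · by_cases hj : j.val < n - d
      · refine (gdeg_row_inv ⟨i, hi⟩ ⟨j, hj⟩ ?_ fun a b => ?_).le.trans (Nat.zero_le _)
        · simpa [Fin.ext_iff] using hne
        · simp [Ld, hy, Fin.ext_iff]
      · rw [if_pos (by rcases h with h | h <;> omega)]
        refine gdeg_row_le ⟨i, hi⟩ fun a b ha => ?_
        simp only [ne_eq, Fin.ext_iff] at ha
        simp [Ld, hy, Fin.ext_iff, ha]
    · refine (gdeg_untouched fun a b => ?_).le.trans (Nat.zero_le _)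
      have : a.val ≠ i.val := by omega
      simp [Ld, hy, Fin.ext_iff, this]
  · exact (gdeg_untouched fun a b => by simp [Ld, hy]).le.trans (Nat.zero_le _)
lemma gdeg_pU_R (y : β) (d : Fin n) {i j : Fin n} (h : adj i j) :
    gdeg (Rd la i j) (pU K y d) ≤ if j.val + 1 = i.val ∧ i = d then 1 else 0 := by
  unfold pU
  rw [← vdet_transpose]
  have hne := h.ne
  by_cases hy : la y = true
  · by_cases hi : d.val ≤ i.val
    · by_cases hj : d.val ≤ j.val
      · refine (gdeg_row_inv ⟨i - d, by omega⟩ ⟨j - d, by omega⟩ ?_ fun a b => ?_).le.trans (Nat.zero_le _)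
        · rcases h with h | h <;> simp only [ne_eq, Fin.ext_iff] <;> omega
        · have : a.val + d.val = i.val ↔ a.val = i.val - d.val := by omega
          simp [Ld, Rd, hy, Fin.ext_iff, this, Nat.sub_add_cancel hj]
      · rw [if_pos (by rw [Fin.ext_iff]; rcases h with h | h <;> omega)]
        refine gdeg_row_le ⟨i - d, by omega⟩ fun a b ha => ?_
        simp only [ne_eq, Fin.ext_iff] at ha
        have : a.val + d.val ≠ i.val := by omega
        simp [Rd, hy, Fin.ext_iff, this]
    · refine (gdeg_untouched fun a b => ?_).le.trans (Nat.zero_le _)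
      have : a.val + d.val ≠ i.val := by omega
      simp [Rd, hy, Fin.ext_iff, this]
  · exact (gdeg_untouched fun a b => by simp [Rd, hy]).le.trans (Nat.zero_le _)
lemma gdeg_pU_L0 (y : β) (d : Fin n) (hy : la y = false) {i j : Fin n} :
    gdeg (Ld la i j) (pU K y d) = 0 := gdeg_untouched fun a b => by simp [Ld, hy]
lemma gdeg_pU_R0 (y : β) (d : Fin n) (hy : la y = false) {i j : Fin n} :
    gdeg (Rd la i j) (pU K y d) = 0 := gdeg_untouched fun a b => by simp [Rd, hy]
lemma cRow_surj (d : Fin n) (a : Fin n) : ∃ k, cRow d k = (false, a) := by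
  by_cases h : a.val < n - d
  · exact ⟨.inl ⟨a, h⟩, rfl⟩
  · exact ⟨.inr (.inl ⟨a - (n - d), by omega⟩), by simp [cRow, Fin.ext_iff]; omega⟩
lemma cCol_surj (d : Fin n) (a : Fin n) : ∃ k, cCol d k = (true, a) := by
  by_cases h : a.val < d
  · exact ⟨.inr (.inl ⟨a, h⟩), rfl⟩
  · exact ⟨.inr (.inr ⟨a - d, by omega⟩), by simp [cCol, Fin.ext_iff]; omega⟩
lemma cRow_inj (d : Fin n) : Function.Injective (cRow d) := by
  rintro (a | a | a) (b | b | b) h <;> simp [cRow, Fin.ext_iff] at h ⊢ <;> omega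
lemma cCol_inj (d : Fin n) : Function.Injective (cCol d) := by
  rintro (a | a | a) (b | b | b) h <;> simp [cCol, Fin.ext_iff] at h ⊢ <;> omega
lemma gdeg_pC_L (z x w : β) (d : Fin n) (hz : la z = true) (hx : la x = true) (hw : la w = false)
    {i j : Fin n} (h : i ≠ j) : gdeg (Ld la i j) (pC K z x w d) = 0 := by
  obtain ⟨k, hk⟩ := cRow_surj d i
  obtain ⟨l, hl⟩ := cRow_surj d j
  refine gdeg_row_inv k l (by rintro rfl; rw [hk] at hl; simp at hl; exact h hl) fun a b => ?_
  have hak : a = k ↔ cRow d a = (false, i) := by rw [← hk, (cRow_inj d).eq_iff]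
  rw [hl]
  simp only [hak]
  generalize cRow d a = r
  generalize cCol d b = c
  obtain ⟨r1, r2⟩ := r
  obtain ⟨c1, c2⟩ := c
  cases r1 <;> cases c1 <;> simp [cEnt, Ld, hz, hx, hw]
lemma gdeg_pC_R (z x w : β) (d : Fin n) (hz : la z = false) (hx : la x = true) (hw : la w = true)
    {i j : Fin n} (h : i ≠ j) : gdeg (Rd la i j) (pC K z x w d) = 0 := by
  obtain ⟨k, hk⟩ := cCol_surj d i
  obtain ⟨l, hl⟩ := cCol_surj d j
  unfold pC
  rw [← vdet_transpose]
  refine gdeg_row_inv k l (by rintro rfl; rw [hk] at hl; simp at hl; exact h hl) fun a b => ?_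
  have hak : a = k ↔ cCol d a = (true, i) := by rw [← hk, (cCol_inj d).eq_iff]
  rw [hl]
  simp only [hak]
  generalize cRow d b = r
  generalize cCol d a = c
  obtain ⟨r1, r2⟩ := r
  obtain ⟨c1, c2⟩ := c
  cases r1 <;> cases c1 <;> simp [cEnt, Rd, hz, hx, hw]
/-! leading terms -/
def bw (s t : β → ℕ) : β ⊠ₙ n → ℕ :=
  fun x => x.2.1 * x.2.2 + s x.1 * x.2.1 + t x.1 * x.2.2
lemma bw_tr (s t : β → ℕ) : bw s t ∘ tr (n := n) = bw t s := by
  funext x; simp [bw, tr]; ring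
lemma lead_pD (s t : β → ℕ) (y : β) : Lead (bw s t) (pD K y) (∑ k : Fin n, Finsupp.single (y, k, k) 1) := by
  refine vdet_lead (fun a => (y, a, a)) (fun a => rfl) (fun a => a.val) (fun a => a.val)
    (fun a => s y * a.val) (fun b => t y * b.val) ?_ (fun a b => Iff.rfl) ?_
  · rintro a b _ ⟨⟩; simp [bw]
  · intro a b h; exact Fin.ext (by exact_mod_cast h)
lemma lead_pU (s t : β → ℕ) (y : β) (d : Fin n) : Lead (bw s t) (pU K y d)
    (∑ k : Fin (n - d), Finsupp.single (y, (⟨k, by omega⟩ : Fin n), (⟨k + d, by omega⟩ : Fin n)) 1) := by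
  refine vdet_lead (fun k : Fin (n - d) => (y, (⟨k, by omega⟩ : Fin n), (⟨k + d, by omega⟩ : Fin n)))
    (fun a => rfl) (fun a => a.val) (fun a => a.val + d.val)
    (fun a => s y * a.val) (fun b => t y * (b.val + d.val)) ?_ (fun a b => by omega) ?_
  · rintro a b _ ⟨⟩; simp [bw]
  · intro a b h; exact Fin.ext (by exact_mod_cast h)
lemma lead_pC (s t : β → ℕ) (z x w : β) (d : Fin n) (hs : s x = s z + n) (ht : t w = t x + n) :
    Lead (bw s t) (pC K z x w d)
    (∑ k : Fin (n - d), Finsupp.single (z, (⟨k, by omega⟩ : Fin n), (⟨k + d, by omega⟩ : Fin n)) 1 +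
     (∑ j : Fin d, Finsupp.single (x, (⟨n - d + j, by omega⟩ : Fin n), (⟨j, by omega⟩ : Fin n)) 1 +
      ∑ k : Fin (n - d), Finsupp.single (w, (⟨k, by omega⟩ : Fin n), (⟨k + d, by omega⟩ : Fin n)) 1)) := by
  have := vdet_lead (K := K) (w := bw s t) (v := fun k l => cEnt z x w (cRow d k) (cCol d l))
    (fun k => (match k with
      | .inl k => (z, (⟨k, by omega⟩ : Fin n), (⟨k + d, by omega⟩ : Fin n))
      | .inr (.inl j) => (x, (⟨n - d + j, by omega⟩ : Fin n), (⟨j, by omega⟩ : Fin n))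
      | .inr (.inr k) => (w, (⟨k, by omega⟩ : Fin n), (⟨k + d, by omega⟩ : Fin n)))) ?_
    (fun k => (cRow d k).2.val + if (cRow d k).1 then (n : ℤ) else 0)
    (fun k => (cCol d k).2.val + if (cCol d k).1 then (s x : ℤ) else s z)
    (fun k => if (cRow d k).1 then (s w - s x) * (cRow d k).2.val - n * s x else 0)
    (fun k => if (cCol d k).1 then t x * (cCol d k).2.val else t z * (cCol d k).2.val) ?_ ?_ ?_
  · rw [Fintype.sum_sum_type, Fintype.sum_sum_type] at this
    exact this
  · rintro (a | a | a) <;> rfl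
  · intro a b y
    generalize cRow d a = r
    generalize cCol d b = c
    obtain ⟨r1, r2⟩ := r
    obtain ⟨c1, c2⟩ := c
    cases r1 <;> cases c1 <;> simp [cEnt] <;> rintro rfl <;> simp [bw, ht] <;> ring
  · have hs' : (s x : ℤ) = s z + n := by exact_mod_cast hs
    have hd := d.2
    rintro (a | a | a) (b | b | b) <;> simp [cRow, cCol] <;> omega
  · rintro (a | a | a) (b | b | b) h <;> simp [cRow, Fin.ext_iff] at h ⊢ <;> omega
end blocks
section fs
variable {β : Type} {n : ℕ}
lemma sum_single_apply {ι α : Type} [Fintype ι] (g : ι → α) (hg : Function.Injective g) (x : α)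
    (P : Prop) [Decidable P] (h : P ↔ ∃ k, g k = x) :
    (∑ k, Finsupp.single (g k) 1 : α →₀ ℕ) x = if P then 1 else 0 := by
  classical
  rw [Finsupp.finsetSum_apply]
  split_ifs with hP
  · obtain ⟨k, rfl⟩ := h.1 hP
    rw [Finset.sum_eq_single k]
    · simp
    · intro b _ hb; rw [Finsupp.single_eq_of_ne]; exact fun h => hb (hg h.symm)
    · simp
  · apply Finset.sum_eq_zero
    intro k _
    rw [Finsupp.single_eq_of_ne]; intro hk; exact hP (h.2 ⟨k, hk.symm⟩)
abbrev nz (n : ℕ) : Finset (Fin n) := Finset.univ.filter fun d => d.val ≠ 0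
noncomputable def uD (y : β) : β ⊠ₙ n →₀ ℕ := ∑ k : Fin n, Finsupp.single (y, k, k) 1
noncomputable def uU (y : β) (d : Fin n) : β ⊠ₙ n →₀ ℕ :=
  ∑ k : Fin (n - d), Finsupp.single (y, (⟨k, by omega⟩ : Fin n), (⟨k + d, by omega⟩ : Fin n)) 1
noncomputable def uX (y : β) (d : Fin n) : β ⊠ₙ n →₀ ℕ :=
  ∑ j : Fin d, Finsupp.single (y, (⟨n - d + j, by omega⟩ : Fin n), (⟨j, by omega⟩ : Fin n)) 1
noncomputable def trH : (β ⊠ₙ n →₀ ℕ) →+ (β ⊠ₙ n →₀ ℕ) :=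
  Finsupp.mapDomain.addMonoidHom tr
lemma trH_apply (u : β ⊠ₙ n →₀ ℕ) (x) : trH u x = u (tr x) := by
  show (Finsupp.mapDomain tr u) x = _
  rw [← tr_tr x, Finsupp.mapDomain_apply tr_inj, tr_tr]
noncomputable def UU (y : β) : β ⊠ₙ n →₀ ℕ := ∑ d ∈ nz n, uU y d
noncomputable def LL (y : β) : β ⊠ₙ n →₀ ℕ := trH (UU y)
noncomputable def blk (y : β) : β ⊠ₙ n →₀ ℕ := uD y + UU y + LL y
open Classical in
lemma UU_apply (y : β) (x : β ⊠ₙ n) :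
    UU y x = if x.1 = y ∧ x.2.1 < x.2.2 then 1 else 0 := by
  obtain ⟨y', a, b⟩ := x
  unfold UU
  rw [Finsupp.finsetSum_apply]
  have h1 : ∀ d : Fin n, uU y d (y', a, b) = if y' = y ∧ a.val + d.val = b.val then 1 else 0 := by
    intro d
    unfold uU
    apply sum_single_apply
    · intro k l h; simp at h; omega
    · constructor
      · rintro ⟨rfl, h⟩
        exact ⟨⟨a, by omega⟩, by simp [Fin.ext_iff, h]⟩
      · rintro ⟨k, hk⟩
        simp [Fin.ext_iff] at hk
        exact ⟨hk.1.symm, by omega⟩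
  simp only [h1]
  split_ifs with h
  · obtain ⟨rfl, hab⟩ := h
    simp only [Fin.lt_def] at hab
    rw [Finset.sum_eq_single ⟨b - a, by omega⟩]
    · simp; omega
    · intro d _ hd
      simp [Fin.ext_iff] at hd ⊢; omega
    · simp; omega
  · apply Finset.sum_eq_zero
    intro d hd
    simp at hd
    rw [if_neg]
    rintro ⟨rfl, h2⟩
    exact h ⟨rfl, by show (_ : ℕ) < _; omega⟩
open Classical in
lemma LL_apply (y : β) (x : β ⊠ₙ n) :
    LL y x = if x.1 = y ∧ x.2.2 < x.2.1 then 1 else 0 := by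
  unfold LL; rw [trH_apply, UU_apply]; rfl
lemma trH_LL (y : β) : trH (LL y : β ⊠ₙ n →₀ ℕ) = UU y := by
  ext x; rw [trH_apply, LL, trH_apply]; rfl
lemma sum_uX (y : β) : ∑ d ∈ nz n, uX y d = (LL y : β ⊠ₙ n →₀ ℕ) := by
  classical
  ext ⟨y', a, b⟩
  rw [LL_apply, Finsupp.finsetSum_apply]
  have h1 : ∀ d : Fin n, uX y d (y', a, b) = if y' = y ∧ a.val + d.val = n + b.val ∧ b < d then 1 else 0 := by
    intro d
    unfold uX
    apply sum_single_apply
    · intro k l h; simp at h; omega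
    · constructor
      · rintro ⟨rfl, h, h2⟩
        exact ⟨⟨b, h2⟩, by simp [Fin.ext_iff]; omega⟩
      · rintro ⟨k, hk⟩
        simp [Fin.ext_iff] at hk
        exact ⟨hk.1.symm, by omega, by show (_ : ℕ) < _; omega⟩
  simp only [h1]
  split_ifs with h
  · obtain ⟨rfl, hab⟩ := h
    simp only [Fin.lt_def] at hab
    rw [Finset.sum_eq_single ⟨n + b - a, by omega⟩]
    · simp [Fin.lt_def]; omega
    · intro d _ hd
      simp [Fin.ext_iff] at hd ⊢; omega
    · simp; omega
  · apply Finset.sum_eq_zero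
    intro d hd
    rw [if_neg]
    rintro ⟨rfl, h2, h3⟩
    exact h ⟨rfl, by show (_ : ℕ) < _; omega⟩
open Classical in
lemma blk_apply (y : β) (x : β ⊠ₙ n) : blk y x = if x.1 = y then 1 else 0 := by
  obtain ⟨y', a, b⟩ := x
  unfold blk
  rw [Finsupp.add_apply, Finsupp.add_apply, UU_apply, LL_apply]
  have : uD y (y', a, b) = if y' = y ∧ a = b then 1 else 0 := by
    unfold uD
    apply sum_single_apply
    · intro k l h; simp at h; exact h
    · constructor
      · rintro ⟨rfl, rfl⟩; exact ⟨a, rfl⟩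
      · rintro ⟨k, hk⟩; simp at hk; exact ⟨hk.1.symm, by rw [← hk.2.1, hk.2.2]⟩
  rw [this]
  by_cases hy : y' = y
  · rcases lt_trichotomy a b with h | h | h
    · simp [hy, h, h.ne, h.not_gt]
    · simp [hy, h]
    · simp [hy, h, h.ne', h.not_gt]
  · simp [hy]
lemma sum_blk [Fintype β] : ∑ y : β, blk y = cst (β ⊠ₙ n) 1 := by
  classical
  ext x
  rw [Finsupp.finsetSum_apply]
  simp [blk_apply, cst]
end fs
section
variable {β : Type} {n : ℕ} (K : Type) [Field K]
lemma lead_pL (s t : β → ℕ) (y : β) (d : Fin n) : Lead (bw s t) (pL K y d) (trH (uU y d)) := by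
  apply Lead.rename tr tr_inj
  rw [bw_tr]; exact lead_pU K t s y d
lemma lead_pC2 (s t : β → ℕ) (z x w : β) (d : Fin n) (hs : s x = s z + n) (ht : t w = t x + n) :
    Lead (bw s t) (pC K z x w d) (uU z d + (uX x d + uU w d)) := lead_pC K s t z x w d hs ht
lemma lead_pC' (s t : β → ℕ) (z x w : β) (d : Fin n) (hs : t x = t z + n) (ht : s w = s x + n) :
    Lead (bw s t) (pC' K z x w d) (trH (uU z d + (uX x d + uU w d))) := by
  apply Lead.rename tr tr_inj
  rw [bw_tr]; exact lead_pC2 K t s z x w d hs ht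
noncomputable def pUs (y : β) : MvPolynomial (β ⊠ₙ n) K := ∏ d ∈ nz n, pU K y d
noncomputable def pLs (y : β) : MvPolynomial (β ⊠ₙ n) K := ∏ d ∈ nz n, pL K y d
noncomputable def eta (y : β) : MvPolynomial (β ⊠ₙ n) K := pD K y * pUs K y * pLs K y
lemma lead_pUs (s t : β → ℕ) (y : β) : Lead (bw s t) (pUs K y : MvPolynomial (β ⊠ₙ n) K) (UU y) :=
  Lead.prod _ fun d _ => lead_pU K s t y d
lemma lead_pLs (s t : β → ℕ) (y : β) : Lead (bw s t) (pLs K y : MvPolynomial (β ⊠ₙ n) K) (LL y) := by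
  unfold LL UU; rw [map_sum]
  exact Lead.prod _ fun d _ => lead_pL K s t y d
lemma lead_eta (s t : β → ℕ) (y : β) : Lead (bw s t) (eta K y : MvPolynomial (β ⊠ₙ n) K) (blk y) :=
  ((lead_pD K s t y).mul (lead_pUs K s t y)).mul (lead_pLs K s t y)
variable (la : β → Bool)
lemma sum_ite_le (P : Prop) [Decidable P] (Q : Fin n → Prop) [DecidablePred Q]
    (h : ∀ d d', Q d → Q d' → d = d') :
    ∑ d ∈ nz n, (if P ∧ Q d then 1 else 0) ≤ if P then 1 else 0 := by
  split_ifs with hP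
  · by_cases hQ : ∃ d, Q d
    · obtain ⟨d0, h0⟩ := hQ
      calc _ ≤ ∑ d ∈ nz n, (if d = d0 then 1 else 0) := by
            apply Finset.sum_le_sum
            intro d _
            by_cases hd : Q d
            · simp [hP, h d d0 hd h0, h0]
            · simp [hd]
        _ ≤ 1 := by rw [Finset.sum_ite_eq']; split_ifs <;> simp
    · push Not at hQ; simp [hQ]
  · simp [hP]
lemma gdeg_pUs_L (y : β) {i j : Fin n} (h : adj i j) :
    gdeg (Ld la i j) (pUs K y) ≤ if i.val + 1 = j.val then 1 else 0 := by
  unfold pUs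
  refine (gdeg_prod _ _ _).trans ((Finset.sum_le_sum fun d _ => gdeg_pU_L K la y d h).trans ?_)
  exact sum_ite_le _ (fun d => j.val + d.val = n) (fun d d' h h' => by omega)
lemma gdeg_pUs_R (y : β) {i j : Fin n} (h : adj i j) :
    gdeg (Rd la i j) (pUs K y) ≤ if j.val + 1 = i.val then 1 else 0 := by
  unfold pUs
  refine (gdeg_prod _ _ _).trans ((Finset.sum_le_sum fun d _ => gdeg_pU_R K la y d h).trans ?_)
  exact sum_ite_le _ (fun d => i = d) (fun d d' h h' => by rw [← h, h'])
lemma pLs_eq (y : β) : pLs K y = rename tr (pUs K y : MvPolynomial (β ⊠ₙ n) K) := by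
  unfold pLs pUs; rw [map_prod]; rfl
lemma gdeg_pLs_L (y : β) {i j : Fin n} (h : adj i j) :
    gdeg (Ld la i j) (pLs K y) ≤ if j.val + 1 = i.val then 1 else 0 := by
  rw [pLs_eq, gdeg_Ld_tr]; exact gdeg_pUs_R K la y h
lemma gdeg_pLs_R (y : β) {i j : Fin n} (h : adj i j) :
    gdeg (Rd la i j) (pLs K y) ≤ if i.val + 1 = j.val then 1 else 0 := by
  rw [pLs_eq, gdeg_Rd_tr]; exact gdeg_pUs_L K la y h
lemma gdeg_pUs_L0 (y : β) (hy : la y = false) {i j : Fin n} : gdeg (Ld la i j) (pUs K y) = 0 := by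
  unfold pUs
  exact Nat.le_zero.1 ((gdeg_prod _ _ _).trans (Finset.sum_nonpos fun d _ => (gdeg_pU_L0 K la y d hy).le))
lemma gdeg_pUs_R0 (y : β) (hy : la y = false) {i j : Fin n} : gdeg (Rd la i j) (pUs K y) = 0 := by
  unfold pUs
  exact Nat.le_zero.1 ((gdeg_prod _ _ _).trans (Finset.sum_nonpos fun d _ => (gdeg_pU_R0 K la y d hy).le))
lemma gdeg_pLs_L0 (y : β) (hy : la y = false) {i j : Fin n} : gdeg (Ld la i j) (pLs K y) = 0 := by
  rw [pLs_eq, gdeg_Ld_tr]; exact gdeg_pUs_R0 K la y hy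
lemma gdeg_pLs_R0 (y : β) (hy : la y = false) {i j : Fin n} : gdeg (Rd la i j) (pLs K y) = 0 := by
  rw [pLs_eq, gdeg_Rd_tr]; exact gdeg_pUs_L0 K la y hy
lemma gdeg_eta_L (y : β) {i j : Fin n} (h : adj i j) : gdeg (Ld la i j) (eta K y) ≤ 1 := by
  unfold eta
  refine (gdeg_mul _ _ _).trans ((add_le_add_left (gdeg_mul _ _ _) _).trans ?_)
  have h1 := gdeg_pD_L K la y h.ne
  have h2 := gdeg_pUs_L K la y h
  have h3 := gdeg_pLs_L K la y h
  rcases h with h | h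
  · rw [if_pos h] at h2; rw [if_neg (by omega)] at h3; omega
  · rw [if_neg (by omega)] at h2; rw [if_pos h] at h3; omega
lemma gdeg_eta_R (y : β) {i j : Fin n} (h : adj i j) : gdeg (Rd la i j) (eta K y) ≤ 1 := by
  unfold eta
  refine (gdeg_mul _ _ _).trans ((add_le_add_left (gdeg_mul _ _ _) _).trans ?_)
  have h1 := gdeg_pD_R K la y h.ne
  have h2 := gdeg_pUs_R K la y h
  have h3 := gdeg_pLs_R K la y h
  rcases h with h | h
  · rw [if_neg (by omega)] at h2; rw [if_pos h] at h3; omega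
  · rw [if_pos h] at h2; rw [if_neg (by omega)] at h3; omega
lemma gdeg_eta_L0 (y : β) (hy : la y = false) {i j : Fin n} (h : i ≠ j) : gdeg (Ld la i j) (eta K y) = 0 := by
  unfold eta
  have := (gdeg_mul (Ld la i j) (pD K y * pUs K y) (pLs K y)).trans (add_le_add_left (gdeg_mul _ _ _) _)
  rw [gdeg_pD_L K la y h, gdeg_pUs_L0 K la y hy, gdeg_pLs_L0 K la y hy] at this
  omega
lemma gdeg_eta_R0 (y : β) (hy : la y = false) {i j : Fin n} (h : i ≠ j) : gdeg (Rd la i j) (eta K y) = 0 := by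
  unfold eta
  have := (gdeg_mul (Rd la i j) (pD K y * pUs K y) (pLs K y)).trans (add_le_add_left (gdeg_mul _ _ _) _)
  rw [gdeg_pD_R K la y h, gdeg_pUs_R0 K la y hy, gdeg_pLs_R0 K la y hy] at this
  omega
end
section big
variable (K : Type) [Field K] (n m : ℕ)
abbrev Big (m : ℕ) := Fin m ⊕ Fin (m+1) ⊕ Fin (m+1)
abbrev bX {m} (i : Fin m) : Big m := .inl i
abbrev bZ {m} (i : Fin (m+1)) : Big m := .inr (.inl i)
abbrev bW {m} (i : Fin (m+1)) : Big m := .inr (.inr i)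
def bla {m} : Big m → Bool
  | .inr (.inr _) => false
  | _ => true
def bra {m} : Big m → Bool
  | .inr (.inl _) => false
  | _ => true
noncomputable def hC (i : Fin m) : MvPolynomial (Big m ⊠ₙ n) K :=
  (∏ d ∈ nz n, pC K (bZ i.castSucc) (bX i) (bW i.succ) d) *
  ∏ d ∈ nz n, pC' K (bW i.castSucc) (bX i) (bZ i.succ) d
noncomputable def hE : MvPolynomial (Big m ⊠ₙ n) K :=
  (pLs K (bZ 0) * pUs K (bZ (Fin.last m))) * (pUs K (bW 0) * pLs K (bW (Fin.last m)))
noncomputable def hbig : MvPolynomial (Big m ⊠ₙ n) K :=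
  (∏ y : Big m, pD K y) * (∏ i, hC K n m i) * hE K n m
def bs : Big m → ℕ
  | .inl i => 2*n*i + n
  | .inr (.inl k) => 2*n*k
  | .inr (.inr _) => 0
def bt : Big m → ℕ
  | .inl i => 2*n*i + n
  | .inr (.inl _) => 0
  | .inr (.inr k) => 2*n*k
lemma lead_hC (i : Fin m) : Lead (bw (bs n m) (bt n m)) (hC K n m i)
    ((UU (bZ i.castSucc) + (LL (bX i) + UU (bW i.succ))) +
      (LL (bW i.castSucc) + (UU (bX i) + LL (bZ i.succ)))) := by
  unfold hC
  apply Lead.mul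
  · have := Lead.prod (w := bw (bs n m) (bt n m)) (nz n) (f := fun d => pC K (bZ i.castSucc) (bX i) (bW i.succ) d)
      (fun d _ => lead_pC2 K (bs n m) (bt n m) (bZ i.castSucc) (bX i) (bW i.succ) d
        (by simp [bs]) (by simp [bt]; ring))
    rw [Finset.sum_add_distrib, Finset.sum_add_distrib, sum_uX] at this
    exact this
  · have := Lead.prod (w := bw (bs n m) (bt n m)) (nz n) (f := fun d => pC' K (bW i.castSucc) (bX i) (bZ i.succ) d)
      (fun d _ => lead_pC' K (bs n m) (bt n m) (bW i.castSucc) (bX i) (bZ i.succ) d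
        (by simp [bt]) (by simp [bs]; ring))
    rw [← map_sum, Finset.sum_add_distrib, Finset.sum_add_distrib, sum_uX, map_add, map_add, trH_LL] at this
    exact this
lemma lead_hbig : Lead (bw (bs n m) (bt n m)) (hbig K n m) (cst _ 1) := by
  have h := ((Lead.prod (w := bw (bs n m) (bt n m)) Finset.univ (f := fun y : Big m => pD (n := n) K y)
    fun y _ => lead_pD K _ _ y).mul
    (Lead.prod Finset.univ fun i _ => lead_hC K n m i)).mul
    (((lead_pLs K (bs n m) (bt n m) (bZ 0)).mul (lead_pUs K (bs n m) (bt n m) (bZ (Fin.last m)))).mul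
     ((lead_pUs K (bs n m) (bt n m) (bW 0)).mul (lead_pLs K (bs n m) (bt n m) (bW (Fin.last m)))))
  have e : ∀ u v (f : MvPolynomial (Big m ⊠ₙ n) K), u = v → Lead (bw (bs n m) (bt n m)) f u →
      Lead (bw (bs n m) (bt n m)) f v := by
    rintro u v f rfl h; exact h
  refine e _ _ _ ?_ h
  symm
  rw [← sum_blk]
  unfold blk
  have e1 := Fin.sum_univ_castSucc fun k : Fin (m+1) => (UU (bZ k) : Big m ⊠ₙ n →₀ ℕ)
  have e2 := Fin.sum_univ_succ fun k : Fin (m+1) => (LL (bZ k) : Big m ⊠ₙ n →₀ ℕ)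
  have e3 := Fin.sum_univ_succ fun k : Fin (m+1) => (UU (bW k) : Big m ⊠ₙ n →₀ ℕ)
  have e4 := Fin.sum_univ_castSucc fun k : Fin (m+1) => (LL (bW k) : Big m ⊠ₙ n →₀ ℕ)
  simp only [Finset.sum_add_distrib, add_assoc]
  rw [Fintype.sum_sum_type UU, Fintype.sum_sum_type LL, Fintype.sum_sum_type (fun x => UU (Sum.inr x)),
    Fintype.sum_sum_type (fun x => LL (Sum.inr x)), e1, e2, e3, e4]
  unfold uD
  abel
lemma gdeg_hC (D) (i : Fin m)
   (h1 : ∀ d, gdeg D (pC K (bZ i.castSucc) (bX i) (bW i.succ) d) = 0)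
   (h2 : ∀ d, gdeg D (pC' K (bW i.castSucc) (bX i) (bZ i.succ) d) = 0) : gdeg D (hC K n m i) = 0 := by
  apply Nat.le_zero.1
  unfold hC
  refine (gdeg_mul _ _ _).trans ((add_le_add (gdeg_prod _ _ _) (gdeg_prod _ _ _)).trans ?_)
  simp [h1, h2]
lemma gdeg_hbig (D) (h1 : ∀ y : Big m, gdeg D (pD (n := n) K y) = 0) (h2 : ∀ i, gdeg D (hC K n m i) = 0)
    (h3 : gdeg D (hE K n m) ≤ 1) : gdeg D (hbig K n m) ≤ 1 := by
  unfold hbig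
  refine (gdeg_mul _ _ _).trans ((add_le_add_left ((gdeg_mul _ _ _).trans (add_le_add (gdeg_prod _ _ _) (gdeg_prod _ _ _))) _).trans ?_)
  simp [h1, h2, h3]
lemma gdeg_hbig_L {i j : Fin n} (h : adj i j) : gdeg (Ld bla i j) (hbig K n m) ≤ 1 := by
  apply gdeg_hbig
  · intro y; exact gdeg_pD_L K _ y h.ne
  · intro k
    apply gdeg_hC
    · intro d; exact gdeg_pC_L K _ _ _ _ d rfl rfl rfl h.ne
    · intro d; unfold pC'; rw [gdeg_Ld_tr]; exact gdeg_pC_R K _ _ _ _ d rfl rfl rfl h.ne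
  · unfold hE
    refine (gdeg_mul _ _ _).trans ((add_le_add (gdeg_mul _ _ _) (gdeg_mul _ _ _)).trans ?_)
    rw [gdeg_pUs_L0 K bla (bW 0) rfl, gdeg_pLs_L0 K bla (bW _) rfl]
    have h2 := gdeg_pUs_L K bla (bZ (Fin.last m)) h
    have h3 := gdeg_pLs_L K bla (bZ (0 : Fin (m+1))) h
    rcases h with h | h
    · rw [if_pos h] at h2; rw [if_neg (by omega)] at h3; omega
    · rw [if_neg (by omega)] at h2; rw [if_pos h] at h3; omega
lemma gdeg_hbig_R {i j : Fin n} (h : adj i j) : gdeg (Rd bra i j) (hbig K n m) ≤ 1 := by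
  apply gdeg_hbig
  · intro y; exact gdeg_pD_R K _ y h.ne
  · intro k
    apply gdeg_hC
    · intro d; exact gdeg_pC_R K _ _ _ _ d rfl rfl rfl h.ne
    · intro d; unfold pC'; rw [gdeg_Rd_tr]; exact gdeg_pC_L K _ _ _ _ d rfl rfl rfl h.ne
  · unfold hE
    refine (gdeg_mul _ _ _).trans ((add_le_add (gdeg_mul _ _ _) (gdeg_mul _ _ _)).trans ?_)
    rw [gdeg_pUs_R0 K bra (bZ _) rfl, gdeg_pLs_R0 K bra (bZ _) rfl]
    have h2 := gdeg_pUs_R K bra (bW (0 : Fin (m+1))) h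
    have h3 := gdeg_pLs_R K bra (bW (Fin.last m)) h
    rcases h with h | h
    · rw [if_pos h] at h3; rw [if_neg (by omega)] at h2; omega
    · rw [if_neg (by omega)] at h3; rw [if_pos h] at h2; omega
lemma hbig_dvd : ∃ h', hbig K n m = (pD K (bZ 0) * pD K (bW 0)) * h' := by
  have : hbig K n m = (∏ i, pD K (bX i)) * ((∏ k, pD K (bZ k)) * ∏ k, pD K (bW k)) * (∏ i, hC K n m i) * hE K n m := by
    unfold hbig; rw [Fintype.prod_sum_type, Fintype.prod_sum_type]
  rw [this, Fin.prod_univ_succ, Fin.prod_univ_succ (fun k => pD K (bW k))]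
  exact ⟨(∏ i, pD K (bX i)) * ((∏ k : Fin m, pD K (bZ k.succ)) * ∏ k : Fin m, pD K (bW k.succ)) * (∏ i, hC K n m i) * hE K n m, by ring⟩
end big
section act
variable {β : Type} {n : ℕ}
def pt {T : Type} (x : β → Mt n T) : β ⊠ₙ n → T :=
  fun p => x p.1 p.2.1 p.2.2
noncomputable def gX (β : Type) (n : ℕ) (T : Type) [CommRing T] (k : β) :
    Mt n (MvPolynomial (β ⊠ₙ n) T) := of fun i j => X (k, i, j)
variable {K : Type} [Field K]
noncomputable def sbs {T : Type} [CommRing T] [Algebra K T] (a b : Mt n T) :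
    MvPolynomial (β ⊠ₙ n) K →ₐ[K] MvPolynomial (β ⊠ₙ n) T :=
  aeval (pt fun k => a.map C * gX β n T k * b.map C)
lemma sbs_X {T : Type} [CommRing T] [Algebra K T] (a b : Mt n T) (k : β) (i j : Fin n) :
    sbs (K := K) a b (X (k, i, j)) = (a.map C * gX β n T k * b.map C : Mt n (MvPolynomial (β ⊠ₙ n) T)) i j := by
  simp [sbs, pt]
lemma map_sbs {T T' : Type} [CommRing T] [Algebra K T] [CommRing T'] [Algebra K T'] (g : T →ₐ[K] T')
    (a b : Mt n T) (f : MvPolynomial (β ⊠ₙ n) K) :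
    map g.toRingHom (sbs a b f) = sbs (a.map g) (b.map g) f := by
  have : (MvPolynomial.mapAlgHom (σ := β ⊠ₙ n) g).comp (sbs (K := K) a b) = sbs (a.map g) (b.map g) := by
    apply MvPolynomial.algHom_ext
    rintro ⟨k, i, j⟩
    rw [AlgHom.comp_apply, sbs_X, sbs_X]
    simp [Matrix.mul_apply, gX]
  exact DFunLike.congr_fun this f
lemma eval_sbs (a b : Mt n K) (x : β → Mt n K)
    (f : MvPolynomial (β ⊠ₙ n) K) :
    aeval (R := K) (pt x) (sbs (K := K) a b f) = aeval (R := K) (pt fun k => a * x k * b) f := by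
  have : (aeval (R := K) (pt x)).comp (sbs (K := K) a b) = aeval (R := K) (pt fun k => a * x k * b) := by
    apply MvPolynomial.algHom_ext
    rintro ⟨k, i, j⟩
    rw [AlgHom.comp_apply, sbs_X]
    simp [Matrix.mul_apply, gX, pt]
  exact DFunLike.congr_fun this f
lemma sbs_sbs (a b a' b' : Mt n K) (f : MvPolynomial (β ⊠ₙ n) K) :
    sbs (K := K) a' b' (sbs (K := K) a b f) = sbs (K := K) (a * a') (b' * b) f := by
  have : (sbs (K := K) a' b').comp (sbs (K := K) a b) = sbs (β := β) (K := K) (a * a') (b' * b) := by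
    apply MvPolynomial.algHom_ext
    rintro ⟨k, i, j⟩
    rw [AlgHom.comp_apply, sbs_X, sbs_X]
    have h : ((a.map C * gX β n K k * b.map C).map (sbs (K := K) a' b')) =
       ((a * a').map C * gX β n K k * (b' * b).map C) := by
      have e1 : ∀ c : Mt n K, (c.map (C (σ := β ⊠ₙ n))).map (sbs (K := K) a' b') = c.map C := by
        intro c; exact Matrix.ext fun i j => (sbs (K := K) a' b').commutes (c i j)
      have e2 : (gX β n K k).map (sbs (K := K) a' b') = a'.map C * gX β n K k * b'.map C := by
        ext i j : 2; simp [gX, sbs_X]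
      have e3 : ∀ M N : Mt n (MvPolynomial (β ⊠ₙ n) K),
          (M * N).map (sbs (K := K) a' b') = M.map (sbs (K := K) a' b') * N.map (sbs (K := K) a' b') := by
        intro M N; exact Matrix.map_mul (f := (sbs (K := K) a' b').toRingHom)
      rw [e3, e3, e1, e1, e2, Matrix.map_mul, Matrix.map_mul]
      simp only [Matrix.mul_assoc]
    exact congrFun (congrFun h i) j
  exact DFunLike.congr_fun this f
lemma sbs_one (f : MvPolynomial (β ⊠ₙ n) K) : sbs (1 : Mt n K) 1 f = f := by
  have : sbs (1 : Mt n K) 1 = AlgHom.id K (MvPolynomial (β ⊠ₙ n) K) := by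
    apply MvPolynomial.algHom_ext
    rintro ⟨k, i, j⟩
    rw [sbs_X]
    rw [Matrix.map_one _ (map_zero _) (map_one _), one_mul, mul_one]; rfl
  exact DFunLike.congr_fun this f
abbrev tt : β → Bool := fun _ => true
lemma trv_mul {T : Type} [CommRing T] (i j : Fin n) (t : T) (M : Mt n T) (a b : Fin n) :
    (transvection i j t * M) a b = M a b + if a = i then t * M j b else 0 := by
  rw [transvection, add_mul, one_mul, Matrix.add_apply]
  congr 1
  split_ifs with h
  · subst h; rw [single_mul_apply_same]
  · rw [single_mul_apply_of_ne _ _ _ _ _ h]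
lemma mul_trv {T : Type} [CommRing T] (i j : Fin n) (t : T) (M : Mt n T) (a b : Fin n) :
    (M * transvection i j t) a b = M a b + if b = j then t * M a i else 0 := by
  rw [transvection, mul_add, mul_one, Matrix.add_apply]
  congr 1
  split_ifs with h
  · subst h; rw [mul_single_apply_same, mul_comm]
  · rw [mul_single_apply_of_ne _ _ _ _ _ h]
lemma trv_map {T T' : Type} [CommRing T] [CommRing T'] (g : T →+* T') (i j : Fin n) (t : T) :
    (transvection i j t).map g = transvection i j (g t) := by
  ext a b
  simp [transvection, Matrix.one_apply, Matrix.single_apply, apply_ite g]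
lemma shear_L (i j : Fin n) (t : K) : shear (Ld tt i j) t = sbs (β := β) (K := K) (transvection i j t) 1 := by
  apply MvPolynomial.algHom_ext
  rintro ⟨k, a, b⟩
  rw [sbs_X, Matrix.map_one _ (map_zero _) (map_one _), mul_one, trv_map, trv_mul]
  simp only [shear, aeval_X, shPt, Ld, gX, of_apply]
  by_cases h : a = i <;> simp [h]
lemma shear_R (i j : Fin n) (t : K) : shear (Rd tt i j) t = sbs (β := β) (K := K) 1 (transvection j i t) := by
  apply MvPolynomial.algHom_ext
  rintro ⟨k, a, b⟩
  rw [sbs_X, Matrix.map_one _ (map_zero _) (map_one _), one_mul, trv_map, mul_trv]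
  simp only [shear, aeval_X, shPt, Rd, gX, of_apply]
  by_cases h : b = i <;> simp [h]
lemma adj.symm {i j : Fin n} (h : adj i j) : adj j i := Or.symm h
lemma sbs_split (a b : Mt n K) (f : MvPolynomial (β ⊠ₙ n) K) :
    sbs (K := K) a b f = sbs (K := K) a 1 (sbs (K := K) 1 b f) := by
  rw [sbs_sbs, one_mul, one_mul]
lemma sl_L (P : MvPolynomial (β ⊠ₙ n) K → MvPolynomial (β ⊠ₙ n) K → Prop)
    (hr : ∀ f, P f f) (ht : ∀ f g h, P f g → P g h → P f h) (f)
    (h : ∀ i j : Fin n, adj i j → ∀ t (f : MvPolynomial (β ⊠ₙ n) K), P f (shear (Ld tt i j) t f))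
    (a : Mt n K) (ha : a.det = 1) : P f (sbs (K := K) a 1 f) := by
  revert f
  refine slGen n (fun a => ∀ f, P f (sbs (K := K) a 1 f)) ?_ ?_ ?_ a ha
  · intro f; rw [sbs_one]; exact hr f
  · intro A B hA hB f
    have := sbs_sbs A 1 B 1 f
    rw [mul_one] at this
    rw [← this]
    exact ht _ _ _ (hA f) (hB _)
  · intro i j hij t f
    have := h i j hij t f
    rwa [shear_L] at this
lemma sl_R (P : MvPolynomial (β ⊠ₙ n) K → MvPolynomial (β ⊠ₙ n) K → Prop)
    (hr : ∀ f, P f f) (ht : ∀ f g h, P f g → P g h → P f h) (f)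
    (h : ∀ i j : Fin n, adj i j → ∀ t (f : MvPolynomial (β ⊠ₙ n) K), P f (shear (Rd tt i j) t f))
    (a : Mt n K) (ha : a.det = 1) : P f (sbs (K := K) 1 a f) := by
  revert f
  refine slGen n (fun a => ∀ f, P f (sbs (K := K) 1 a f)) ?_ ?_ ?_ a ha
  · intro f; rw [sbs_one]; exact hr f
  · intro A B hA hB f
    have := sbs_sbs 1 B 1 A f
    rw [mul_one] at this
    rw [← this]
    exact ht _ _ _ (hB f) (hA _)
  · intro i j hij t f
    have := h j i (adj.symm hij) t f
    rwa [shear_R] at this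
def GInv (f : MvPolynomial (β ⊠ₙ n) K) : Prop :=
  ∀ a b : Mt n K, a.det = 1 → b.det = 1 → sbs (K := K) a b f = f
lemma GInv_of_shear {f : MvPolynomial (β ⊠ₙ n) K}
    (hL : ∀ i j, adj i j → Sinv (Ld tt i j) f) (hR : ∀ i j, adj i j → Sinv (Rd tt i j) f) : GInv f := by
  intro a b ha hb
  have h1 : sbs (K := K) 1 b f = f := by
    refine slGen n (fun b => sbs (K := K) 1 b f = f) (sbs_one f) ?_ ?_ b hb
    · intro A B hA hB
      have := sbs_sbs 1 B 1 A f
      rw [mul_one, hB, hA] at this; exact this.symm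
    · intro i j hij t
      have := hR j i (adj.symm hij) t
      rwa [shear_R] at this
  rw [sbs_split, h1]
  refine slGen n (fun b => sbs (K := K) b 1 f = f) (sbs_one f) ?_ ?_ a ha
  · intro A B hA hB
    have := sbs_sbs A 1 B 1 f
    rw [mul_one, hA, hB] at this; exact this.symm
  · intro i j hij t
    have := hL i j hij t
    rwa [shear_L] at this
lemma GInv.L {f : MvPolynomial (β ⊠ₙ n) K} (h : GInv f) {i j} (hij : i ≠ j) : Sinv (Ld tt i j) f := by
  intro t; rw [shear_L]; exact h _ _ (det_transvection_of_ne i j hij t) det_one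
lemma GInv.R {f : MvPolynomial (β ⊠ₙ n) K} (h : GInv f) {i j} (hij : i ≠ j) : Sinv (Rd tt i j) f := by
  intro t; rw [shear_R]; exact h _ _ det_one (det_transvection_of_ne j i hij.symm t)
lemma mem_R [Infinite K] {m : ℕ} (f : MvPolynomial (Fin m ⊠ₙ n) K) :
    f ∈ matrixSemiInvariants K n m ↔ GInv f := by
  simp only [matrixSemiInvariants, Algebra.mem_iInf, AlgHom.mem_equalizer]
  constructor
  · intro h a b ha hb
    apply MvPolynomial.funext
    intro x
    have e1 := eval_sbs a b (fun k => of fun i j => x (k, i, j)) f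
    obtain ⟨B, hB⟩ : ∃ B : SpecialLinearGroup (Fin n) K, B.val = b := ⟨⟨b, hb⟩, rfl⟩
    have e2 := h ⟨a, ha⟩ B⁻¹ (fun k => of fun i j => x (k, i, j))
    rw [inv_inv, hB] at e2
    exact e1.trans e2
  · intro h A B X
    have := h A.val (B⁻¹).val A.2 (B⁻¹).2
    have e := eval_sbs A.val (B⁻¹).val X f
    rw [this] at e
    exact e.symm
variable [Fintype β] (p : ℕ) [Fact p.Prime] [CharP K p] [PerfectRing K p] (e : ℕ)
lemma coeff_shear {σ : Type} [Fintype σ] {D : σ → Option σ} (hD : IsShear D) (t : K) (f : MvPolynomial σ K) :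
    coeff (cst σ (p ^ e - 1)) (shear D t f) = coeff (cst σ (p ^ e - 1)) f := by
  have h := congrArg (coeff 0) (tau_shear p e hD t f)
  have key : ∀ g : MvPolynomial σ K, coeff 0 (shear D t g) = coeff 0 g := by
    intro g
    have : (constantCoeff (R := K) (σ := σ)).comp (shear D t).toRingHom = constantCoeff := by
      apply MvPolynomial.ringHom_ext
      · intro r; simp [← algebraMap_eq]
      · intro i; cases h : D i <;> simp [h, shear, shPt]
    exact DFunLike.congr_fun this g
  rw [key, coeff_tau, coeff_tau] at h
  simpa using (iterateFrobeniusEquiv K p e).symm.injective h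
lemma coeff_sbs (a b : Mt n K) (ha : a.det = 1) (hb : b.det = 1)
    (f : MvPolynomial (β ⊠ₙ n) K) :
    coeff (cst _ (p ^ e - 1)) (sbs (K := K) a b f) = coeff (cst _ (p ^ e - 1)) f := by
  rw [sbs_split]
  rw [← sl_L (fun f g => coeff (cst _ (p ^ e - 1)) f = coeff (cst _ (p ^ e - 1)) g) (fun _ => rfl)
    (fun _ _ _ h1 h2 => h1.trans h2) _ (fun i j hij t f => (coeff_shear p e (isShear_Ld _ hij.ne) t f).symm) a ha]
  rw [← sl_R (fun f g => coeff (cst _ (p ^ e - 1)) f = coeff (cst _ (p ^ e - 1)) g) (fun _ => rfl)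
    (fun _ _ _ h1 h2 => h1.trans h2) _ (fun i j hij t f => (coeff_shear p e (isShear_Rd _ hij.ne) t f).symm) b hb]
end act
section endgame
variable {K : Type} [Field K] [IsAlgClosed K] {R : Type} [CommRing R] [IsDomain R] [Algebra K R]
def SopReg (K R : Type) [Field K] [CommRing R] [Algebra K R] : Prop :=
  ∀ (d : ℕ) (θ : MvPolynomial (Fin d) K →ₐ[K] R), Function.Injective θ → θ.Finite →
    ∀ (i : Fin d) (r : R), r * θ (X i) ∈ Ideal.span ((fun j => θ (X j)) '' {j | j < i}) →
      r ∈ Ideal.span ((fun j => θ (X j)) '' {j | j < i})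
theorem CM_of_SopReg [Algebra.FiniteType K R] (H : SopReg K R) : IsCohenMacaulayRing R := by
  intro p hp
  haveI := hp.isPrime
  haveI : IsNoetherianRing R := Algebra.FiniteType.isNoetherianRing K R
  obtain ⟨d, θ, hinj, hfin⟩ := exists_finite_inj_algHom_of_fg K R
  letI : Field (R ⧸ p) := Ideal.Quotient.field p
  haveI : Module.Finite K (R ⧸ p) := finite_of_finite_type_of_isJacobsonRing K (R ⧸ p)
  have hbij : Function.Bijective (algebraMap K (R ⧸ p)) :=
    IsAlgClosed.algebraMap_bijective_of_isIntegral
  choose a ha using fun j => hbij.2 (Ideal.Quotient.mk p (θ (X j)))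
  set sh : (Fin d → K) → MvPolynomial (Fin d) K →ₐ[K] MvPolynomial (Fin d) K := fun a =>
    aeval fun j => X j + C (a j)
  have hsh : ∀ a b, b = -a → (sh a).comp (sh b) = AlgHom.id K _ := by
    rintro a _ rfl
    apply MvPolynomial.algHom_ext
    intro j
    simp [sh]
  set θ' : MvPolynomial (Fin d) K →ₐ[K] R := θ.comp (sh (-a))
  have e1 := hsh a (-a) rfl
  have e2 := hsh (-a) a (by simp)
  have bij : Function.Bijective (sh (-a)) :=
    ⟨Function.LeftInverse.injective (g := sh a) fun f => DFunLike.congr_fun e1 f,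
     Function.RightInverse.surjective (g := sh a) fun f => DFunLike.congr_fun e2 f⟩
  have hinj' : Function.Injective θ' := hinj.comp bij.1
  have hfin' : θ'.Finite := hfin.comp (AlgHom.Finite.of_surjective _ bij.2)
  set x : Fin d → R := fun j => θ' (X j)
  have hxp : ∀ j, x j ∈ p := by
    intro j
    rw [← Ideal.Quotient.eq_zero_iff_mem]
    have : x j = θ (X j) - algebraMap K R (a j) := by
      simp [x, θ', sh, sub_eq_add_neg]
    rw [this, map_sub, ← ha]
    exact sub_self _
  have hreg : RingTheory.Sequence.IsWeaklyRegular R (List.ofFn x) := by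
    constructor
    intro i hi
    have hi' : i < d := by simpa using hi
    have hof : Ideal.ofList ((List.ofFn x).take i) = Ideal.span (x '' {j | j < ⟨i, hi'⟩}) := by
      unfold Ideal.ofList
      congr 1
      ext r
      simp only [Set.mem_setOf_eq, Set.mem_image, List.mem_take_iff_getElem, List.length_ofFn,
        List.getElem_ofFn]
      constructor
      · rintro ⟨k, hk, rfl⟩
        exact ⟨⟨k, by omega⟩, by simp only [Fin.mk_lt_mk]; omega, rfl⟩
      · rintro ⟨k, hk, rfl⟩
        exact ⟨k.1, by have : k.1 < i := hk; omega, rfl⟩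
    have : (Ideal.ofList ((List.ofFn x).take i) • ⊤ : Submodule R R) =
        Ideal.span (x '' {j | j < ⟨i, hi'⟩}) := by rw [hof]; simp
    rw [this, isSMulRegular_iff_right_eq_zero_of_smul]
    intro y hy
    obtain ⟨r, rfl⟩ := Submodule.Quotient.mk_surjective _ y
    rw [← Submodule.Quotient.mk_smul, Submodule.Quotient.mk_eq_zero] at hy
    rw [Submodule.Quotient.mk_eq_zero]
    refine H d θ' hinj' hfin' ⟨i, hi'⟩ r ?_
    simpa [x, mul_comm] using hy
  have hreg2 := hreg.isRegular_of_isLocalization_of_mem (Localization.AtPrime p) p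
    (by intro r hr; rw [List.mem_ofFn] at hr; obtain ⟨j, rfl⟩ := hr; exact hxp j)
  have hmax : ∀ q : Ideal R, q.IsPrime → (∀ j, x j ∈ q) → q.IsMaximal := by
    intro q hq hxq
    have hint : θ'.toRingHom.IsIntegral := RingHom.Finite.to_isIntegral hfin'
    refine Ideal.isMaximal_of_isIntegral_of_isMaximal_comap' θ'.toRingHom hint q ?_
    have : q.comap θ'.toRingHom = RingHom.ker (constantCoeff : MvPolynomial (Fin d) K →+* K) := by
      symm
      refine Ideal.IsMaximal.eq_of_le (RingHom.ker_isMaximal_of_surjective _ ?_)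
        (Ideal.IsPrime.ne_top (Ideal.IsPrime.comap _)) ?_
      · intro k; exact ⟨C k, by simp⟩
      · intro f hf
        have : f ∈ Ideal.span (Set.range (X : Fin d → MvPolynomial (Fin d) K)) := by
          rw [← Set.image_univ, mem_ideal_span_X_image]
          intro m hm
          by_contra h
          push Not at h
          have : m = 0 := by ext v; simpa using h v
          rw [this] at hm
          rw [RingHom.mem_ker] at hf
          simp at hm
          exact hm (by simpa [constantCoeff_eq] using hf)
        have hle : Ideal.span (Set.range (X : Fin d → MvPolynomial (Fin d) K)) ≤
            q.comap θ'.toRingHom := by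
          rw [Ideal.span_le]
          rintro _ ⟨j, rfl⟩
          exact hxq j
        exact hle this
    rw [this]
    exact RingHom.ker_isMaximal_of_surjective _ (fun k => ⟨C k, by simp⟩)
  have hht : p.height ≤ d := by
    have := Ideal.height_le_card_of_mem_minimalPrimes_span (p := p) (s := Set.range x)
      (Set.finite_range x) ⟨⟨inferInstance, by rw [Ideal.span_le]; rintro _ ⟨j, rfl⟩; exact hxp j⟩, by
        rintro q ⟨hq, hq2⟩ hqp
        exact ((hmax q hq fun j => hq2 (Ideal.subset_span ⟨j, rfl⟩)).eq_of_le hp.ne_top hqp).ge⟩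
    refine this.trans ?_
    have : (Set.range x).ncard ≤ d := by
      rw [← Set.image_univ]
      refine (Set.ncard_image_le Set.finite_univ).trans ?_
      simp [Set.ncard_univ]
    exact_mod_cast this
  have hle : ∀ rs : List (Localization.AtPrime p), RingTheory.Sequence.IsRegular (Localization.AtPrime p) rs →
      (rs.length : WithBot (WithTop ℕ)) ≤ ringKrullDim (Localization.AtPrime p) := by
    intro rs hrs
    have h1 := ringKrullDim_add_length_eq_ringKrullDim_of_isRegular rs hrs
    rw [← h1]
    have : Nontrivial (Localization.AtPrime p ⧸ Ideal.ofList rs) := by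
      rw [Ideal.Quotient.nontrivial_iff]
      intro h
      have := hrs.top_ne_smul
      rw [h] at this; simp at this
    exact le_add_of_nonneg_left ringKrullDim_nonneg_of_nontrivial
  unfold localRingDepth
  have hdim : ringKrullDim (Localization.AtPrime p) = p.height :=
    IsLocalization.AtPrime.ringKrullDim_eq_height p _
  apply le_antisymm
  · apply sSup_le
    rintro _ ⟨rs, rfl, hrs, -⟩
    exact hle rs hrs
  · refine le_trans ?_ (le_sSup ⟨_, rfl, hreg2, ?_⟩)
    · rw [hdim]
      simp only [List.length_map, List.length_ofFn]
      exact WithBot.coe_le_coe.2 hht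
    · intro r hr
      simp only [List.mem_map, List.mem_ofFn] at hr
      obtain ⟨_, ⟨j, rfl⟩, rfl⟩ := hr
      rw [IsLocalization.AtPrime.to_map_mem_maximal_iff (Localization.AtPrime p) p]
      exact hxp j
end endgame
lemma free_cover (A R : Type) [CommRing A] [IsDomain A] [AddCommGroup R] [Module A R]
    [Module.Finite A R] : ∃ (k : ℕ) (e : Fin k → R), LinearIndependent A e ∧
      ∃ c : A, c ≠ 0 ∧ ∀ r : R, ∃ f : Fin k → A, c • r = ∑ l, f l • e l := by
  classical
  obtain ⟨N, v, hv⟩ := Module.Finite.exists_fin (R := A) (M := R)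
  obtain ⟨s, hs, hs2⟩ := exists_maximal_linearIndepOn A v
  have hfin : Finite s := inferInstance
  obtain ⟨k, ⟨eq⟩⟩ := Finite.exists_equiv_fin s
  refine ⟨k, fun l => v (eq.symm l), ?_, ?_⟩
  · exact (linearIndependent_equiv eq.symm (f := fun i : s => v i)).2 hs
  have hrange : Set.range (fun l => v (eq.symm l)) = v '' s := by
    ext x; constructor
    · rintro ⟨l, rfl⟩; exact ⟨_, (eq.symm l).2, rfl⟩
    · rintro ⟨i, hi, rfl⟩; exact ⟨eq ⟨i, hi⟩, by simp⟩
  have h3 : ∀ i, ∃ a : A, a ≠ 0 ∧ a • v i ∈ Submodule.span A (v '' s) := by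
    intro i
    by_cases hi : i ∈ s
    · exact ⟨1, one_ne_zero, by rw [one_smul]; exact Submodule.subset_span ⟨i, hi, rfl⟩⟩
    · exact hs2 i hi
  choose a ha ha2 using h3
  refine ⟨∏ i, a i, Finset.prod_ne_zero_iff.2 fun i _ => ha i, fun r => ?_⟩
  have hr : r ∈ Submodule.span A (Set.range v) := by rw [hv]; trivial
  have : (∏ i, a i) • r ∈ Submodule.span A (v '' s) := by
    induction hr using Submodule.span_induction with
    | mem x hx =>
      obtain ⟨i, rfl⟩ := hx
      rw [← Finset.prod_erase_mul _ _ (Finset.mem_univ i), mul_smul]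
      exact Submodule.smul_mem _ _ (ha2 i)
    | zero => simp
    | add x y _ _ hx hy => rw [smul_add]; exact add_mem hx hy
    | smul b x _ hx => rw [smul_comm]; exact Submodule.smul_mem _ _ hx
  rw [← hrange, Submodule.mem_span_range_iff_exists_fun] at this
  obtain ⟨f, hf⟩ := this
  exact ⟨f, hf.symm⟩
lemma mono_reg {K : Type} [CommRing K] {d : ℕ} (q : ℕ) (i : Fin d)
    (P : MvPolynomial (Fin d) K)
    (h : P * X i ^ q ∈ Ideal.span ((fun j => (X j : MvPolynomial (Fin d) K) ^ q) '' {j | j < i})) :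
    P ∈ Ideal.span ((fun j => (X j : MvPolynomial (Fin d) K) ^ q) '' {j | j < i}) := by
  classical
  have key : (fun j => (X j : MvPolynomial (Fin d) K) ^ q) '' {j | j < i} =
      (fun s => monomial s (1 : K)) '' ((fun j => Finsupp.single j q) '' {j | j < i}) := by
    rw [Set.image_image]
    simp [X_pow_eq_monomial]
  rw [key, mem_ideal_span_monomial_image] at h ⊢
  intro u hu
  obtain ⟨s, ⟨j, hj, rfl⟩, hs⟩ := h (u + Finsupp.single i q) (by
    rw [mem_support_iff, X_pow_eq_monomial, coeff_mul_monomial]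
    simpa using hu)
  refine ⟨_, ⟨j, hj, rfl⟩, ?_⟩
  have hj' : j < i := hj
  have hsj := hs j
  rw [Finsupp.single_le_iff]
  simpa [Finsupp.single_apply, hj'.ne'] using hsj
lemma mem_span_lt {R : Type} [CommRing R] {d : ℕ} (x : Fin d → R) (i : Fin d) (r : R) :
    r ∈ Ideal.span (x '' {j | j < i}) ↔ ∃ f : Fin d → R, r = ∑ j with j < i, f j * x j := by
  classical
  constructor
  · intro h
    induction h using Submodule.span_induction with
    | mem y hy =>
      obtain ⟨j, hj, rfl⟩ := hy
      refine ⟨fun k => if k = j then 1 else 0, ?_⟩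
      have hj' : j < i := hj
      simp [Finset.sum_filter, hj']
    | zero => exact ⟨0, by simp⟩
    | add a b _ _ ha hb =>
      obtain ⟨f, rfl⟩ := ha
      obtain ⟨g, rfl⟩ := hb
      exact ⟨f + g, by simp [add_mul, Finset.sum_add_distrib]⟩
    | smul a b _ hb =>
      obtain ⟨f, rfl⟩ := hb
      exact ⟨fun j => a * f j, by simp [Finset.mul_sum, mul_assoc]⟩
  · rintro ⟨f, rfl⟩
    refine Ideal.sum_mem _ fun j hj => Ideal.mul_mem_left _ _ (Ideal.subset_span ⟨j, ?_, rfl⟩)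
    simpa using hj
section charp
variable {K : Type} [Field K] {R : Type} [CommRing R] [IsDomain R] [Algebra K R]
theorem SopReg_of_Freg (p : ℕ) [Fact p.Prime] [CharP K p]
    (H : ∀ c : R, c ≠ 0 → ∃ (e : ℕ) (φ : R → R) (b : R), (∀ x y, φ (x + y) = φ x + φ y) ∧
      (∀ x y, φ (x ^ p ^ e * y) = x * φ y) ∧ φ (c * b) = 1) : SopReg K R := by
  classical
  intro d θ hinj hfin i r hr
  letI : Algebra (MvPolynomial (Fin d) K) R := θ.toRingHom.toAlgebra
  haveI : Module.Finite (MvPolynomial (Fin d) K) R := hfin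
  haveI : CharP R p := charP_of_injective_algebraMap (algebraMap K R).injective p
  obtain ⟨k, e, he, c, hc, hcov⟩ := free_cover (MvPolynomial (Fin d) K) R
  have smul_def : ∀ (a : MvPolynomial (Fin d) K) (x : R), a • x = θ a * x := fun _ _ => rfl
  obtain ⟨E, φ, b, hadd, hφ, hb⟩ := H (θ c) (by
    intro h; exact hc (hinj (by rw [h, map_zero])))
  set q := p ^ E
  rw [mem_span_lt] at hr
  obtain ⟨f, hf⟩ := hr
  have hq : r ^ q * θ (X i) ^ q = ∑ j with j < i, f j ^ q * θ (X j) ^ q := by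
    rw [← mul_pow, hf, sum_pow_char_pow]
    simp [mul_pow, q]
  obtain ⟨P, hP⟩ := hcov (r ^ q)
  choose g hg using fun j => hcov (f j ^ q)
  have hlin : ∀ l, P l * X i ^ q = ∑ j with j < i, g j l * X j ^ q := by
    have h1 : ∑ l, (P l * X i ^ q) • e l = ∑ l, (∑ j with j < i, g j l * X j ^ q) • e l := by
      have h2 : ∑ l, (P l * X i ^ q) • e l = θ (X i) ^ q * (c • r ^ q) := by
        rw [hP, Finset.mul_sum]
        refine Finset.sum_congr rfl fun l _ => ?_
        rw [smul_def, smul_def, map_mul, map_pow]; ring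
      have h3 : ∑ l, (∑ j with j < i, g j l * X j ^ q) • e l =
          ∑ j with j < i, θ (X j) ^ q * (c • f j ^ q) := by
        simp_rw [hg, Finset.mul_sum, Finset.sum_smul]
        rw [Finset.sum_comm]
        refine Finset.sum_congr rfl fun j _ => Finset.sum_congr rfl fun l _ => ?_
        rw [smul_def, smul_def, map_mul, map_pow]; ring
      rw [h2, h3, smul_def, mul_left_comm, mul_comm (θ (X i) ^ q), hq, Finset.mul_sum]
      refine Finset.sum_congr rfl fun j _ => ?_
      rw [smul_def]; ring
    intro l
    have := (Fintype.linearIndependent_iff.1 he) (fun l => P l * X i ^ q -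
      ∑ j with j < i, g j l * X j ^ q) (by simp_rw [sub_smul, Finset.sum_sub_distrib]; rw [h1, sub_self]) l
    exact sub_eq_zero.1 this
  have hmem : ∀ l, ∃ G : Fin d → MvPolynomial (Fin d) K, P l = ∑ j with j < i, G j * X j ^ q := by
    intro l
    rw [← mem_span_lt (fun j => (X j : MvPolynomial (Fin d) K) ^ q) i]
    apply mono_reg
    rw [mem_span_lt (fun j => (X j : MvPolynomial (Fin d) K) ^ q) i]
    exact ⟨_, hlin l⟩
  choose G hG using hmem
  have hfinal : r ^ q * (θ c * b) = ∑ j with j < i, θ (X j) ^ q * (∑ l, θ (G l j) * e l * b) := by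
    have : r ^ q * (θ c * b) = (c • r ^ q) * b := by rw [smul_def]; ring
    rw [this, hP, Finset.sum_mul]
    simp_rw [Finset.mul_sum]
    rw [Finset.sum_comm]
    refine Finset.sum_congr rfl fun l _ => ?_
    rw [hG l, smul_def, map_sum, Finset.sum_mul, Finset.sum_mul]
    refine Finset.sum_congr rfl fun j _ => ?_
    rw [map_mul, map_pow]; ring
  have h0 : φ 0 = 0 := by simpa using hadd 0 0
  have hsum : ∀ (s : Finset (Fin d)) (F : Fin d → R), φ (∑ j ∈ s, F j) = ∑ j ∈ s, φ (F j) := by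
    intro s F
    induction s using Finset.induction_on with
    | empty => simp [h0]
    | insert a s ha ih => rw [Finset.sum_insert ha, Finset.sum_insert ha, hadd, ih]
  have := congrArg φ hfinal
  rw [hφ, hb, mul_one, hsum] at this
  rw [mem_span_lt, this]
  exact ⟨fun j => φ (∑ l, θ (G l j) * e l * b), Finset.sum_congr rfl fun j _ => by
    rw [hφ, mul_comm]⟩
end charp
section
variable {n m : ℕ} {K : Type} [Field K]
lemma aeval_scale {σ A : Type} [CommRing A] [Algebra K A] (c : A) (g : σ → A) (ν : σ →₀ ℕ) :
    aeval (R := K) (fun v => c * g v) (monomial ν 1) = c ^ ν.degree * aeval (R := K) g (monomial ν 1) := by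
  simp only [aeval_monomial, map_one, one_mul, Finsupp.prod, mul_pow, Finset.prod_mul_distrib, Finset.prod_pow_eq_pow_sum]
  rfl
lemma sbs_scale {β : Type} (a b : Mt n K) (r s : K) (ν : β ⊠ₙ n →₀ ℕ) :
    sbs (K := K) (r • a) (s • b) (monomial ν 1) = C ((r * s) ^ ν.degree) * sbs (K := K) a b (monomial ν 1) := by
  have := aeval_scale (K := K) (C (r * s)) (pt fun k => a.map C * gX β n K k * b.map C) ν
  unfold sbs
  rw [C_pow, ← this]
  congr 2
  funext ⟨k, i, j⟩
  simp only [pt]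
  have e : ∀ (r : K) (a : Mt n K), (r • a).map (C (σ := β ⊠ₙ n)) = (C r : MvPolynomial (β ⊠ₙ n) K) • a.map (C (σ := β ⊠ₙ n)) := by
    intro r a; refine Matrix.ext fun i j => ?_; simp [smul_eq_C_mul]
  rw [e, e]
  simp only [Matrix.smul_mul, Matrix.mul_smul, Matrix.smul_apply, smul_smul, smul_eq_mul, C_mul]
  ring
noncomputable abbrev gz (K : Type) [Field K] (n : ℕ) := gX Bool n K
noncomputable def Ft (ν : Fin m ⊠ₙ n →₀ ℕ) (c : MvPolynomial (Fin m ⊠ₙ n) K) :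
    MvPolynomial (Fin m ⊠ₙ n) (MvPolynomial (Bool ⊠ₙ n) K) :=
  sbs (K := K) (gz K n false).adjugate (gz K n true).adjugate (monomial ν 1) * map C c
lemma gX_map {β : Type} (z : β → Mt n K) (k : β) : (gX β n K k).map (aeval (R := K) (pt z)) = z k := by
  ext i j; simp [gX, pt]
lemma det_gX_ne {β : Type} (k : β) : (gX β n K k).det ≠ 0 := by
  intro h
  have := congrArg (aeval (R := K) (pt fun _ : β => (1 : Mt n K))) h
  rw [AlgHom.map_det, AlgHom.mapMatrix_apply, gX_map] at this
  simp at this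
lemma Ft_map (ν : Fin m ⊠ₙ n →₀ ℕ) (c : MvPolynomial (Fin m ⊠ₙ n) K)
    (z : Bool → Mt n K) : map (aeval (R := K) (pt z)).toRingHom (Ft ν c) =
      sbs (K := K) (z false).adjugate (z true).adjugate (monomial ν 1) * c := by
  unfold Ft
  have h : ∀ k, (gz K n k).adjugate.map (aeval (R := K) (pt z)) = (z k).adjugate := by
    intro k
    have := AlgHom.map_adjugate (aeval (R := K) (pt z)) (gz K n k)
    rw [AlgHom.mapMatrix_apply, AlgHom.mapMatrix_apply, gX_map] at this; exact this
  rw [map_mul, map_sbs, h, h, MvPolynomial.map_map]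
  have : ((aeval (R := K) (pt z)).toRingHom.comp C) = RingHom.id K := by
    ext r; exact (aeval (R := K) (pt z)).commutes r
  rw [this, MvPolynomial.map_id]
variable [IsAlgClosed K] (p : ℕ) [Fact p.Prime] [CharP K p] (e : ℕ)
lemma kappa (hn : 0 < n) (ν : Fin m ⊠ₙ n →₀ ℕ) (E : ℕ) (hE : ν.degree = n * E)
    (c : MvPolynomial (Fin m ⊠ₙ n) K) (hc : GInv c) :
    coeff (cst _ (p ^ e - 1)) (Ft ν c) = C (coeff (cst _ (p ^ e - 1)) (monomial ν 1 * c)) *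
      ((gz K n false).det * (gz K n true).det) ^ ((n - 1) * E) := by
  have hinf : Infinite K := IsAlgClosed.instInfinite
  have hpt : ∀ z : Bool → Mt n K, (z false).det ≠ 0 → (z true).det ≠ 0 →
      aeval (R := K) (pt z) (coeff (cst _ (p ^ e - 1)) (Ft ν c)) =
      coeff (cst _ (p ^ e - 1)) (monomial ν 1 * c) * ((z false).det * (z true).det) ^ ((n - 1) * E) := by
    intro z h0 h1
    have e1 : aeval (R := K) (pt z) (coeff (cst _ (p ^ e - 1)) (Ft ν c)) =
        coeff (cst _ (p ^ e - 1)) (sbs (K := K) (z false).adjugate (z true).adjugate (monomial ν 1) * c) := by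
      have := coeff_map (aeval (R := K) (pt z)).toRingHom (Ft ν c) (cst _ (p ^ e - 1))
      refine this.symm.trans ?_
      rw [Ft_map]
    have hroot : ∀ w : Mt n K, w.det ≠ 0 → ∃ (r : K) (a : Mt n K),
        r ^ n = w.det ∧ a.det = 1 ∧ w = r • a := by
      intro w hw
      obtain ⟨r, hr⟩ := IsAlgClosed.exists_pow_nat_eq w.det hn
      have hr0 : r ≠ 0 := by rintro rfl; rw [zero_pow hn.ne'] at hr; exact hw hr.symm
      refine ⟨r, r⁻¹ • w, hr, ?_, by rw [smul_smul, mul_inv_cancel₀ hr0, one_smul]⟩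
      rw [det_smul, Fintype.card_fin, ← hr, ← mul_pow, inv_mul_cancel₀ hr0, one_pow]
    obtain ⟨r, a, hr, ha, hza⟩ := hroot _ h0
    obtain ⟨s, b, hs, hb, hzb⟩ := hroot _ h1
    rw [e1, ← hr, ← hs, hza, hzb, adjugate_smul, adjugate_smul, sbs_scale, mul_assoc, coeff_C_mul]
    have ha' : a.adjugate.det = 1 := by rw [det_adjugate, ha, one_pow]
    have hb' : b.adjugate.det = 1 := by rw [det_adjugate, hb, one_pow]
    nth_rewrite 1 [← hc _ _ ha' hb']
    rw [← map_mul, coeff_sbs p e _ _ ha' hb', hE, mul_comm, Fintype.card_fin]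
    congr 1
    rw [← mul_pow, ← mul_pow, ← pow_mul, ← pow_mul]
    congr 1; ring
  have hd : (gz K n false).det * (gz K n true).det ≠ 0 := mul_ne_zero (det_gX_ne _) (det_gX_ne _)
  apply mul_right_cancel₀ hd
  apply MvPolynomial.funext
  intro x
  have hx : ∀ f : MvPolynomial (Bool ⊠ₙ n) K, eval x f = aeval (R := K) (pt fun k => of fun i j => x (k, i, j)) f := fun f => rfl
  set z : Bool → Mt n K := fun k => of fun i j => x (k, i, j)
  have hdet : ∀ k, aeval (R := K) (pt z) (gz K n k).det = (z k).det := by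
    intro k; rw [AlgHom.map_det, AlgHom.mapMatrix_apply, gX_map]
  rw [hx, hx]
  simp only [map_mul, map_pow, hdet]
  by_cases h0 : (z false).det = 0
  · rw [h0]; ring
  by_cases h1 : (z true).det = 0
  · rw [h1]; ring
  rw [hpt z h0 h1]
  congr 2
  simp
end
section
variable {n m : ℕ} {K : Type} [Field K]
lemma gX_shear_L {β : Type} (la : β → Bool) (i j : Fin n) (t : K) (y : β) :
    (gX β n K y).map (shear (Ld la i j) t) = if la y then transvection i j (C t) * gX β n K y else gX β n K y := by
  refine Matrix.ext fun a b => ?_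
  cases h : la y
  · simp [gX, shear, shPt, Ld, h]
  · rw [if_pos rfl, trv_mul]
    by_cases ha : a = i <;> simp [gX, shear, shPt, Ld, h, ha]
lemma gX_shear_R {β : Type} (la : β → Bool) (i j : Fin n) (t : K) (y : β) :
    (gX β n K y).map (shear (Rd la i j) t) = if la y then gX β n K y * transvection j i (C t) else gX β n K y := by
  refine Matrix.ext fun a b => ?_
  cases h : la y
  · simp [gX, shear, shPt, Rd, h]
  · rw [if_pos rfl, mul_trv]
    by_cases ha : b = i <;> simp [gX, shear, shPt, Rd, h, ha]
def ix (m n : ℕ) : Fin m ⊠ₙ n → (Fin m ⊕ Bool) ⊠ₙ n := Prod.map Sum.inl id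
def iz (m n : ℕ) : Bool ⊠ₙ n → (Fin m ⊕ Bool) ⊠ₙ n := Prod.map Sum.inr id
lemma ix_inj : Function.Injective (ix m n) := Sum.inl_injective.prodMap Function.injective_id
lemma iz_inj : Function.Injective (iz m n) := Sum.inr_injective.prodMap Function.injective_id
def sla {m : ℕ} : Fin m ⊕ Bool → Bool
  | .inl _ => true
  | .inr b => !b
def sra {m : ℕ} : Fin m ⊕ Bool → Bool
  | .inl _ => true
  | .inr b => b
noncomputable def Psi : MvPolynomial (Fin m ⊠ₙ n) (MvPolynomial (Bool ⊠ₙ n) K) →+*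
    MvPolynomial ((Fin m ⊕ Bool) ⊠ₙ n) K :=
  eval₂Hom (rename (R := K) (iz m n)).toRingHom (fun x => X (ix m n x))
noncomputable def g0 : MvPolynomial (Fin m ⊠ₙ n) K →ₐ[K] MvPolynomial ((Fin m ⊕ Bool) ⊠ₙ n) K :=
  aeval (pt fun k : Fin m => (gX (Fin m ⊕ Bool) n K (.inr false)).adjugate * gX (Fin m ⊕ Bool) n K (.inl k) *
    (gX (Fin m ⊕ Bool) n K (.inr true)).adjugate)
lemma Psi_mapC (c : MvPolynomial (Fin m ⊠ₙ n) K) :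
    Psi (MvPolynomial.map C c) = rename (ix m n) c := by
  have : Psi.comp (MvPolynomial.map C) = (rename (R := K) (ix m n)).toRingHom := by
    apply MvPolynomial.ringHom_ext
    · intro r; simp [Psi]
    · intro i; simp [Psi]
  exact DFunLike.congr_fun this c
lemma gz_map (k : Bool) : (gz K n k).map (rename (iz m n)) = gX (Fin m ⊕ Bool) n K (.inr k) := by
  refine Matrix.ext fun a b => ?_
  simp [gX, iz]
lemma Psi_sbs (f : MvPolynomial (Fin m ⊠ₙ n) K) :
    Psi (sbs (K := K) (gz K n false).adjugate (gz K n true).adjugate f) = g0 f := by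
  have h : ∀ k, (gz K n k).adjugate.map (rename (iz m n)) = (gX (Fin m ⊕ Bool) n K (.inr k)).adjugate := by
    intro k
    have := AlgHom.map_adjugate (rename (R := K) (iz m n)) (gz K n k)
    rw [AlgHom.mapMatrix_apply, AlgHom.mapMatrix_apply, gz_map] at this; exact this
  have : Psi.comp (sbs (β := Fin m) (K := K) (gz K n false).adjugate (gz K n true).adjugate).toRingHom =
      (g0 (K := K) (n := n) (m := m)).toRingHom := by
    apply MvPolynomial.ringHom_ext
    · intro r
      have e1 := (sbs (β := Fin m) (K := K) (gz K n false).adjugate (gz K n true).adjugate).commutes r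
      have e2 := (g0 (K := K) (n := n) (m := m)).commutes r
      simp only [algebraMap_eq] at e1 e2
      simp only [RingHom.comp_apply, AlgHom.toRingHom_eq_coe, RingHom.coe_coe, e1, e2]
      simp [Psi, MvPolynomial.algebraMap_apply, algebraMap_eq]
    · rintro ⟨k, i, j⟩
      simp only [RingHom.comp_apply, AlgHom.toRingHom_eq_coe, RingHom.coe_coe, sbs_X]
      rw [g0, aeval_X, pt, ← h, ← h]
      simp [Matrix.mul_apply, gX, Psi, ix]
  exact DFunLike.congr_fun this f
lemma adj_trv {T : Type} [CommRing T] {i j : Fin n} (h : i ≠ j) (t : T) :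
    (transvection i j t).adjugate * transvection i j t = 1 ∧
    transvection i j t * (transvection i j t).adjugate = 1 := by
  rw [adjugate_mul, mul_adjugate, det_transvection_of_ne i j h, one_smul]; simp
lemma g0_inv_L {i j : Fin n} (h : i ≠ j) (f : MvPolynomial (Fin m ⊠ₙ n) K) :
    Sinv (Ld sla i j) (g0 f) := by
  intro t
  have : (shear (Ld sla i j) t).comp (g0 (K := K) (n := n) (m := m)) = g0 := by
    apply MvPolynomial.algHom_ext
    rintro ⟨k, a, b⟩
    rw [AlgHom.comp_apply, g0, aeval_X, pt]
    set φ := shear (K := K) (Ld (sla (m := m)) i j) t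
    have hm : ∀ M : Matrix (Fin n) (Fin n) (MvPolynomial ((Fin m ⊕ Bool) ⊠ₙ n) K), ∀ a b, φ (M a b) = (φ.mapMatrix M) a b := fun _ _ _ => rfl
    rw [hm, map_mul, map_mul, AlgHom.map_adjugate, AlgHom.map_adjugate]
    simp only [AlgHom.mapMatrix_apply]
    rw [gX_shear_L, gX_shear_L, gX_shear_L]
    simp only [sla, Bool.not_false, Bool.not_true, if_true, Bool.false_eq_true, if_false]
    rw [adjugate_mul_distrib, Matrix.mul_assoc (adjugate _) (adjugate _), ← Matrix.mul_assoc (adjugate (transvection _ _ _)), (adj_trv h _).1, Matrix.one_mul]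
  exact DFunLike.congr_fun this f
lemma g0_inv_R {i j : Fin n} (h : i ≠ j) (f : MvPolynomial (Fin m ⊠ₙ n) K) :
    Sinv (Rd sra i j) (g0 f) := by
  intro t
  have : (shear (Rd sra i j) t).comp (g0 (K := K) (n := n) (m := m)) = g0 := by
    apply MvPolynomial.algHom_ext
    rintro ⟨k, a, b⟩
    rw [AlgHom.comp_apply, g0, aeval_X, pt]
    set φ := shear (K := K) (Rd (sra (m := m)) i j) t
    have hm : ∀ M : Matrix (Fin n) (Fin n) (MvPolynomial ((Fin m ⊕ Bool) ⊠ₙ n) K), ∀ a b, φ (M a b) = (φ.mapMatrix M) a b := fun _ _ _ => rfl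
    rw [hm, map_mul, map_mul, AlgHom.map_adjugate, AlgHom.map_adjugate]
    simp only [AlgHom.mapMatrix_apply]
    rw [gX_shear_R, gX_shear_R, gX_shear_R]
    simp only [sra, if_true, Bool.false_eq_true, if_false]
    rw [adjugate_mul_distrib, ← Matrix.mul_assoc, ← Matrix.mul_assoc, Matrix.mul_assoc (_ * _) (transvection _ _ _), (adj_trv h.symm _).2, Matrix.mul_one]
  exact DFunLike.congr_fun this f
lemma sbs_deg {T : Type} [CommRing T] [Algebra K T] (a b : Mt n T) (ν : Fin m ⊠ₙ n →₀ ℕ) :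
    (sbs (K := K) a b (monomial ν 1)).totalDegree ≤ ν.degree := by
  unfold sbs
  rw [aeval_monomial, map_one, one_mul]
  refine (totalDegree_finsetProd _ _).trans ?_
  unfold Finsupp.degree
  apply Finset.sum_le_sum
  rintro ⟨k, i, j⟩ _
  refine (totalDegree_pow _ _).trans ?_
  have : (pt (fun k => a.map C * gX (Fin m) n T k * b.map C) (k, i, j)).totalDegree ≤ 1 := by
    simp only [pt, Matrix.mul_apply]
    apply totalDegree_finsetSum_le
    intro x _
    refine (totalDegree_mul _ _).trans ?_
    have h1 : (b.map (C (σ := Fin m ⊠ₙ n)) x j).totalDegree = 0 := by simp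
    rw [h1, add_zero]
    apply totalDegree_finsetSum_le
    intro y _
    refine (totalDegree_mul _ _).trans ?_
    have h1 : (a.map (C (σ := Fin m ⊠ₙ n)) i y).totalDegree = 0 := by simp
    rw [h1, zero_add]
    simp only [gX, of_apply, X]
    exact (totalDegree_monomial_le _ _).trans (by simp)
  calc _ ≤ ν (k, i, j) * 1 := Nat.mul_le_mul_left _ this
    _ = _ := by simp
lemma Ft_deg (ν : Fin m ⊠ₙ n →₀ ℕ) (c : MvPolynomial (Fin m ⊠ₙ n) K) :
    (Ft ν c).totalDegree ≤ ν.degree + c.totalDegree := by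
  unfold Ft
  refine (totalDegree_mul _ _).trans (add_le_add (sbs_deg _ _ _) ?_)
  exact Finset.sup_mono (support_map_subset _ _)
lemma Psi_Ft (ν : Fin m ⊠ₙ n →₀ ℕ) (c : MvPolynomial (Fin m ⊠ₙ n) K) :
    Psi (Ft ν c) = g0 (monomial ν 1) * rename (ix m n) c := by
  unfold Ft; rw [map_mul, Psi_sbs, Psi_mapC]
lemma Psi_mono (α : Fin m ⊠ₙ n →₀ ℕ) (κ : MvPolynomial (Bool ⊠ₙ n) K) :
    Psi (monomial α κ) = rename (ix m n) (monomial α 1) * rename (iz m n) κ := by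
  have : rename (ix m n) (monomial α (1 : K)) = aeval (R := K) (fun x => X (ix m n x)) (monomial α (1 : K)) := by
    rw [rename_eq_aeval]; rfl
  rw [this, aeval_monomial, Psi, coe_eval₂Hom, eval₂_monomial, map_one, one_mul, mul_comm]; rfl
end
section
variable {n m : ℕ} {K : Type} [Field K] [IsAlgClosed K] (p : ℕ) [Fact p.Prime] [CharP K p] (e : ℕ)
lemma degree_cst (σ : Type) [Fintype σ] (k : ℕ) : (cst σ k).degree = Fintype.card σ * k := by
  rw [Finsupp.degree_eq_sum]; simp
lemma cst_eq_of_le {σ : Type} [Fintype σ] {k : ℕ} {α : σ →₀ ℕ} (h : cst σ k ≤ α)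
    (hd : α.degree ≤ Fintype.card σ * k) : α = cst σ k := by
  obtain ⟨d, rfl⟩ := le_iff_exists_add.1 h
  rw [map_add, degree_cst] at hd
  have : d.degree = 0 := by omega
  rw [Finsupp.degree_eq_zero_iff] at this
  simp [this]
lemma mapDomain_ne {α β : Type} (f : α → β) (u : α →₀ ℕ) (b : β) (h : ∀ a, f a ≠ b) : u.mapDomain f b = 0 :=
  Finsupp.mapDomain_notin_range _ _ (by rintro ⟨a, ha⟩; exact h a ha)
lemma tau_Psi (F : MvPolynomial (Fin m ⊠ₙ n) (MvPolynomial (Bool ⊠ₙ n) K))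
    (hF : F.totalDegree ≤ Fintype.card (Fin m ⊠ₙ n) * (p ^ e - 1))
    (G : MvPolynomial (Bool ⊠ₙ n) K) :
    tau p e (Psi F * rename (iz m n) G) =
    tau p e (rename (ix m n) (monomial (cst _ (p ^ e - 1)) 1) * rename (iz m n) (coeff (cst _ (p ^ e - 1)) F * G)) := by
  classical
  have key : ∀ α κ, α ∈ F.support → α ≠ cst _ (p ^ e - 1) → tau p e (Psi (monomial α κ) * rename (iz m n) G) = 0 := by
    intro α κ hα hne
    apply tau_eq_zero
    intro α' h1 h2
    apply hne
    have hdeg : α.degree ≤ Fintype.card (Fin m ⊠ₙ n) * (p ^ e - 1) :=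
      (le_totalDegree hα).trans hF
    refine cst_eq_of_le (fun x => ?_) hdeg
    rw [Psi_mono, mul_assoc, ← map_mul, rename_monomial, coeff_monomial_mul'] at h1
    split_ifs at h1 with h3
    · rw [one_mul] at h1
      obtain ⟨u, hu, -⟩ := coeff_rename_ne_zero _ _ _ h1
      have e1 : α' = α.mapDomain (ix m n) + u.mapDomain (iz m n) := by
        rw [hu, add_comm, tsub_add_cancel_of_le h3]
      have := h2 (ix m n x)
      rw [e1, Finsupp.add_apply, Finsupp.mapDomain_apply ix_inj, mapDomain_ne (iz m n) u _ (by
        rintro ⟨a, b⟩ h; simp [iz, ix, Prod.ext_iff] at h)] at this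
      simpa using this
    · exact (h1 rfl).elim
  conv_lhs => rw [F.as_sum, map_sum, Finset.sum_mul, tau_sum]
  rw [Finset.sum_eq_single (cst _ (p ^ e - 1))]
  · rw [Psi_mono, mul_assoc, ← map_mul]
  · intro α hα hne; exact key α _ hα hne
  · intro h
    rw [notMem_support_iff.1 h]; simp [tau_zero]
lemma pD_gX (y : Bool) : (gz K n y).det = pD K y := by
  simp [pD, vdet, gX, gz]
lemma ren_pD {β γ : Type} (f : β → γ) (y : β) :
    rename (Prod.map f id) (pD K y : MvPolynomial (β ⊠ₙ n) K) = pD K (f y) := by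
  unfold pD vdet
  rw [AlgHom.map_det]
  congr 1
  refine Matrix.ext fun i j => ?_
  simp
lemma step1 (hn : 0 < n) (c : MvPolynomial (Fin m ⊠ₙ n) K) (hc : GInv c) (h0 : c ≠ 0)
    (hd : n ∣ c.totalDegree) : ∃ (e : ℕ) (g : MvPolynomial ((Fin m ⊕ Bool) ⊠ₙ n) K) (u : ℕ) (k : K), k ≠ 0 ∧
    (∀ i j, adj i j → gdeg (Ld sla i j) g < p ^ e) ∧ (∀ i j, adj i j → gdeg (Rd sra i j) g < p ^ e) ∧
    tau p e (g * rename (ix m n) c) = C k * (pD K (.inr false) * pD K (.inr true)) ^ u := by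
  haveI : Infinite K := IsAlgClosed.instInfinite
  obtain ⟨γ, hγ, hγd⟩ : ∃ γ ∈ c.support, c.totalDegree = γ.degree := by
    obtain ⟨γ, h1, h2⟩ := Finset.exists_mem_eq_sup c.support (support_nonempty.2 h0) (fun s => s.sum fun _ e => e)
    exact ⟨γ, h1, h2⟩
  obtain ⟨e, he⟩ : ∃ e, c.totalDegree < p ^ e := ⟨_, Nat.lt_pow_self (Nat.Prime.one_lt Fact.out)⟩
  set N := Fintype.card (Fin m ⊠ₙ n) with hN
  have hγle : γ ≤ cst _ (p ^ e - 1) := by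
    intro x
    have := Finsupp.le_degree x γ
    simp only [cst_apply]; omega
  set ν := cst _ (p ^ e - 1) - γ with hν
  have hνγ : ν + γ = cst _ (p ^ e - 1) := tsub_add_cancel_of_le hγle
  have hνd : ν.degree + γ.degree = N * (p ^ e - 1) := by
    rw [← map_add, hνγ, degree_cst]
  obtain ⟨E, hE⟩ : n ∣ ν.degree := by
    rw [hγd] at hd
    refine (Nat.dvd_add_left hd).1 ?_
    rw [hνd]
    refine Dvd.dvd.mul_right ?_ _
    simp only [hN, Fintype.card_prod, Fintype.card_fin]; exact ⟨m * n, by ring⟩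
  have hk := kappa p e hn ν E hE c hc
  set κ0 := coeff (cst _ (p ^ e - 1)) (monomial ν 1 * c) with hκ0
  have hκ : κ0 ≠ 0 := by
    rw [hκ0, ← hνγ, coeff_monomial_mul, one_mul]; exact mem_support_iff.1 hγ
  set u := (n - 1) * E with hu
  obtain ⟨q1, hq1⟩ : ∃ q1, p ^ e = q1 + 1 := ⟨p ^ e - 1, by have := q_pos p e; omega⟩
  set Dd : MvPolynomial (Bool ⊠ₙ n) K := pD K false * pD K true with hDd
  set G : MvPolynomial (Bool ⊠ₙ n) K := Dd ^ (q1 * u) * (eta K false * eta K true) ^ q1 with hG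
  set k := (iterateFrobeniusEquiv K p e).symm κ0 with hkdef
  have hkq : k ^ p ^ e = κ0 := by
    rw [← iterateFrobenius_def, ← coe_iterateFrobeniusEquiv]
    exact RingEquiv.apply_symm_apply _ _
  have hgd : ∀ (D : (Fin m ⊕ Bool) ⊠ₙ n → Option ((Fin m ⊕ Bool) ⊠ₙ n)) D',
      (∀ x, D (iz m n x) = (D' x).map (iz m n)) → Sinv D (g0 (monomial ν (1 : K))) → gdeg D' Dd = 0 →
      gdeg D' (eta K false) + gdeg D' (eta K true) ≤ 1 → 
      gdeg D (g0 (monomial ν (1 : K)) * rename (iz m n) G) < p ^ e := by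
    intro D D' hD h1 h2 h3
    rw [← gdeg_zero_iff] at h1
    have h4 : gdeg D' G ≤ q1 := by
      refine (gdeg_mul _ _ _).trans ?_
      have a1 := gdeg_pow D' Dd (q1 * u)
      have a2 := gdeg_pow D' (eta K false * eta K true) q1
      have a3 := gdeg_mul D' (eta K false) (eta (n := n) K true)
      rw [h2] at a1
      have a4 : q1 * gdeg D' (eta (n := n) K false * eta K true) ≤ q1 * 1 := Nat.mul_le_mul_left _ (by omega)
      omega
    have := gdeg_mul D (g0 (monomial ν (1 : K))) (rename (iz m n) G)
    rw [gdeg_rename (iz m n) iz_inj hD] at this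
    omega
  refine ⟨e, g0 (monomial ν (1 : K)) * rename (iz m n) G, u, k, ?_, ?_, ?_, ?_⟩
  · intro h; rw [h, zero_pow (q_pos p e).ne'] at hkq; exact hκ hkq.symm
  · intro i j hij
    refine hgd _ (Ld (fun b => !b) i j) ?_ (g0_inv_L hij.ne _) ?_ ?_
    · rintro ⟨y, a, b⟩
      cases y <;> by_cases h : a = i <;> simp [Ld, iz, sla, h]
    · have := gdeg_mul (Ld (fun b => !b) i j) (pD K false) (pD (n := n) K true)
      rw [gdeg_pD_L K _ _ hij.ne, gdeg_pD_L K _ _ hij.ne] at this; exact Nat.le_zero.1 this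
    · rw [gdeg_eta_L0 K _ true rfl hij.ne]; exact gdeg_eta_L K _ _ hij
  · intro i j hij
    refine hgd _ (Rd (fun b => b) i j) ?_ (g0_inv_R hij.ne _) ?_ ?_
    · rintro ⟨y, a, b⟩
      cases y <;> by_cases h : b = i <;> simp [Rd, iz, sra, h]
    · have := gdeg_mul (Rd (fun b => b) i j) (pD K false) (pD (n := n) K true)
      rw [gdeg_pD_R K _ _ hij.ne, gdeg_pD_R K _ _ hij.ne] at this; exact Nat.le_zero.1 this
    · rw [gdeg_eta_R0 K _ false rfl hij.ne, zero_add]; exact gdeg_eta_R K _ _ hij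
  · have e1 : g0 (monomial ν (1 : K)) * rename (iz m n) G * rename (ix m n) c = Psi (Ft ν c) * rename (iz m n) G := by
      rw [Psi_Ft]; ring
    rw [e1, tau_Psi p e _ ((Ft_deg _ _).trans (by rw [hγd, hνd])), hk, pD_gX, pD_gX]
    have e2 : C κ0 * (pD K false * pD K true) ^ u * G = (C k * Dd ^ u) ^ p ^ e * (eta K false * eta K true) ^ q1 := by
      rw [mul_pow (C k), ← C_pow, hkq, hG, ← hDd, hq1]; ring
    rw [e2, map_mul, map_pow, mul_left_comm, tau_pow_mul]
    have e3 : rename (iz m n) (C k * Dd ^ u) = C k * (pD K (.inr false) * pD K (.inr true)) ^ u := by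
      have h : ∀ y, rename (iz m n) (pD K y) = pD K (Sum.inr y) := fun y => ren_pD (n := n) (K := K) (Sum.inr (α := Fin m)) y
      rw [map_mul, map_pow, hDd, map_mul, h, h]; simp
    rw [e3]
    have e4 : tau p e (rename (ix m n) (monomial (cst _ (p ^ e - 1)) 1) * rename (iz m n) ((eta K false * eta K true) ^ q1)) = 1 := by
      refine tau_lead p e (w := bw (fun _ => 0) (fun _ => 0)) ?_
      have hm : ∀ {σ : Type} (w : σ → ℕ) (u : σ →₀ ℕ), Lead w (monomial u (1 : K)) u := by
        classical
        intro σ w u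
        refine ⟨by simp, fun v hv hne => ?_⟩
        rw [coeff_monomial, if_neg (Ne.symm hne)] at hv; exact (hv rfl).elim
      have l1 := (hm (bw (fun _ => 0) (fun _ => 0) ∘ ix m n) (cst _ (p ^ e - 1))).rename (ix m n) ix_inj
      have hb : bw (n := n) (fun _ : Fin m ⊕ Bool => 0) (fun _ => 0) ∘ iz m n = bw (fun _ => 0) (fun _ => 0) := by
        funext ⟨y, a, b⟩; simp [bw, iz]
      have l2 := ((lead_eta (n := n) K (fun _ => 0) (fun _ => 0) false).mul (lead_eta K (fun _ => 0) (fun _ => 0) true)).pow q1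
      rw [← hb] at l2
      have l3 := l1.mul (l2.rename (iz m n) iz_inj)
      convert l3 using 1
      ext ⟨y, a, b⟩
      rcases y with y | y
      · have : (((Sum.inl y : Fin m ⊕ Bool), a, b)) = ix m n (y, a, b) := rfl
        rw [Finsupp.add_apply, this, Finsupp.mapDomain_apply ix_inj, mapDomain_ne (iz m n) _ _ (by
          rintro ⟨a, b⟩ h; simp [iz, ix, Prod.ext_iff] at h)]; simp
      · have : (((Sum.inr y : Fin m ⊕ Bool), a, b)) = iz m n (y, a, b) := rfl
        rw [Finsupp.add_apply, this, Finsupp.mapDomain_apply iz_inj, mapDomain_ne (ix m n) _ _ (by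
          rintro ⟨a, b⟩ h; simp [iz, ix, Prod.ext_iff] at h)]
        simp only [cst_apply, zero_add, Finsupp.smul_apply, Finsupp.add_apply, blk_apply, smul_eq_mul]
        cases y <;> simp [hq1]
    rw [e4, mul_one]
end
section
variable {n m : ℕ} {K : Type} [Field K]
def jf {m : ℕ} : Fin m ⊕ Bool → Big m
  | .inl i => bX i
  | .inr false => bZ 0
  | .inr true => bW 0
lemma jf_inj : Function.Injective (jf (m := m)) := by
  rintro (a | _ | _) (b | _ | _) h <;> simp_all [jf]
def jj (m n : ℕ) : (Fin m ⊕ Bool) ⊠ₙ n → Big m ⊠ₙ n := Prod.map jf id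
lemma jj_inj : Function.Injective (jj m n) := jf_inj.prodMap Function.injective_id
lemma jf_l (y : Fin m ⊕ Bool) : bla (jf y) = sla y := by rcases y with a | _ | _ <;> rfl
lemma jf_r (y : Fin m ⊕ Bool) : bra (jf y) = sra y := by rcases y with a | _ | _ <;> rfl
lemma Ld_map {β γ : Type} (f : β → γ) (la : γ → Bool) (lb : β → Bool) (h : ∀ y, la (f y) = lb y) (i j : Fin n) (x) :
    Ld la i j (Prod.map f id x) = (Ld lb i j x).map (Prod.map f id) := by
  obtain ⟨y, a, b⟩ := x
  by_cases h1 : lb y = true ∧ a = i <;> simp [Ld, h, h1]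
lemma Rd_map {β γ : Type} (f : β → γ) (la : γ → Bool) (lb : β → Bool) (h : ∀ y, la (f y) = lb y) (i j : Fin n) (x) :
    Rd la i j (Prod.map f id x) = (Rd lb i j x).map (Prod.map f id) := by
  obtain ⟨y, a, b⟩ := x
  by_cases h1 : lb y = true ∧ b = i <;> simp [Rd, h, h1]
noncomputable def rho : Big m ⊠ₙ n → MvPolynomial (Fin m ⊠ₙ n) K
  | (.inl i, a, b) => X (i, a, b)
  | _ => 0
lemma rho_L (i j : Fin n) (F : MvPolynomial (Big m ⊠ₙ n) K) (h : Sinv (Ld bla i j) F) :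
    Sinv (Ld tt i j) (aeval (R := K) (rho (K := K)) F) := by
  intro t
  conv_rhs => rw [← h t]
  rw [← AlgHom.comp_apply, ← AlgHom.comp_apply]
  congr 1
  apply MvPolynomial.algHom_ext
  rintro ⟨y | y | y, a, b⟩ <;> by_cases h1 : a = i <;> simp [rho, shear, shPt, Ld, bla, tt, h1]
lemma rho_R (i j : Fin n) (F : MvPolynomial (Big m ⊠ₙ n) K) (h : Sinv (Rd bra i j) F) :
    Sinv (Rd tt i j) (aeval (R := K) (rho (K := K)) F) := by
  intro t
  conv_rhs => rw [← h t]
  rw [← AlgHom.comp_apply, ← AlgHom.comp_apply]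
  congr 1
  apply MvPolynomial.algHom_ext
  rintro ⟨y | y | y, a, b⟩ <;> by_cases h1 : b = i <;> simp [rho, shear, shPt, Rd, bra, tt, h1]
lemma gdeg_dvd {σ : Type} (D : σ → Option σ) {f g : MvPolynomial σ K} (h : f ∣ g) (hg : g ≠ 0) : gdeg D f ≤ gdeg D g := by
  refine Polynomial.natDegree_le_of_dvd (map_dvd _ h) ?_
  intro h0
  apply hg
  have := gshear_eval D g 0
  rw [shear_zero, h0] at this
  simpa using this.symm
variable [IsAlgClosed K] (p : ℕ) [Fact p.Prime] [CharP K p]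
noncomputable def TT (e1 e2 : ℕ) (g1 : MvPolynomial ((Fin m ⊕ Bool) ⊠ₙ n) K)
    (g2 : MvPolynomial (Big m ⊠ₙ n) K) (r : MvPolynomial (Fin m ⊠ₙ n) K) :
    MvPolynomial (Fin m ⊠ₙ n) K :=
  aeval (R := K) rho (tau p e2 (g2 * rename (jj m n) (tau p e1 (g1 * rename (ix m n) r))))
lemma TT_add (e1 e2 : ℕ) (g1 : MvPolynomial ((Fin m ⊕ Bool) ⊠ₙ n) K)
    (g2 : MvPolynomial (Big m ⊠ₙ n) K) (r s) : TT p e1 e2 g1 g2 (r + s) = TT p e1 e2 g1 g2 r + TT p e1 e2 g1 g2 s := by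
  simp only [TT, map_add, mul_add, tau_add]
lemma TT_mul (e1 e2 : ℕ) (g1 : MvPolynomial ((Fin m ⊕ Bool) ⊠ₙ n) K)
    (g2 : MvPolynomial (Big m ⊠ₙ n) K) (r s) :
    TT p e1 e2 g1 g2 (r ^ p ^ (e1 + e2) * s) = r * TT p e1 e2 g1 g2 s := by
  have : r ^ p ^ (e1 + e2) = (r ^ p ^ e2) ^ p ^ e1 := by rw [← pow_mul, ← pow_add, add_comm]
  unfold TT
  rw [this, map_mul, map_pow, mul_left_comm, tau_pow_mul, map_mul, map_pow, map_pow, mul_left_comm, tau_pow_mul, map_mul]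
  congr 1
  rw [rename_rename, aeval_rename]
  conv_rhs => rw [← aeval_X_left_apply r]
  congr 1
lemma step2 (u : ℕ) : ∃ (e : ℕ) (g : MvPolynomial (Big m ⊠ₙ n) K),
    (∀ i j, adj i j → gdeg (Ld bla i j) g < p ^ e) ∧ (∀ i j, adj i j → gdeg (Rd bra i j) g < p ^ e) ∧
    tau p e (g * (pD K (bZ 0) * pD K (bW 0)) ^ u) = 1 := by
  obtain ⟨e, he⟩ : ∃ e, u < p ^ e := ⟨_, Nat.lt_pow_self (Nat.Prime.one_lt Fact.out)⟩
  obtain ⟨h', hh⟩ := hbig_dvd K n m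
  have hne : hbig K n m ≠ 0 := by
    intro h0; have := (lead_hbig K n m).1; rw [h0] at this; simp at this
  have hg : ∀ D : Big m ⊠ₙ n → Option (Big m ⊠ₙ n), gdeg D (pD K (bZ 0)) = 0 → gdeg D (pD K (bW 0)) = 0 →
      gdeg D (hbig K n m) ≤ 1 → gdeg D ((pD K (bZ 0) * pD K (bW 0)) ^ (p ^ e - 1 - u) * h' ^ (p ^ e - 1)) < p ^ e := by
    intro D h1 h2 h3
    have a1 := gdeg_mul D (pD K (bZ 0)) (pD K (bW 0))
    have a2 := gdeg_pow D (pD K (bZ 0) * pD K (bW 0)) (p ^ e - 1 - u)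
    have a3 := gdeg_pow D h' (p ^ e - 1)
    have a4 := gdeg_mul D ((pD K (bZ 0) * pD K (bW 0)) ^ (p ^ e - 1 - u)) (h' ^ (p ^ e - 1))
    have a5 : gdeg D h' ≤ 1 := (gdeg_dvd D ⟨_, by rw [hh, mul_comm]⟩ hne).trans h3
    rw [Nat.le_zero.1 (a1.trans (by omega)), mul_zero] at a2
    have a6 := a3.trans (Nat.mul_le_mul_left _ a5)
    omega
  refine ⟨e, (pD K (bZ 0) * pD K (bW 0)) ^ (p ^ e - 1 - u) * h' ^ (p ^ e - 1), ?_, ?_, ?_⟩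
  · intro i j h
    exact hg _ (gdeg_pD_L K _ _ h.ne) (gdeg_pD_L K _ _ h.ne) (gdeg_hbig_L K n m h)
  · intro i j h
    exact hg _ (gdeg_pD_R K _ _ h.ne) (gdeg_pD_R K _ _ h.ne) (gdeg_hbig_R K n m h)
  · have : (pD K (bZ 0) * pD K (bW 0)) ^ (p ^ e - 1 - u) * h' ^ (p ^ e - 1) * (pD K (bZ 0) * pD K (bW 0)) ^ u = hbig K n m ^ (p ^ e - 1) := by
      rw [hh, mul_right_comm, ← pow_add, Nat.sub_add_cancel (by omega), ← mul_pow]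
    rw [this]
    refine tau_lead p e (w := bw (bs n m) (bt n m)) ?_
    convert (lead_hbig K n m).pow (p ^ e - 1) using 1
    ext x; simp
lemma TT_inv (e1 e2 : ℕ) {g1 : MvPolynomial ((Fin m ⊕ Bool) ⊠ₙ n) K}
    {g2 : MvPolynomial (Big m ⊠ₙ n) K}
    (hL1 : ∀ i j, adj i j → gdeg (Ld sla i j) g1 < p ^ e1) (hR1 : ∀ i j, adj i j → gdeg (Rd sra i j) g1 < p ^ e1)
    (hL2 : ∀ i j, adj i j → gdeg (Ld bla i j) g2 < p ^ e2) (hR2 : ∀ i j, adj i j → gdeg (Rd bra i j) g2 < p ^ e2)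
    {r} (hr : GInv r) : GInv (TT p e1 e2 g1 g2 r) := by
  haveI : Infinite K := IsAlgClosed.instInfinite
  apply GInv_of_shear
  · intro i j h
    apply rho_L
    refine tau_inv p e2 (isShear_Ld _ h.ne) _ ((gdeg_mul _ _ _).trans_lt ?_)
    rw [gdeg_rename (jj m n) jj_inj (Ld_map jf bla sla jf_l i j)]
    have := tau_inv p e1 (isShear_Ld _ h.ne) (g1 * rename (ix m n) r) ((gdeg_mul (Ld sla i j) _ _).trans_lt (by
      rw [gdeg_rename (ix m n) ix_inj (Ld_map Sum.inl sla tt (fun _ => rfl) i j), (gdeg_zero_iff _ _).2 (hr.L h.ne)]; exact hL1 i j h))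
    rw [(gdeg_zero_iff _ _).2 this]; exact hL2 i j h
  · intro i j h
    apply rho_R
    refine tau_inv p e2 (isShear_Rd _ h.ne) _ ((gdeg_mul _ _ _).trans_lt ?_)
    rw [gdeg_rename (jj m n) jj_inj (Rd_map jf bra sra jf_r i j)]
    have := tau_inv p e1 (isShear_Rd _ h.ne) (g1 * rename (ix m n) r) ((gdeg_mul (Rd sra i j) _ _).trans_lt (by
      rw [gdeg_rename (ix m n) ix_inj (Rd_map Sum.inl sra tt (fun _ => rfl) i j), (gdeg_zero_iff _ _).2 (hr.R h.ne)]; exact hR1 i j h))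
    rw [(gdeg_zero_iff _ _).2 this]; exact hR2 i j h
theorem Freg (hn : 0 < n) (c : ↥(matrixSemiInvariants K n m)) (hc : c ≠ 0) :
    ∃ (e : ℕ) (φ : ↥(matrixSemiInvariants K n m) → ↥(matrixSemiInvariants K n m)) (b : ↥(matrixSemiInvariants K n m)),
      (∀ x y, φ (x + y) = φ x + φ y) ∧ (∀ x y, φ (x ^ p ^ e * y) = x * φ y) ∧ φ (c * b) = 1 := by
  haveI : Infinite K := IsAlgClosed.instInfinite
  have hc' : (c : MvPolynomial (Fin m ⊠ₙ n) K) ≠ 0 := by simpa using hc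
  obtain ⟨e1, g1, u, k, hk, hL1, hR1, ht1⟩ := step1 (m := m) p hn ((c ^ n : ↥(matrixSemiInvariants K n m)) : MvPolynomial (Fin m ⊠ₙ n) K)
    ((mem_R _).1 (c ^ n).2) (by rw [SubmonoidClass.coe_pow]; exact pow_ne_zero n hc') (by
      
      rw [SubmonoidClass.coe_pow]
      have : ∀ k, ((c : MvPolynomial (Fin m ⊠ₙ n) K) ^ k).totalDegree = k * (c : MvPolynomial (Fin m ⊠ₙ n) K).totalDegree := by
        intro k
        induction k with
        | zero => simp
        | succ k ih => rw [pow_succ, totalDegree_mul_of_isDomain (pow_ne_zero _ hc') hc', ih]; ring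
      rw [this]; exact Dvd.intro _ rfl)
  obtain ⟨e2, g2, hL2, hR2, ht2⟩ := step2 (K := K) (n := n) (m := m) p u
  set k2 := (iterateFrobeniusEquiv K p e2).symm k with hk2def
  have hkq : k2 ^ p ^ e2 = k := by
    rw [← iterateFrobenius_def, ← coe_iterateFrobeniusEquiv]
    exact RingEquiv.apply_symm_apply _ _
  have hk2 : k2 ≠ 0 := by
    intro h; rw [h, zero_pow (q_pos p e2).ne'] at hkq; exact hk hkq.symm
  have hTc : TT p e1 e2 g1 g2 ((c ^ n : ↥(matrixSemiInvariants K n m)) : MvPolynomial _ K) = C k2 := by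
    unfold TT
    have h : ∀ y, rename (jj m n) (pD K y) = pD K (jf y) := fun y => ren_pD jf y
    rw [ht1, map_mul, map_pow, map_mul, h, h, rename_C, ← hkq, C_pow, mul_left_comm, tau_pow_mul]
    simp only [jf]
    rw [ht2, mul_one]; simp
  refine ⟨e1 + e2, fun r => ⟨TT p e1 e2 g1 g2 r, (mem_R _).2 (TT_inv p e1 e2 hL1 hR1 hL2 hR2 ((mem_R _).1 r.2))⟩,
    c ^ (n - 1) * (algebraMap K _ k2⁻¹) ^ p ^ (e1 + e2), ?_, ?_, ?_⟩
  · intro x y; exact Subtype.ext (TT_add p _ _ _ _ _ _)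
  · intro x y; exact Subtype.ext (TT_mul p _ _ _ _ _ _)
  · apply Subtype.ext
    have : c * (c ^ (n - 1) * (algebraMap K ↥(matrixSemiInvariants K n m) k2⁻¹) ^ p ^ (e1 + e2)) = (algebraMap K _ k2⁻¹) ^ p ^ (e1 + e2) * c ^ n := by
      rw [← mul_assoc, mul_pow_sub_one hn.ne', mul_comm]
    rw [this]
    refine (TT_mul p e1 e2 g1 g2 _ _).trans ?_
    rw [hTc]
    change C k2⁻¹ * C k2 = 1
    rw [← C_mul, inv_mul_cancel₀ hk2, C_1]
theorem SopReg_p (p : ℕ) [Fact p.Prime] [CharP K p] (hn : 0 < n) : SopReg K ↥(matrixSemiInvariants K n m) := SopReg_of_Freg p (Freg p hn)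
end
section scl
variable {K : Type} [Field K] {σ : Type}
lemma vand [Infinite K] {V : Type} [AddCommGroup V] [Module K V] (N : Submodule K V) (c : ℕ → V) (s : Finset ℕ)
    (h : ∀ t : K, t ≠ 0 → ∑ k ∈ s, t ^ k • c k ∈ N) (k : ℕ) (hk : k ∈ s) : c k ∈ N := by
  by_contra hc
  obtain ⟨φ, h1, h2⟩ := Submodule.exists_le_ker_of_notMem hc
  let P : Polynomial K := ∑ k ∈ s, Polynomial.monomial k (φ (c k))
  have hP : ∀ t : K, t ≠ 0 → P.eval t = 0 := by
    intro t ht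
    have := h2 (h t ht)
    rw [LinearMap.mem_ker, map_sum] at this
    rw [← this, Polynomial.eval_finset_sum]
    refine Finset.sum_congr rfl fun k _ => ?_
    simp [mul_comm]
  have hX : Polynomial.X * P = 0 := by
    apply Polynomial.funext
    intro t
    by_cases ht : t = 0
    · simp [ht]
    · simp [hP t ht]
  have hP0 : P = 0 := by simpa using hX
  have := congrArg (fun Q => Polynomial.coeff Q k) hP0
  simp [P, Polynomial.coeff_monomial, hk] at this
  exact h1 this
noncomputable def scl (w : σ → ℕ) (t : K) : MvPolynomial σ K →ₐ[K] MvPolynomial σ K := aeval fun i => C (t ^ w i) * X i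
lemma scl_homog {w : σ → ℕ} {f : MvPolynomial σ K} {k : ℕ} (h : IsWeightedHomogeneous w f k) (t : K) :
    scl w t f = t ^ k • f := by
  induction h using IsWeightedHomogeneous.induction_on with
  | zero => simp
  | add p q hp hq h1 h2 => rw [map_add, h1, h2, smul_add]
  | monomial d r hd =>
    subst hd
    simp only [scl, aeval_monomial, Finsupp.prod, mul_pow, Finset.prod_mul_distrib, Finsupp.weight_apply, Finsupp.sum]
    rw [monomial_eq, Finsupp.prod, smul_eq_C_mul, ← Finset.prod_pow_eq_pow_sum, map_prod]
    simp only [smul_eq_mul, pow_mul, mul_comm (d _), ← map_pow, algebraMap_eq]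
    ring
lemma scl_eq (w : σ → ℕ) (f : MvPolynomial σ K) : ∃ s : Finset ℕ, (∀ k ∉ s, weightedHomogeneousComponent w k f = 0) ∧
    ∀ t : K, scl w t f = ∑ k ∈ s, t ^ k • weightedHomogeneousComponent w k f := by
  have hf : Set.Finite (Function.support fun k => weightedHomogeneousComponent w k f) := weightedHomogeneousComponent_finsupp f
  refine ⟨hf.toFinset, fun k hk => by simpa using hk, fun t => ?_⟩
  conv_lhs => rw [← finsum_weightedHomogeneousComponent w f, finsum_eq_sum_of_support_toFinset_subset _ hf subset_rfl, map_sum]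
  exact Finset.sum_congr rfl fun k _ => scl_homog (weightedHomogeneousComponent_isWeightedHomogeneous _ _) t
lemma whc_mem [Infinite K] (N : Submodule K (MvPolynomial σ K)) (w : σ → ℕ) (f : MvPolynomial σ K)
    (h : ∀ t : K, t ≠ 0 → scl w t f ∈ N) (k : ℕ) : weightedHomogeneousComponent w k f ∈ N := by
  obtain ⟨s, h1, h2⟩ := scl_eq w f
  by_cases hk : k ∈ s
  · refine vand N (fun k => weightedHomogeneousComponent w k f) s (fun t ht => ?_) k hk
    rw [← h2 t]; exact h t ht
  · rw [h1 k hk]; exact N.zero_mem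
lemma homog_of_scl [Infinite K] (f : MvPolynomial σ K) (w : σ → ℕ) (d : ℕ) (h : ∀ t : K, t ≠ 0 → scl w t f = t ^ d • f) :
    IsWeightedHomogeneous w f d := by
  have key : ∀ k, k ≠ d → weightedHomogeneousComponent w k f = 0 := by
    intro k hk
    obtain ⟨s, h1, h2⟩ := scl_eq w f
    have := vand (⊥ : Submodule K (MvPolynomial σ K)) (fun k => weightedHomogeneousComponent w k f - if k = d then f else 0)
      (insert k (insert d s)) (fun t ht => ?_) k (by simp)
    · simpa [hk] using this
    · rw [Submodule.mem_bot]
      simp only [smul_sub, Finset.sum_sub_distrib, smul_ite, smul_zero, Finset.sum_ite_eq']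
      rw [if_pos (by simp), sub_eq_zero, ← h t ht, h2 t]
      symm
      refine Finset.sum_subset (fun x hx => by simp [hx]) fun x _ hx => by rw [h1 x hx, smul_zero]
  rw [← finsum_weightedHomogeneousComponent w f, finsum_eq_single (fun k => weightedHomogeneousComponent w k f) d key]
  exact weightedHomogeneousComponent_isWeightedHomogeneous _ _
end scl
section uniq
variable {K : Type} [Field K] {n : ℕ}
abbrev Zr (K : Type) [Field K] (n : ℕ) := MvPolynomial (Unit ⊠ₙ n) K
noncomputable def ev (z : Mt n K) : Zr K n →ₐ[K] K := aeval (R := K) (pt fun _ => z)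
lemma ev_X (z : Mt n K) (i j) : ev z (X ((), i, j)) = z i j := by simp [ev, pt]
lemma ev_sbs (a b z : Mt n K) (f : Zr K n) : ev z (sbs (K := K) a b f) = ev (a * z * b) f := eval_sbs _ _ _ _
lemma ev_ext [Infinite K] {f g : Zr K n} (h : ∀ z, ev z f = ev z g) : f = g := by
  apply MvPolynomial.funext
  intro x
  exact h (of fun i j => x ((), i, j))
lemma ev_dense [Infinite K] (M : Mt n (Polynomial K)) (g : Polynomial K) (hg : g ≠ 0) (f : Zr K n) (c : K)
    (h : ∀ s, g.eval s ≠ 0 → ev (M.map (Polynomial.eval s)) f = c) (s : K) : ev (M.map (Polynomial.eval s)) f = c := by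
  let Q : Polynomial K := aeval (R := K) (pt (β := Unit) fun _ => M) f
  have hQ : ∀ s, Q.eval s = ev (M.map (Polynomial.eval s)) f := by
    intro s
    have : (Polynomial.aeval s).comp (aeval (R := K) (pt (β := Unit) fun _ => M)) = ev (M.map (Polynomial.eval s)) := by
      apply MvPolynomial.algHom_ext
      rintro ⟨_, i, j⟩
      rw [AlgHom.comp_apply, ev_X]
      simp [pt, Polynomial.coe_aeval_eq_eval]
    have := DFunLike.congr_fun this f
    rw [← this, AlgHom.comp_apply, Polynomial.coe_aeval_eq_eval]
  have : g * (Q - Polynomial.C c) = 0 := by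
    apply Polynomial.funext
    intro t
    by_cases ht : g.eval t = 0
    · simp [ht]
    · simp [hQ, h t ht]
  rcases mul_eq_zero.1 this with h | h
  · exact absurd h hg
  · rw [← hQ, sub_eq_zero.1 h]; simp
def Psub (K : Type) [Field K] {n : ℕ} (w : Fin n → ℕ) : Submodule K (Zr K n) where
  carrier := {f | ∀ M : Mt n K, (∀ i j, i < j → M i j = 0) → ∀ z, ev (M * z) f = (∏ i, M i i ^ w i) * ev z f}
  add_mem' := fun {f g} hf hg M hM z => by rw [map_add, map_add, hf M hM, hg M hM, mul_add]
  zero_mem' := fun M hM z => by simp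
  smul_mem' := fun c f hf M hM z => by rw [map_smul, map_smul, hf M hM, smul_eq_mul, smul_eq_mul]; ring
lemma Psub_right {w : Fin n → ℕ} {f : Zr K n} (hf : f ∈ Psub K w) (b : Mt n K) : sbs (K := K) 1 b f ∈ Psub K w := by
  intro M hM z
  rw [ev_sbs, ev_sbs, one_mul, one_mul, Matrix.mul_assoc, hf M hM]
lemma uniq [Infinite K] {w : Fin n → ℕ} {f : Zr K n} (hf : f ∈ Psub K w)
    (h : ∀ U : Mt n K, (∀ i j, j < i → U i j = 0) → (∀ i, U i i = 1) → ev U f = 0) : f = 0 := by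
  have h1 : ∀ z : Mt n K, (∀ i j, j < i → z i j = 0) → ev z f = 0 := by
    intro z hz
    have h0 : ∀ z : Mt n K, (∀ i j, j < i → z i j = 0) → (∀ i, z i i ≠ 0) → ev z f = 0 := by
      intro z hz hd
      have e : z = diagonal (fun i => z i i) * (diagonal (fun i => (z i i)⁻¹) * z) := by
        rw [← Matrix.mul_assoc, diagonal_mul_diagonal]
        simp [hd]
      rw [e, hf _ (fun i j hij => by simp [hij.ne]), h, mul_zero]
      · intro i j hij; simp [hz i j hij]
      · intro i; simp [hd i]
    have := ev_dense (z.map Polynomial.C + (Polynomial.X : Polynomial K) • 1) (∏ i, (Polynomial.X + Polynomial.C (z i i)))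
      (Finset.prod_ne_zero_iff.2 fun i _ => Polynomial.X_add_C_ne_zero _) f 0 (fun s hs => ?_) 0
    · convert this
      simp [Matrix.ext_iff.symm]
    · apply h0
      · intro i j hij; simp [hz i j hij, hij.ne']
      · intro i
        rw [Polynomial.eval_prod, Finset.prod_ne_zero_iff] at hs
        have := hs i (Finset.mem_univ _)
        simpa [add_comm] using this
  have h2 : ∀ d : ℕ, ∀ k : ℕ, k + d = n → ∀ z : Mt n K, (∀ i j : Fin n, j.val < k → j < i → z i j = 0) → ev z f = 0 := by
    intro d
    induction d with
    | zero => intro k hk z hz; exact h1 z fun i j hij => hz i j (by omega) hij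
    | succ d ih =>
      intro k hk z hz
      let κ : Fin n := ⟨k, by omega⟩
      have h0 : ∀ z : Mt n K, (∀ i j : Fin n, j.val < k → j < i → z i j = 0) → z κ κ ≠ 0 → ev z f = 0 := by
        intro z hz hd
        let c : Fin n → K := fun i => if κ < i then - z i κ / z κ κ else 0
        have e := hf (1 + vecMulVec c (Pi.single κ 1)) (fun i j hij => ?_) z
        · have e2 : (1 + vecMulVec c (Pi.single κ 1)) * z = z + vecMulVec c (z κ) := by
            rw [Matrix.add_mul, Matrix.one_mul, vecMulVec_mul]; congr 1
            congr 1
            simp [Matrix.row]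
          have e3 : ∀ i, (1 + vecMulVec c (Pi.single κ (1:K)) : Mt n K) i i = 1 := by
            intro i
            simp only [Matrix.add_apply, one_apply_eq, vecMulVec_apply, c]
            by_cases hi : i = κ
            · simp [hi]
            · simp [hi]
          simp only [e3, one_pow, Finset.prod_const_one, one_mul] at e
          rw [← e, e2]
          refine ih (k + 1) (by omega) _ fun i j hj hji => ?_
          simp only [Matrix.add_apply, vecMulVec_apply, c]
          by_cases hjk : j.val < k
          · rw [hz i j hjk hji, hz κ j hjk hjk]; simp
          · have : j = κ := Fin.ext (by simp [κ]; omega)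
            subst this
            rw [if_pos hji]; field_simp; ring
        · simp only [Matrix.add_apply, vecMulVec_apply, c]
          by_cases hj : j = κ
          · subst hj; simp [hij.ne, hij.not_gt]
          · simp [hj, hij.ne]
      have := ev_dense (z.map Polynomial.C + (Polynomial.X : Polynomial K) • single κ κ 1) (Polynomial.X + Polynomial.C (z κ κ))
        (Polynomial.X_add_C_ne_zero _) f 0 (fun s hs => ?_) 0
      · convert this
        simp [Matrix.ext_iff.symm, single_apply, apply_ite (Polynomial.eval (0:K))]
      · apply h0
        · intro i j hj hij
          have : j ≠ κ := by intro h; simp [h, κ] at hj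
          simp [hz i j hj hij, single_apply, this.symm]
        · simpa [add_comm] using hs
  exact ev_ext fun z => by rw [h2 n 0 (by simp) z (fun i j hj => absurd hj (by omega)), map_zero]
end uniq
section gr1
variable {K : Type} [Field K] {n : ℕ}
lemma ev_pD (z : Mt n K) : ev z (pD K ()) = z.det := by
  unfold pD vdet
  rw [AlgHom.map_det]
  congr 1
  refine Matrix.ext fun i j => ?_
  simp [ev_X]
lemma ev_pU (z : Mt n K) (d : Fin n) : ev z (pU K () d) =
    (of fun k l : Fin (n - d) => z ⟨k, by omega⟩ ⟨l + d, by omega⟩).det := by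
  unfold pU vdet
  rw [AlgHom.map_det]
  congr 1
  refine Matrix.ext fun i j => ?_
  simp [ev_X]
def w0 (K : Type) [Field K] (n : ℕ) : Mt n K := (1 : Mt n K).submatrix id Fin.rev
lemma mul_w0 (z : Mt n K) (i j) : (z * w0 K n) i j = z i (Fin.rev j) := by
  simp [Matrix.mul_apply, w0, Matrix.one_apply]
lemma w0_w0 : w0 K n * w0 K n = 1 := by
  ext i j; rw [mul_w0, w0, submatrix_apply, Fin.rev_rev]; rfl
def wq (n Q : ℕ) (i : Fin n) : ℕ := Q * ((nz n).filter fun d : Fin n => i.val < n - d).card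
noncomputable def pp (K : Type) [Field K] (n Q : ℕ) : Zr K n := pUs K () ^ Q
lemma pU_left (M z : Mt n K) (hM : ∀ i j, i < j → M i j = 0) (d : Fin n) :
    ev (M * z) (pU K () d) = (∏ i : Fin n, if i.val < n - d then M i i else 1) * ev z (pU K () d) := by
  rw [ev_pU, ev_pU]
  have e : (of fun k l : Fin (n - d) => (M * z) ⟨k, by omega⟩ ⟨l + d, by omega⟩) =
     (of fun k l : Fin (n - d) => M ⟨k, by omega⟩ ⟨l, by omega⟩) * (of fun k l : Fin (n - d) => z ⟨k, by omega⟩ ⟨l + d, by omega⟩) := by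
    ext k l
    simp only [Matrix.mul_apply, of_apply]
    symm
    refine Finset.sum_of_injOn (fun x : Fin (n - d) => (⟨x, by omega⟩ : Fin n)) ?_ ?_ ?_ ?_
    · intro a _ b _ h; exact Fin.ext (by simpa using h)
    · intro a _; simp
    · intro x _ hx
      rw [hM, zero_mul]
      by_contra hc
      apply hx
      rw [Fin.lt_def] at hc
      exact ⟨⟨x, by simp at hc; omega⟩, by simp, rfl⟩
    · intro x _; rfl
  rw [e, det_mul]
  congr 1
  rw [det_of_lowerTriangular]
  · refine Finset.prod_of_injOn (fun x : Fin (n - d) => (⟨x, by omega⟩ : Fin n)) ?_ ?_ ?_ ?_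
    · intro a _ b _ h; exact Fin.ext (by simpa using h)
    · intro a _; simp
    · intro x _ hx
      rw [if_neg]
      intro hc
      exact hx ⟨⟨x, hc⟩, by simp, rfl⟩
    · intro x _; simp
  · intro i j hij
    exact hM _ _ hij
lemma pp_mem (Q : ℕ) : pp K n Q ∈ Psub K (wq n Q) := by
  intro M hM z
  simp only [pp, pUs, map_pow, map_prod, pU_left M z hM, Finset.prod_mul_distrib]
  rw [mul_pow]
  congr 1
  rw [Finset.prod_comm, ← Finset.prod_pow]
  refine Finset.prod_congr rfl fun i _ => ?_
  rw [← Finset.prod_filter, Finset.prod_const, ← pow_mul, wq, mul_comm]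
lemma pp_U (Q : ℕ) : ∃ c : K, c ≠ 0 ∧ ∀ U : Mt n K, (∀ i j, j < i → U i j = 0) → (∀ i, U i i = 1) →
    ev (U * w0 K n) (pp K n Q) = c := by
  refine ⟨(∏ d ∈ nz n, (((Equiv.Perm.sign (Fin.revPerm (n := n - d)) : ℤ) : K))) ^ Q, ?_, ?_⟩
  · apply pow_ne_zero
    rw [Finset.prod_ne_zero_iff]
    intro d _
    rcases Int.units_eq_one_or (Equiv.Perm.sign (Fin.revPerm (n := n - d))) with h | h <;> simp [h]
  · intro U h1 h2
    simp only [pp, pUs, map_pow, map_prod]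
    congr 1
    refine Finset.prod_congr rfl fun d _ => ?_
    rw [ev_pU]
    have e : (of fun k l : Fin (n - d) => (U * w0 K n) ⟨k, by omega⟩ ⟨l + d, by omega⟩) =
      ((of fun k l : Fin (n - d) => U ⟨k, by omega⟩ ⟨l, by omega⟩).submatrix id Fin.revPerm) := by
      ext k l
      rw [of_apply, mul_w0]
      simp only [submatrix_apply, of_apply, id, Fin.revPerm_apply]
      congr 1
      ext; simp [Fin.val_rev]; omega
    rw [e, det_permute', det_of_upperTriangular]
    · simp [h2]
    · intro i j hij
      exact h1 _ _ hij
lemma pLs_w0 : sbs (K := K) (w0 K n) 1 (sbs (K := K) 1 (w0 K n) (pUs K ())) = pLs K () := by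
  classical
  rw [sbs_sbs, one_mul]
  have : ∀ d, sbs (K := K) (w0 K n) (w0 K n) (pU K () d) = (pL K () d : Zr K n) := by
    intro d
    unfold pL pU vdet
    rw [AlgHom.map_det, AlgHom.map_det, ← det_transpose, ← det_submatrix_equiv_self Fin.revPerm]
    congr 1
    refine Matrix.ext fun k l => ?_
    simp only [submatrix_apply, transpose_apply, AlgHom.mapMatrix_apply, map_apply, of_apply, Option.elim, sbs_X, rename_X, tr]
    have e1 : (w0 K n).map (C (σ := Unit ⊠ₙ n)) = (1 : Mt n (Zr K n)).submatrix id Fin.rev := by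
      refine Matrix.ext fun i j => ?_
      simp [w0, Matrix.one_apply, apply_ite]
    rw [e1]
    simp only [Matrix.mul_apply, submatrix_apply, Matrix.one_apply, id, gX, of_apply, Fin.revPerm_apply]
    simp only [mul_ite, mul_one, mul_zero, ite_mul, one_mul, zero_mul, Finset.sum_ite_eq', Finset.sum_ite_eq, Finset.mem_univ, if_true]
    rw [Finset.sum_eq_single ⟨l + d, by omega⟩]
    · rw [if_pos]
      · refine congrArg X (Prod.ext rfl (Prod.ext rfl (Fin.ext ?_))); simp only [Fin.val_rev]; have := k.2; have := d.2; omega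
      · ext; simp [Fin.val_rev]; omega
    · intro b _ hb
      rw [if_neg]
      intro h; apply hb
      have := congrArg Fin.rev h; simp only [Fin.rev_rev] at this; rw [← this]; ext; simp [Fin.val_rev]; omega
    · simp
  simp only [pUs, pLs, map_prod, this]
end gr1
section gr2
variable {K : Type} [Field K] {n : ℕ}
lemma sbs_pD [Infinite K] (a b : Mt n K) : sbs (K := K) a b (pD K () : Zr K n) = (a.det * b.det) • pD K () := by
  refine ev_ext fun z => ?_
  rw [ev_sbs, ev_pD, map_smul, ev_pD, det_mul, det_mul, smul_eq_mul]; ring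
noncomputable def Bf (Q : ℕ) (f h : Zr K n) : K := coeff (cst _ Q) (pD K () ^ Q * f * sbs (K := K) (w0 K n) 1 h)
lemma Bf_add (Q : ℕ) (f f' h : Zr K n) : Bf Q (f + f') h = Bf Q f h + Bf Q f' h := by
  simp [Bf, mul_add, add_mul]
lemma Bf_smul (Q : ℕ) (c : K) (f h : Zr K n) : Bf Q (c • f) h = c * Bf Q f h := by
  simp [Bf]
def Nsub (K : Type) [Field K] (n Q : ℕ) : Submodule K (Zr K n) where
  carrier := {f | f ∈ Psub K (wq n Q) ∧ ∀ h ∈ Psub K (wq n Q), Bf Q f h = 0}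
  add_mem' := fun {f g} hf hg => ⟨Submodule.add_mem _ hf.1 hg.1, fun h hh => by rw [Bf_add, hf.2 h hh, hg.2 h hh, add_zero]⟩
  zero_mem' := ⟨Submodule.zero_mem _, fun h _ => by simp [Bf]⟩
  smul_mem' := fun c f hf => ⟨Submodule.smul_mem _ _ hf.1, fun h hh => by rw [Bf_smul, hf.2 h hh, mul_zero]⟩
variable [IsAlgClosed K] (p : ℕ) [Fact p.Prime] [CharP K p] (e : ℕ)
lemma inv_det {b : Mt n K} (hb : b.det = 1) : b * b⁻¹ = 1 ∧ b⁻¹ * b = 1 ∧ b⁻¹.det = 1 := by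
  have : IsUnit b.det := by rw [hb]; exact isUnit_one
  exact ⟨mul_nonsing_inv _ this, nonsing_inv_mul _ this, by rw [det_nonsing_inv, hb]; simp⟩
lemma Bf_inv (f h : Zr K n) (b : Mt n K) (hb : b.det = 1) :
    Bf (p ^ e - 1) (sbs (K := K) 1 b f) (sbs (K := K) 1 b h) = Bf (p ^ e - 1) f h := by
  have := IsAlgClosed.instInfinite (K := K)
  unfold Bf
  rw [← coeff_sbs p e 1 b det_one hb (pD K () ^ (p ^ e - 1) * f * sbs (K := K) (w0 K n) 1 h), map_mul, map_mul, map_pow, sbs_pD, det_one, hb]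
  rw [sbs_sbs, sbs_sbs]; simp
lemma Nsub_SL {f : Zr K n} (hf : f ∈ Nsub K n (p ^ e - 1)) (b : Mt n K) (hb : b.det = 1) :
    sbs (K := K) 1 b f ∈ Nsub K n (p ^ e - 1) := by
  refine ⟨Psub_right hf.1 b, fun h hh => ?_⟩
  have := Bf_inv p e f (sbs (K := K) 1 b⁻¹ h) b hb
  rw [sbs_sbs, (inv_det hb).1, one_mul, sbs_one] at this
  rw [this]; exact hf.2 _ (Psub_right hh _)
lemma GL_SL (hn : 0 < n) (b : Mt n K) (hb : b.det ≠ 0) :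
    ∃ (c : K) (b1 : Mt n K), c ≠ 0 ∧ c ^ n = b.det ∧ b1.det = 1 ∧ b = c • b1 := by
  obtain ⟨c, hc⟩ := IsAlgClosed.exists_pow_nat_eq b.det hn
  have hc0 : c ≠ 0 := by rintro rfl; rw [zero_pow hn.ne'] at hc; exact hb hc.symm
  refine ⟨c, c⁻¹ • b, hc0, hc, ?_, by rw [smul_smul, mul_inv_cancel₀ hc0, one_smul]⟩
  rw [det_smul, Fintype.card_fin, inv_pow, hc, inv_mul_cancel₀ hb]
lemma Psub_smul {w : Fin n → ℕ} {f : Zr K n} (hf : f ∈ Psub K w) (c : K) :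
    sbs (K := K) 1 (c • 1 : Mt n K) f = c ^ (∑ i, w i) • f := by
  have := IsAlgClosed.instInfinite (K := K)
  refine ev_ext fun z => ?_
  rw [ev_sbs, map_smul, one_mul, smul_eq_mul]
  have := hf (c • 1) (fun i j hij => by simp [hij.ne]) z
  rw [show z * c • (1 : Mt n K) = (c • 1) * z by simp, this]
  simp [Finset.prod_pow_eq_pow_sum]
lemma Nsub_GL (hn : 0 < n) {f : Zr K n} (hf : f ∈ Nsub K n (p ^ e - 1)) (b : Mt n K) (hb : b.det ≠ 0) :
    sbs (K := K) 1 b f ∈ Nsub K n (p ^ e - 1) := by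
  obtain ⟨c, b1, h1, h2, h3, rfl⟩ := GL_SL hn b hb
  have := sbs_sbs 1 (c • 1) 1 b1 f
  rw [one_mul, show b1 * c • (1 : Mt n K) = c • b1 by simp] at this
  rw [← this]
  rw [Psub_smul hf.1, map_smul]
  exact Submodule.smul_mem _ _ (Nsub_SL p e hf b1 h3)
def vcol (n : ℕ) : Unit ⊠ₙ n → ℕ := fun x => x.2.2
lemma scl_vcol (t : K) : scl (vcol n) t = sbs (K := K) 1 (diagonal fun j : Fin n => t ^ j.val) := by
  apply MvPolynomial.algHom_ext
  rintro ⟨k, a, b⟩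
  rw [sbs_X, Matrix.map_one _ (map_zero _) (map_one _), one_mul, Matrix.diagonal_map (map_zero _), mul_diagonal]
  simp [scl, gX, vcol, mul_comm]
lemma Bf_pp : Bf (p ^ e - 1) (pp K n (p ^ e - 1)) (sbs (K := K) 1 (w0 K n) (pp K n (p ^ e - 1))) = 1 := by
  unfold Bf pp
  rw [map_pow, map_pow, pLs_w0, ← mul_pow, ← mul_pow]
  have := ((lead_eta K (n := n) 0 0 ()).pow (p ^ e - 1)).1
  rw [eta] at this
  have e : (p ^ e - 1) • blk () = cst (Unit ⊠ₙ n) (p ^ e - 1) := by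
    refine Finsupp.ext fun x => ?_
    simp [blk_apply]
  rwa [e] at this
lemma const_U {w : Fin n → ℕ} {F : Zr K n} (hF : F ∈ Psub K w) (k : ℕ)
    (hk : IsWeightedHomogeneous (vcol n) F k) (h1 : ev 1 F ≠ 0) (U : Mt n K)
    (hU : ∀ i j, j < i → U i j = 0) (hU1 : ∀ i, U i i = 1) : ev U F = ev 1 F := by
  have hinf := IsAlgClosed.instInfinite (K := K)
  have hR : ∀ (s : K) z, ev (z * diagonal fun j : Fin n => s ^ j.val) F = s ^ k * ev z F := by
    intro s z
    have := ev_sbs 1 (diagonal fun j : Fin n => s ^ j.val) z F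
    rw [one_mul] at this
    rw [← this, ← scl_vcol, scl_homog hk, map_smul, smul_eq_mul]
  have hL : ∀ (s : K) z, ev ((diagonal fun j : Fin n => s ^ j.val) * z) F = (∏ i : Fin n, (s ^ i.val) ^ w i) * ev z F := by
    intro s z
    have := hF (diagonal fun j : Fin n => s ^ j.val) (fun i j hij => by simp [hij.ne]) z
    rw [this]; simp
  have hs : ∀ s : K, s ^ k = ∏ i : Fin n, (s ^ i.val) ^ w i := by
    intro s
    have := hR s 1
    rw [one_mul] at this
    have h2 := hL s 1
    rw [mul_one, this] at h2
    exact mul_right_cancel₀ h1 h2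
  have key := ev_dense (of fun i j : Fin n => if i ≤ j then Polynomial.C (U i j) * Polynomial.X ^ (j.val - i.val) else 0)
    Polynomial.X Polynomial.X_ne_zero F (ev U F) (fun s hs0 => ?_) 0
  · rw [← key]
    congr 2
    ext i j
    simp only [map_apply, of_apply, Matrix.one_apply]
    rcases lt_trichotomy i j with h | h | h
    · have : j.val - i.val ≠ 0 := by rw [Fin.lt_def] at h; omega
      simp [h.le, h.ne, this]
    · subst h; simp [hU1]
    · simp [h.not_ge, h.ne']
  · rw [Polynomial.eval_X] at hs0
    have hne : s ^ k ≠ 0 := pow_ne_zero _ hs0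
    apply mul_left_cancel₀ hne
    conv_lhs => rw [hs s]
    rw [← hL, ← hR]
    congr 2
    ext i j
    rw [diagonal_mul, mul_diagonal]
    simp only [map_apply, of_apply]
    rcases lt_or_ge j i with h | h
    · simp [h.not_ge, hU i j h]
    · simp only [h, if_true, Polynomial.eval_mul, Polynomial.eval_C, Polynomial.eval_pow, Polynomial.eval_X]
      rw [mul_left_comm, ← pow_add, Nat.add_sub_cancel' h]
lemma rad (hn : 0 < n) : Nsub K n (p ^ e - 1) = ⊥ := by
  have hinf := IsAlgClosed.instInfinite (K := K)
  rw [eq_bot_iff]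
  intro f hf
  rw [Submodule.mem_bot]
  by_contra hf0
  obtain ⟨z, hz1, hz2⟩ : ∃ z : Mt n K, z.det ≠ 0 ∧ ev z f ≠ 0 := by
    by_contra hc
    push Not at hc
    have h0 : pD K () * f = 0 := ev_ext fun z => by
      rw [map_mul, ev_pD, map_zero]
      by_cases h : z.det = 0
      · rw [h, zero_mul]
      · rw [hc z h, mul_zero]
    rcases mul_eq_zero.1 h0 with h | h
    · have := congrArg (ev (1 : Mt n K)) h
      rw [ev_pD] at this; simp at this
    · exact hf0 h
  have hf1 := Nsub_GL p e hn hf z hz1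
  set f1 := sbs (K := K) 1 z f with hf1d
  have he1 : ev 1 f1 ≠ 0 := by rw [hf1d, ev_sbs, one_mul, one_mul]; exact hz2
  have hcomp := whc_mem (Nsub K n (p ^ e - 1)) (vcol n) f1 (fun t ht => by
    rw [scl_vcol]
    refine Nsub_GL p e hn hf1 _ ?_
    rw [det_diagonal]
    exact Finset.prod_ne_zero_iff.2 fun i _ => pow_ne_zero _ ht)
  obtain ⟨k, hk⟩ : ∃ k, ev 1 (weightedHomogeneousComponent (vcol n) k f1) ≠ 0 := by
    by_contra hc
    push Not at hc
    obtain ⟨s, -, h2⟩ := scl_eq (vcol n) f1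
    have := h2 1
    rw [scl_vcol] at this
    simp only [one_pow, diagonal_one, sbs_one, one_smul] at this
    rw [this, map_sum] at he1
    exact he1 (Finset.sum_eq_zero fun k _ => hc k)
  set F := weightedHomogeneousComponent (vcol n) k f1
  have hF : F ∈ Nsub K n (p ^ e - 1) := hcomp k
  obtain ⟨c, hc0, hc⟩ := pp_U (K := K) (n := n) (p ^ e - 1)
  have hh : sbs (K := K) 1 (w0 K n) (pp K n (p ^ e - 1)) ∈ Psub K (wq n (p ^ e - 1)) := Psub_right (pp_mem _) _
  have huq := uniq (Submodule.sub_mem _ (Submodule.smul_mem _ c hF.1) (Submodule.smul_mem _ (ev 1 F) hh)) (fun U h1 h2 => by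
    rw [map_sub, map_smul, map_smul, ev_sbs, one_mul, hc U h1 h2, const_U hF.1 k (weightedHomogeneousComponent_isWeightedHomogeneous _ _) hk U h1 h2]
    simp [mul_comm])
  have h3 : sbs (K := K) 1 (w0 K n) (pp K n (p ^ e - 1)) ∈ Nsub K n (p ^ e - 1) := by
    have : ev 1 F • sbs (K := K) 1 (w0 K n) (pp K n (p ^ e - 1)) ∈ Nsub K n (p ^ e - 1) := by
      rw [← sub_eq_zero.1 huq]; exact Submodule.smul_mem _ _ hF
    exact (Submodule.smul_mem_iff _ hk).1 this
  have hw : (w0 K n).det ≠ 0 := by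
    intro h
    have := congrArg det (w0_w0 (K := K) (n := n))
    rw [det_mul, h] at this; simp at this
  have h4 := Nsub_GL p e hn h3 _ hw
  rw [sbs_sbs, w0_w0, one_mul, sbs_one] at h4
  have h5 := h4.2 _ hh
  rw [Bf_pp] at h5
  exact one_ne_zero h5
theorem gr_data (hn : 0 < n) : ∃ (D : ℕ) (P : Fin D → Zr K n), 0 < D ∧
    (∀ b : Mt n K, b.det = 1 → ∃ ρ : Matrix (Fin D) (Fin D) K, ∀ a, sbs (K := K) 1 b (P a) = ∑ c, ρ a c • P c) ∧
    (of fun a c => Bf (p ^ e - 1) (P a) (P c)).det ≠ 0 := by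
  have hinf := IsAlgClosed.instInfinite (K := K)
  have hle : Psub K (wq n (p ^ e - 1)) ≤ homogeneousSubmodule _ K (∑ i, wq n (p ^ e - 1) i) := by
    intro f hf
    refine homog_of_scl f _ _ fun t ht => ?_
    rw [← Psub_smul hf]
    have : scl (1 : Unit ⊠ₙ n → ℕ) t = sbs (K := K) 1 (t • 1 : Mt n K) := by
      apply MvPolynomial.algHom_ext
      rintro ⟨k, a, b⟩
      rw [sbs_X, Matrix.map_one _ (map_zero _) (map_one _), one_mul, smul_one_eq_diagonal, Matrix.diagonal_map (map_zero _), mul_diagonal]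
      simp [scl, gX, mul_comm]
    rw [this]
  have hfin1 : Module.Finite K (homogeneousSubmodule (Unit ⊠ₙ n) K (∑ i, wq n (p ^ e - 1) i)) :=
    Module.Finite.iff_fg.2 (homogeneousSubmodule_fg _ _ _)
  have hfin : Module.Finite K (Psub K (wq n (p ^ e - 1))) := Submodule.finiteDimensional_of_le hle
  let bs := Module.finBasis K (Psub K (wq n (p ^ e - 1)))
  refine ⟨_, fun a => (bs a : Zr K n), ?_, ?_, ?_⟩
  · rw [Module.finrank_pos_iff]
    refine ⟨⟨⟨_, pp_mem _⟩, 0, fun h => ?_⟩⟩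
    have := congrArg Subtype.val h
    obtain ⟨c, h1, h2⟩ := pp_U (K := K) (n := n) (p ^ e - 1)
    apply h1
    rw [← h2 1 (fun i j hij => by simp [hij.ne']) (by simp)]
    simp only at this
    rw [this]; simp
  · intro b hb
    refine ⟨of fun a c => bs.repr ⟨_, Psub_right (bs a).2 b⟩ c, fun a => ?_⟩
    have := congrArg Subtype.val (bs.sum_repr ⟨_, Psub_right (bs a).2 b⟩)
    simp only [Submodule.coe_sum, Submodule.coe_smul] at this
    exact this.symm
  · intro h
    rw [← exists_vecMul_eq_zero_iff] at h
    obtain ⟨v, hv0, hv⟩ := h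
    apply hv0
    have hmem : ((∑ a, v a • bs a : Psub K (wq n (p ^ e - 1))) : Zr K n) ∈ Nsub K n (p ^ e - 1) := by
      refine ⟨Subtype.mem _, fun h hh => ?_⟩
      have e1 : ∀ c, Bf (p ^ e - 1) ((∑ a, v a • bs a : Psub K (wq n (p ^ e - 1))) : Zr K n) (bs c) = 0 := by
        intro c
        have := congrFun hv c
        simp only [vecMul, dotProduct, of_apply, Pi.zero_apply] at this
        rw [← this]
        simp [Bf, Submodule.coe_sum, Submodule.coe_smul, Finset.mul_sum, Finset.sum_mul, coeff_sum]
      have e2 := congrArg Subtype.val (bs.sum_repr ⟨h, hh⟩)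
      simp only [Submodule.coe_sum, Submodule.coe_smul] at e2
      rw [← e2]
      unfold Bf at e1 ⊢
      rw [map_sum, Finset.mul_sum, coeff_sum]
      refine Finset.sum_eq_zero fun c _ => ?_
      rw [map_smul, mul_smul_comm, coeff_smul, e1 c, smul_zero]
    rw [rad p e hn, Submodule.mem_bot] at hmem
    have h2 : (∑ a, v a • bs a) = 0 := Subtype.ext hmem
    funext a
    exact Fintype.linearIndependent_iff.1 bs.linearIndependent v h2 a
end gr2
section gr3
variable {K : Type} [Field K] {n : ℕ} {β : Type}
abbrev Sr (K : Type) [Field K] (β : Type) (n : ℕ) := MvPolynomial (β ⊠ₙ n) K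
abbrev ZS (K : Type) [Field K] (β : Type) (n : ℕ) := MvPolynomial (Unit ⊠ₙ n) (Sr K β n)
noncomputable def sL : Sr K β n →ₐ[K] ZS K β n :=
  aeval (pt fun k => gX Unit n (Sr K β n) () * (gX β n K k).map C)
noncomputable def evS (z : Mt n K) : ZS K β n →ₐ[Sr K β n] Sr K β n := aeval (pt fun _ => z.map C)
noncomputable def rZ (a : Mt n K) : ZS K β n →ₐ[Sr K β n] ZS K β n :=
  aeval (pt fun _ => gX Unit n (Sr K β n) () * (a.map C).map C)
noncomputable def iZ : Zr K n →ₐ[K] ZS K β n := mapAlgHom (Algebra.ofId K (Sr K β n))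
lemma iZ_X (x) : iZ (β := β) (X x : Zr K n) = X x := by simp [iZ]
lemma iZ_coeff (f : Zr K n) (μ) : coeff μ (iZ (β := β) f) = C (coeff μ f) := by
  simp [iZ, coeff_map]
lemma evS_sL (z : Mt n K) (s : Sr K β n) : evS z (sL s) = sbs (K := K) z 1 s := by
  have : ((evS z).restrictScalars K).comp (sL (K := K) (β := β) (n := n)) = sbs (K := K) z 1 := by
    apply MvPolynomial.algHom_ext
    rintro ⟨k, i, j⟩
    rw [AlgHom.comp_apply, sbs_X, Matrix.map_one _ (map_zero _) (map_one _), mul_one]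
    simp [sL, evS, pt, Matrix.mul_apply, gX]
  exact DFunLike.congr_fun this s
lemma evS_iZ (z : Mt n K) (f : Zr K n) : evS (β := β) z (iZ f) = C (ev z f) := by
  have : ((evS z).restrictScalars K).comp (iZ (K := K) (β := β) (n := n)) = (Algebra.ofId K (Sr K β n)).comp (ev z) := by
    apply MvPolynomial.algHom_ext
    rintro ⟨⟨⟩, i, j⟩
    rw [AlgHom.comp_apply, AlgHom.comp_apply, iZ_X, ev_X]
    simp [evS, pt]
  exact DFunLike.congr_fun this f
lemma rZ_iZ (a : Mt n K) (f : Zr K n) : rZ (β := β) a (iZ f) = iZ (sbs (K := K) 1 a f) := by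
  have : ((rZ a).restrictScalars K).comp (iZ (K := K) (β := β) (n := n)) = iZ.comp (sbs (K := K) 1 a) := by
    apply MvPolynomial.algHom_ext
    rintro ⟨k, i, j⟩
    rw [AlgHom.comp_apply, AlgHom.comp_apply, sbs_X, Matrix.map_one _ (map_zero _) (map_one _), one_mul, iZ_X]
    simp only [rZ, AlgHom.coe_restrictScalars', aeval_X, pt, Matrix.mul_apply, gX, of_apply, map_sum, map_mul, iZ_X, map_apply]
    refine Finset.sum_congr rfl fun l _ => ?_
    rw [← algebraMap_eq K (Unit ⊠ₙ n), AlgHom.commutes]; rfl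
  exact DFunLike.congr_fun this f
lemma map_sL_left (a : Mt n K) (s : Sr K β n) :
    mapAlgHom (sbs (β := β) (K := K) a 1) (sL s) = (rZ a (sL s)) := by
  have : (mapAlgHom (σ := Unit ⊠ₙ n) (sbs (β := β) (K := K) a 1)).comp sL = ((rZ a).restrictScalars K).comp sL := by
    apply MvPolynomial.algHom_ext
    rintro ⟨k, i, j⟩
    have e1 : (gX β n K k).map (sbs (K := K) a 1) = a.map C * gX β n K k := by
      refine Matrix.ext fun i j => ?_
      simp only [map_apply, gX, of_apply, sbs_X]
      rw [Matrix.map_one _ (map_zero _) (map_one _), mul_one]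
    have l1 : mapAlgHom (σ := Unit ⊠ₙ n) (sbs (β := β) (K := K) a 1) (sL (X (k, i, j))) =
        (gX Unit n (Sr K β n) () * ((gX β n K k).map (sbs (K := K) a 1)).map C : Mt n (ZS K β n)) i j := by
      simp [sL, pt, Matrix.mul_apply, gX]
    have l2 : (rZ a).restrictScalars K (sL (X (k, i, j))) =
        (gX Unit n (Sr K β n) () * (a.map C).map C * (gX β n K k).map C : Mt n (ZS K β n)) i j := by
      rw [Matrix.mul_apply]
      simp [sL, pt, Matrix.mul_apply, gX, rZ]
    rw [AlgHom.comp_apply, AlgHom.comp_apply, l1, l2, e1, Matrix.map_mul, Matrix.mul_assoc]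
  exact DFunLike.congr_fun this s
lemma map_sL_right (b : Mt n K) (s : Sr K β n) :
    mapAlgHom (sbs (β := β) (K := K) 1 b) (sL s) = sL (sbs (K := K) 1 b s) := by
  have : (mapAlgHom (σ := Unit ⊠ₙ n) (sbs (β := β) (K := K) 1 b)).comp sL = sL.comp (sbs (K := K) 1 b) := by
    apply MvPolynomial.algHom_ext
    rintro ⟨k, i, j⟩
    have l1 : mapAlgHom (σ := Unit ⊠ₙ n) (sbs (β := β) (K := K) 1 b) (sL (X (k, i, j))) =
        (gX Unit n (Sr K β n) () * (gX β n K k * b.map C).map C : Mt n (ZS K β n)) i j := by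
      simp [sL, pt, Matrix.mul_apply, gX, sbs_X, Matrix.map_one, Matrix.one_apply, apply_ite C]
    have l2 : sL (sbs (K := K) 1 b (X (k, i, j))) =
        (gX Unit n (Sr K β n) () * (gX β n K k).map C * (b.map C).map C : Mt n (ZS K β n)) i j := by
      rw [sbs_X, Matrix.map_one _ (map_zero _) (map_one _), one_mul, Matrix.mul_apply, Matrix.mul_apply, map_sum]
      refine Finset.sum_congr rfl fun l _ => ?_
      rw [map_mul]
      congr 1
      · simp [gX, sL, pt]
      · simp only [map_apply]
        rw [← algebraMap_eq K (β ⊠ₙ n), AlgHom.commutes]; rfl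
    rw [AlgHom.comp_apply, AlgHom.comp_apply, l1, l2, Matrix.map_mul, Matrix.mul_assoc]
  exact DFunLike.congr_fun this s
lemma map_iZ (g : Sr K β n →ₐ[K] Sr K β n) (f : Zr K n) : mapAlgHom (σ := Unit ⊠ₙ n) g (iZ f) = iZ f := by
  have : (mapAlgHom (σ := Unit ⊠ₙ n) g).comp iZ = iZ := by
    apply MvPolynomial.algHom_ext
    intro x
    simp [iZ_X]
  exact DFunLike.congr_fun this f
lemma coeffs_mem [Infinite K] (J : Submodule K (Sr K β n)) (F : ZS K β n)
    (h : ∀ z : Mt n K, z.det ≠ 0 → evS z F ∈ J) (μ) : coeff μ F ∈ J := by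
  by_contra hc
  obtain ⟨φ, h1, h2⟩ := Submodule.exists_le_ker_of_notMem hc
  let G : Zr K n := ∑ μ ∈ F.support, monomial μ (φ (coeff μ F))
  have hG : ∀ z : Mt n K, ev z G = φ (evS z F) := by
    intro z
    conv_rhs => rw [evS, aeval_eq_eval₂Hom, coe_eval₂Hom, eval₂_eq]
    rw [map_sum, map_sum]
    refine Finset.sum_congr rfl fun μ _ => ?_
    rw [ev, aeval_monomial, Finsupp.prod]
    have : (∏ i ∈ μ.support, pt (fun _ : Unit => z.map (C (σ := β ⊠ₙ n))) i ^ μ i) = C (∏ i ∈ μ.support, pt (fun _ : Unit => z) i ^ μ i) := by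
      rw [map_prod]; simp [pt]
    rw [this]
    simp only [Algebra.algebraMap_self, RingHom.id_apply]
    rw [mul_comm _ (C _), ← smul_eq_C_mul, map_smul, smul_eq_mul, mul_comm]
  have h0 : pD K () * G = 0 := ev_ext fun z => by
    rw [map_mul, ev_pD, map_zero]
    by_cases hz : z.det = 0
    · rw [hz, zero_mul]
    · rw [hG, h2 (h z hz), mul_zero]
  have hG0 : G = 0 := by
    rcases mul_eq_zero.1 h0 with h | h
    · have := congrArg (ev (1 : Mt n K)) h
      rw [ev_pD] at this; simp at this
    · exact h
  have := congrArg (coeff μ) hG0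
  simp only [G, coeff_sum, coeff_monomial, Finset.sum_ite_eq', coeff_zero] at this
  rw [if_pos] at this
  · exact h1 this
  · rw [mem_support_iff]; intro h; rw [h] at hc; exact hc J.zero_mem
lemma sbs_homog {s : Sr K β n} {d : ℕ} (hs : s.IsHomogeneous d) (c : K) (a b : Mt n K) :
    sbs (K := K) (c • a) b s = c ^ d • sbs (K := K) a b s := by
  have h1 : scl (1 : β ⊠ₙ n → ℕ) c = sbs (K := K) (c • 1 : Mt n K) 1 := by
    apply MvPolynomial.algHom_ext
    rintro ⟨k, i, j⟩
    rw [sbs_X, Matrix.map_one _ (map_zero _) (map_one _), mul_one, smul_one_eq_diagonal, Matrix.diagonal_map (map_zero _), diagonal_mul]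
    simp [scl, gX, mul_comm]
  rw [← map_smul, ← scl_homog hs, h1, sbs_sbs]; simp
lemma gr_mod [IsAlgClosed K] (hn : 0 < n) (J : Ideal (Sr K β n)) (s : Sr K β n) (δ : ℕ) (hs : s.IsHomogeneous (n * δ))
    (hJ : ∀ a : Mt n K, a.det = 1 → sbs (K := K) a 1 s - s ∈ J) (H : Zr K n) (μ) :
    coeff μ (sL s * iZ H) - s * C (coeff μ (pD K () ^ δ * H)) ∈ J := by
  have hinf := IsAlgClosed.instInfinite (K := K)
  have h1 : ∀ μ, coeff μ (sL s - C s * iZ (pD K () ^ δ)) ∈ J := by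
    refine coeffs_mem (J.restrictScalars K) _ fun z hz => ?_
    rw [map_sub, map_mul, evS_sL, evS_iZ, map_pow, ev_pD]
    obtain ⟨c, b1, h1, h2, h3, rfl⟩ := GL_SL hn z hz
    rw [sbs_homog hs, pow_mul, h2]
    have : evS (β := β) (c • b1) (C s) = s := by simp [evS]
    rw [this, mul_comm s, ← smul_eq_C_mul, ← smul_sub]
    exact Submodule.smul_mem (J.restrictScalars K) _ (hJ b1 h3)
  have h2 : coeff μ (sL s * iZ H) - s * C (coeff μ (pD K () ^ δ * H)) = coeff μ ((sL s - C s * iZ (pD K () ^ δ)) * iZ H) := by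
    rw [sub_mul, coeff_sub, mul_assoc, ← map_mul, coeff_C_mul, iZ_coeff]
  rw [h2, coeff_mul]
  exact Ideal.sum_mem _ fun x _ => Ideal.mul_mem_right _ _ (h1 _)
end gr3
section gr4
variable {K : Type} [Field K] {n : ℕ} {β : Type} [IsAlgClosed K] (p : ℕ) [Fact p.Prime] [CharP K p] (e : ℕ)
lemma Lam_right (a : Mt n K) (ha : a.det = 1) (F : ZS K β n) :
    coeff (cst _ (p ^ e - 1)) (rZ a F) = coeff (cst _ (p ^ e - 1)) F := by
  induction F using MvPolynomial.induction_on' with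
  | monomial μ c =>
    have : monomial μ c = C c * iZ (β := β) (monomial μ (1 : K)) := by
      simp [iZ, C_mul_monomial]
    have h2 : rZ a (C c) = C c := (rZ a).commutes c
    rw [this, map_mul, h2, rZ_iZ, coeff_C_mul, coeff_C_mul, iZ_coeff, iZ_coeff, coeff_sbs p e 1 a det_one ha]
  | add f g hf hg => rw [map_add, coeff_add, coeff_add, hf, hg]
noncomputable def phi (Q : ℕ) (s : Sr K β n) : Zr K n →ₗ[K] Sr K β n where
  toFun H := coeff (cst _ Q) (sL s * iZ H)
  map_add' f g := by rw [map_add, mul_add, coeff_add]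
  map_smul' c f := by
    rw [map_smul, mul_smul_comm]
    simp [coeff_smul]
lemma phi_left (s : Sr K β n) (H : Zr K n) (a : Mt n K) (ha : a.det = 1) :
    sbs (K := K) a 1 (phi (p ^ e - 1) s H) = phi (p ^ e - 1) s (sbs (K := K) 1 a⁻¹ H) := by
  have h1 : sbs (K := K) a 1 (phi (p ^ e - 1) s H) = coeff (cst _ (p ^ e - 1)) (mapAlgHom (sbs (β := β) (K := K) a 1) (sL s * iZ H)) := by
    simp only [phi, LinearMap.coe_mk, AddHom.coe_mk, mapAlgHom_apply]
    rw [coeff_map]; rfl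
  have h2 : iZ (β := β) H = rZ a (iZ (sbs (K := K) 1 a⁻¹ H)) := by
    rw [rZ_iZ, sbs_sbs, (inv_det ha).1, one_mul, sbs_one]
  rw [h1, map_mul, map_iZ, map_sL_left, h2, ← map_mul, Lam_right p e a ha]
  rfl
lemma phi_right (s : Sr K β n) (H : Zr K n) (b : Mt n K) (hb : sbs (K := K) 1 b s = s) (Q : ℕ) :
    sbs (K := K) 1 b (phi Q s H) = phi Q s H := by
  have h1 : sbs (K := K) 1 b (phi Q s H) = coeff (cst _ Q) (mapAlgHom (sbs (β := β) (K := K) 1 b) (sL s * iZ H)) := by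
    simp only [phi, LinearMap.coe_mk, AddHom.coe_mk, mapAlgHom_apply]
    rw [coeff_map]; rfl
  rw [h1, map_mul, map_iZ, map_sL_right, hb]
  rfl
theorem GR_left (p : ℕ) [Fact p.Prime] [CharP K p] (hn : 0 < n) (J : Ideal (Sr K β n)) (s : Sr K β n) (δ : ℕ) (hs : s.IsHomogeneous (n * δ))
    (hJ : ∀ a : Mt n K, a.det = 1 → sbs (K := K) a 1 s - s ∈ J) :
    ∃ (N : ℕ) (t : Sr K β n), 0 < N ∧ (∀ a : Mt n K, a.det = 1 → sbs (K := K) a 1 t = t) ∧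
      t - s ^ N ∈ J ∧ ∀ b : Mt n K, sbs (K := K) 1 b s = s → sbs (K := K) 1 b t = t := by
  have hδ : δ ≤ p ^ δ - 1 := by
    have := Nat.lt_pow_self (n := δ) (Fact.out : p.Prime).one_lt; omega
  set Q := p ^ δ - 1 with hQ
  obtain ⟨D, P, hD, hP, hG⟩ := gr_data (K := K) (n := n) p δ hn
  rw [← hQ] at hG
  set G : Matrix (Fin D) (Fin D) K := of fun a c => Bf Q (P a) (P c) with hGd
  have hinf := IsAlgClosed.instInfinite (K := K)
  let H : Zr K n → Zr K n → Zr K n := fun f h => pD K () ^ (Q - δ) * f * sbs (K := K) (w0 K n) 1 h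
  let M : Matrix (Fin D) (Fin D) (Sr K β n) := of fun a c => phi Q s (H (P a) (P c))
  have hq : ∀ a c, M a c - s * C (G a c) ∈ J := by
    intro a c
    have := gr_mod hn J s δ hs hJ (H (P a) (P c)) (cst _ Q)
    have e1 : pD K () ^ δ * H (P a) (P c) = pD K () ^ Q * P a * sbs (K := K) (w0 K n) 1 (P c) := by
      simp only [H]
      rw [← mul_assoc, ← mul_assoc, ← pow_add, Nat.add_sub_cancel' hδ]
    rw [e1] at this
    exact this
  have hHs : ∀ (b : Mt n K), b.det = 1 → ∀ f h, sbs (K := K) 1 b (H f h) = H (sbs (K := K) 1 b f) (sbs (K := K) 1 b h) := by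
    intro b hb f h
    simp only [H]
    rw [map_mul, map_mul, map_pow, sbs_pD, det_one, hb, one_mul, one_smul, sbs_sbs, sbs_sbs]
    simp
  have key : ∀ a : Mt n K, a.det = 1 → sbs (K := K) a 1 M.det = M.det := by
    intro a ha
    obtain ⟨ρ, hρ⟩ := hP a⁻¹ (inv_det ha).2.2
    have hG2 : G = ρ * G * ρᵀ := by
      refine Matrix.ext fun i j => ?_
      have h1 := Bf_inv p δ (P i) (P j) a⁻¹ (inv_det ha).2.2
      rw [← hQ, hρ, hρ] at h1
      rw [hGd, of_apply, ← h1]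
      simp only [Bf, map_sum, map_smul, Finset.mul_sum, Finset.sum_mul, coeff_sum, mul_smul_comm, smul_mul_assoc, coeff_smul, Matrix.mul_apply, transpose_apply, of_apply, smul_eq_mul]
      refine Finset.sum_congr rfl fun x _ => Finset.sum_congr rfl fun y _ => ?_
      ring
    have hdet : ρ.det * ρ.det = 1 := by
      have := congrArg det hG2
      rw [det_mul, det_mul, det_transpose] at this
      exact mul_right_cancel₀ hG (by rw [one_mul]; conv_rhs => rw [this]
                                     ring)
    have hM : M.map (sbs (K := K) a 1) = ρ.map C * M * (ρ.map C)ᵀ := by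
      refine Matrix.ext fun i j => ?_
      simp only [map_apply, M, of_apply]
      rw [hQ, phi_left p δ s _ a ha, ← hQ, hHs _ (inv_det ha).2.2, hρ, hρ]
      simp only [H, map_sum, map_smul, Finset.mul_sum, Finset.sum_mul, mul_smul_comm, smul_mul_assoc, Matrix.mul_apply, transpose_apply, of_apply, map_apply]
      refine Finset.sum_congr rfl fun x _ => ?_
      rw [Finset.smul_sum]
      refine Finset.sum_congr rfl fun y _ => ?_
      simp only [smul_eq_C_mul]
      ring
    have h3 := AlgHom.map_det (sbs (β := β) (K := K) a 1) M
    rw [h3, AlgHom.mapMatrix_apply, hM, det_mul, det_mul, det_transpose]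
    have h4 : (ρ.map (C (σ := β ⊠ₙ n))).det = C ρ.det := (RingHom.map_det C ρ).symm
    rw [h4, mul_right_comm, ← map_mul, hdet, map_one, one_mul]
  refine ⟨D, C G.det⁻¹ * M.det, hD, fun a ha => ?_, ?_, fun b hb => ?_⟩
  · rw [map_mul, key a ha, ← algebraMap_eq, AlgHom.commutes]
  · rw [← Ideal.Quotient.eq, map_mul, map_pow]
    have h5 : (Ideal.Quotient.mk J) M.det = (Ideal.Quotient.mk J s) ^ D * Ideal.Quotient.mk J (C G.det) := by
      have h6 : M.map (Ideal.Quotient.mk J) = Ideal.Quotient.mk J s • (G.map C).map (Ideal.Quotient.mk J) := by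
        refine Matrix.ext fun i j => ?_
        rw [Matrix.smul_apply, map_apply, map_apply, map_apply, smul_eq_mul, ← map_mul]
        exact Ideal.Quotient.eq.2 (hq i j)
      rw [RingHom.map_det, RingHom.mapMatrix_apply, h6, det_smul, Fintype.card_fin, RingHom.map_det, RingHom.map_det]
      rfl
    rw [h5, mul_left_comm, ← map_mul, ← map_mul, inv_mul_cancel₀ hG, map_one, map_one, mul_one]
  · rw [map_mul, ← algebraMap_eq, AlgHom.commutes, AlgHom.map_det]
    congr 2
    refine Matrix.ext fun i j => ?_
    exact phi_right s _ b hb Q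
end gr4
section nag
variable {K : Type} [Field K] {σ : Type}
def Grd (g : MvPolynomial σ K →ₐ[K] MvPolynomial σ K) : Prop := ∀ f d, f.IsHomogeneous d → (g f).IsHomogeneous d
lemma Grd.hc {g : MvPolynomial σ K →ₐ[K] MvPolynomial σ K} (hg : Grd g) (f) (k : ℕ) :
    homogeneousComponent k (g f) = g (homogeneousComponent k f) := by
  conv_lhs => rw [← sum_homogeneousComponent f, map_sum, map_sum]
  have h : ∀ i, homogeneousComponent k (g (homogeneousComponent i f)) = if i = k then g (homogeneousComponent i f) else 0 := by
    intro i
    rw [homogeneousComponent_of_mem (hg _ _ (homogeneousComponent_isHomogeneous i f))]; simp only [eq_comm]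
  simp only [h, Finset.sum_ite_eq', Finset.mem_range]
  split_ifs with h1
  · rfl
  · rw [homogeneousComponent_eq_zero _ _ (by omega), map_zero]
def Hom (J : Ideal (MvPolynomial σ K)) : Prop := ∀ f ∈ J, ∀ k, homogeneousComponent k f ∈ J
end nag
section gr5
variable {K : Type} [Field K] {n : ℕ} {β : Type}
lemma sbs_Grd (a b : Mt n K) : Grd (sbs (β := β) (K := K) a b) := by
  intro f d hf
  have := hf.aeval (S := K) (n := 1) (pt fun k => a.map C * gX β n K k * b.map C) ?_
  · rwa [one_mul] at this
  · rintro ⟨k, i, j⟩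
    simp only [pt, Matrix.mul_apply, gX, of_apply, map_apply]
    refine IsHomogeneous.sum _ _ _ fun x _ => ?_
    refine IsHomogeneous.mul (m := 1) (n := 0) ?_ (isHomogeneous_C _ _)
    refine IsHomogeneous.sum _ _ _ fun y _ => ?_
    exact IsHomogeneous.mul (m := 0) (n := 1) (isHomogeneous_C _ _) (isHomogeneous_X _ _)
noncomputable def trp : Sr K β n →ₐ[K] Sr K β n := rename fun x => (x.1, x.2.2, x.2.1)
lemma trp_trp (f : Sr K β n) : trp (trp f) = f := by
  simp only [trp, rename_rename]; exact rename_id_apply f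
lemma trp_sbs (a b : Mt n K) (f : Sr K β n) : trp (sbs (K := K) a b f) = sbs (K := K) bᵀ aᵀ (trp f) := by
  have : trp.comp (sbs (β := β) (K := K) a b) = (sbs (β := β) (K := K) bᵀ aᵀ).comp trp := by
    apply MvPolynomial.algHom_ext
    rintro ⟨k, i, j⟩
    rw [AlgHom.comp_apply, AlgHom.comp_apply, sbs_X]
    rw [show trp (X (k, i, j) : Sr K β n) = X (k, j, i) by simp [trp], sbs_X]
    simp only [Matrix.mul_apply, gX, of_apply, map_apply, map_sum, map_mul, transpose_apply, Finset.sum_mul]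
    rw [Finset.sum_comm]
    refine Finset.sum_congr rfl fun x _ => Finset.sum_congr rfl fun y _ => ?_
    simp only [trp, rename_C, rename_X]
    ring
  exact DFunLike.congr_fun this f
def GRL (K : Type) [Field K] (n : ℕ) (β : Type) : Prop := ∀ (J : Ideal (Sr K β n)) (s : Sr K β n) (δ : ℕ), s.IsHomogeneous (n * δ) →
    (∀ a : Mt n K, a.det = 1 → sbs (K := K) a 1 s - s ∈ J) →
    ∃ (N : ℕ) (t : Sr K β n), 0 < N ∧ (∀ a : Mt n K, a.det = 1 → sbs (K := K) a 1 t = t) ∧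
      t - s ^ N ∈ J ∧ ∀ b : Mt n K, sbs (K := K) 1 b s = s → sbs (K := K) 1 b t = t
variable [IsAlgClosed K]
theorem GR_right (H : GRL K n β) (hn : 0 < n) (J : Ideal (Sr K β n)) (s : Sr K β n) (δ : ℕ) (hs : s.IsHomogeneous (n * δ))
    (hJ : ∀ a : Mt n K, a.det = 1 → sbs (K := K) 1 a s - s ∈ J) :
    ∃ (N : ℕ) (t : Sr K β n), 0 < N ∧ (∀ a : Mt n K, a.det = 1 → sbs (K := K) 1 a t = t) ∧
      t - s ^ N ∈ J ∧ ∀ b : Mt n K, sbs (K := K) b 1 s = s → sbs (K := K) b 1 t = t := by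
  have hJ' : ∀ a : Mt n K, a.det = 1 → sbs (K := K) a 1 (trp s) - trp s ∈ J.comap (trp (K := K) (β := β)) := by
    intro a ha
    rw [Ideal.mem_comap, map_sub, trp_sbs, trp_trp]
    have := hJ aᵀ (by rwa [det_transpose])
    simpa using this
  obtain ⟨N, t, h1, h2, h3, h4⟩ := H (J.comap trp) (trp s) δ (hs.rename_isHomogeneous) hJ'
  · refine ⟨N, trp t, h1, fun a ha => ?_, ?_, fun b hb => ?_⟩
    · have := congrArg trp (h2 aᵀ (by rwa [det_transpose]))
      rw [trp_sbs] at this; simpa using this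
    · rw [Ideal.mem_comap, map_sub, map_pow, trp_trp] at h3; exact h3
    · have := congrArg trp (h4 bᵀ ?_)
      · rw [trp_sbs] at this; simpa using this
      · have := congrArg trp hb
        rw [trp_sbs] at this; simpa using this
theorem GR (H : GRL K n β) (hn : 0 < n) (J : Ideal (Sr K β n)) (hJh : Hom J)
    (hJs : ∀ a b : Mt n K, a.det = 1 → b.det = 1 → ∀ f ∈ J, sbs (K := K) a b f ∈ J)
    (f : Sr K β n) (d : ℕ) (hf : f.IsHomogeneous d)
    (hJ : ∀ a b : Mt n K, a.det = 1 → b.det = 1 → sbs (K := K) a b f - f ∈ J) :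
    ∃ (N : ℕ) (t : Sr K β n), 0 < N ∧ t.IsHomogeneous (N * d) ∧ GInv t ∧ t - f ^ N ∈ J := by
  have hpow : ∀ (a b : Mt n K) (s : Sr K β n) (k : ℕ), sbs (K := K) a b s - s ∈ J → sbs (K := K) a b (s ^ k) - s ^ k ∈ J := by
    intro a b s k h
    rw [map_pow]
    exact Ideal.mem_of_dvd _ (sub_dvd_pow_sub_pow _ _ k) h
  have hfn : (f ^ n).IsHomogeneous (n * d) := by rw [mul_comm]; exact hf.pow n
  obtain ⟨N1, t1, a1, a2, a3, a4⟩ := H J (f ^ n) d hfn (fun a ha => hpow _ _ _ _ (hJ a 1 ha det_one))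
  set u := homogeneousComponent (n * d * N1) t1 with hu
  have u1 : ∀ a : Mt n K, a.det = 1 → sbs (K := K) a 1 u = u := fun a ha => by
    rw [hu, ← (sbs_Grd a 1).hc, a2 a ha]
  have u2 : u - (f ^ n) ^ N1 ∈ J := by
    have := hJh _ a3 (n * d * N1)
    rw [map_sub, homogeneousComponent_of_mem (hfn.pow N1), if_pos rfl] at this
    exact this
  have u3 : u.IsHomogeneous (n * (d * N1)) := by rw [← mul_assoc]; exact homogeneousComponent_isHomogeneous _ _
  obtain ⟨N2, t2, b1, b2, b3, b4⟩ := GR_right H hn J u (d * N1) u3 (fun b hb => by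
    have h1 := hJs 1 b det_one hb _ u2
    have h2 := hpow 1 b _ N1 (hpow 1 b f n (hJ 1 b det_one hb))
    rw [map_sub] at h1
    have := J.add_mem (J.sub_mem h1 u2) h2
    ring_nf at this ⊢
    exact this)
  refine ⟨n * N1 * N2, homogeneousComponent (n * (d * N1) * N2) t2, by positivity, ?_, fun a b ha hb => ?_, ?_⟩
  · rw [show n * N1 * N2 * d = n * (d * N1) * N2 by ring]; exact homogeneousComponent_isHomogeneous _ _
  · rw [← (sbs_Grd a b).hc, sbs_split, b2 b hb, b4 a (u1 a ha)]
  · have h1 := hJh _ b3 (n * (d * N1) * N2)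
    rw [map_sub, homogeneousComponent_of_mem (u3.pow N2), if_pos rfl] at h1
    have h2 : u ^ N2 - ((f ^ n) ^ N1) ^ N2 ∈ J := Ideal.mem_of_dvd _ (sub_dvd_pow_sub_pow _ _ N2) u2
    have := J.add_mem h1 h2
    rw [← pow_mul, ← pow_mul] at this
    simpa [mul_assoc] using this
end gr5
section nag2
variable {K : Type} [Field K] {σ : Type}
lemma hc_mul {x : MvPolynomial σ K} {a : ℕ} (hx : x.IsHomogeneous a) (c : MvPolynomial σ K) (e : ℕ) :
    homogeneousComponent e (c * x) = if a ≤ e then homogeneousComponent (e - a) c * x else 0 := by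
  conv_lhs => rw [← sum_homogeneousComponent c, Finset.sum_mul, map_sum]
  have h : ∀ i, homogeneousComponent e (homogeneousComponent i c * x) = if e = i + a then homogeneousComponent i c * x else 0 := by
    intro i
    exact homogeneousComponent_of_mem ((homogeneousComponent_isHomogeneous i c).mul hx)
  simp only [h]
  split_ifs with h1
  · rw [Finset.sum_eq_single (e - a)]
    · rw [if_pos (by omega)]
    · intro b _ hb; rw [if_neg (by omega)]
    · intro hb
      rw [homogeneousComponent_eq_zero _ c (by simp at hb; omega)]; simp
  · exact Finset.sum_eq_zero fun i _ => if_neg (by omega)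
lemma hc_adjoin {T : Set (MvPolynomial σ K)} (hT : ∀ t ∈ T, ∃ d, t.IsHomogeneous d) {c : MvPolynomial σ K}
    (hc : c ∈ Algebra.adjoin K T) : ∀ k, homogeneousComponent k c ∈ Algebra.adjoin K T := by
  induction hc using Algebra.adjoin_induction with
  | mem x hx =>
    intro k
    obtain ⟨d, hd⟩ := hT x hx
    rw [homogeneousComponent_of_mem hd]
    split_ifs
    · exact Algebra.subset_adjoin hx
    · exact zero_mem _
  | algebraMap r =>
    intro k
    rw [algebraMap_eq, homogeneousComponent_of_mem (isHomogeneous_C _ r)]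
    split_ifs
    · exact Subalgebra.algebraMap_mem _ r
    · exact zero_mem _
  | add x y _ _ h1 h2 => intro k; rw [map_add]; exact add_mem (h1 k) (h2 k)
  | mul x y _ _ h1 h2 =>
    intro k
    conv => rw [← sum_homogeneousComponent y, Finset.mul_sum, map_sum]
    refine sum_mem fun i _ => ?_
    rw [hc_mul (homogeneousComponent_isHomogeneous i y)]
    split_ifs
    · exact mul_mem (h1 _) (h2 _)
    · exact zero_mem _
lemma hc_span {T U : Set (MvPolynomial σ K)} (hT : ∀ t ∈ T, ∃ d, t.IsHomogeneous d) (hU : ∀ t ∈ U, ∃ d, t.IsHomogeneous d)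
    {w : MvPolynomial σ K} (hw : w ∈ Submodule.span (Algebra.adjoin K T) U) (k : ℕ) :
    homogeneousComponent k w ∈ Submodule.span (Algebra.adjoin K T) U := by
  induction hw using Submodule.closure_induction with
  | zero => rw [map_zero]; exact zero_mem _
  | add x y _ _ h1 h2 => rw [map_add]; exact add_mem h1 h2
  | smul_mem c x hx =>
    obtain ⟨d, hd⟩ := hU x hx
    rw [Subalgebra.smul_def, smul_eq_mul, hc_mul hd]
    split_ifs
    · exact Submodule.smul_mem _ (⟨_, hc_adjoin hT c.2 (k - d)⟩ : Algebra.adjoin K T) (Submodule.subset_span hx)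
    · exact zero_mem _
lemma span_adj {C1 C : Subalgebra K (MvPolynomial σ K)} (hC : C1 ≤ C) {U : Set (MvPolynomial σ K)} (V : Submodule C (MvPolynomial σ K))
    (f : MvPolynomial σ K) (h : ∀ u ∈ U, f * u ∈ V) {w} (hw : w ∈ Submodule.span C1 U) : f * w ∈ V := by
  induction hw using Submodule.span_induction with
  | mem x hx => exact h x hx
  | zero => rw [mul_zero]; exact V.zero_mem
  | add x y _ _ h1 h2 => rw [mul_add]; exact V.add_mem h1 h2
  | smul c x _ h1 =>
    rw [Subalgebra.smul_def, smul_eq_mul, mul_left_comm]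
    exact V.smul_mem (⟨c.1, hC c.2⟩ : C) h1
variable (G : Set (MvPolynomial σ K →ₐ[K] MvPolynomial σ K))
def InvJ (J : Ideal (MvPolynomial σ K)) : Subalgebra K (MvPolynomial σ K) where
  carrier := {s | ∀ g ∈ G, g s - s ∈ J}
  mul_mem' := fun {a b} ha hb g hg => by
    have := J.add_mem (J.mul_mem_left (g a) (hb g hg)) (J.mul_mem_right b (ha g hg))
    rw [map_mul]; ring_nf at this ⊢; exact this
  add_mem' := fun {a b} ha hb g hg => by
    have := J.add_mem (ha g hg) (hb g hg)
    rw [map_add]; ring_nf at this ⊢; exact this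
  algebraMap_mem' := fun r g hg => by rw [AlgHom.commutes, sub_self]; exact J.zero_mem
def Stb (J : Ideal (MvPolynomial σ K)) : Prop := ∀ g ∈ G, ∀ f ∈ J, g f ∈ J
def Clm (J : Ideal (MvPolynomial σ K)) : Prop := ∃ T U : Set (MvPolynomial σ K), T.Finite ∧ U.Finite ∧ (∀ t ∈ T, t ∈ InvJ G ⊥ ∧ ∃ d, t.IsHomogeneous d) ∧
  ∀ x ∈ InvJ G J, ∃ w ∈ Submodule.span (Algebra.adjoin K T) U, x - w ∈ J
variable {G}
lemma InvJ_bot {J : Ideal (MvPolynomial σ K)} {J' : Ideal (MvPolynomial σ K)} (h : J ≤ J') : InvJ G J ≤ InvJ G J' :=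
  fun x hx g hg => h (hx g hg)
lemma noeth {T U : Set (MvPolynomial σ K)} (hT : T.Finite) (hU : U.Finite) (N : Submodule (Algebra.adjoin K T) (MvPolynomial σ K)) 
   (hN : N ≤ Submodule.span (Algebra.adjoin K T) U) : ∃ X : Set (MvPolynomial σ K), X.Finite ∧ Submodule.span (Algebra.adjoin K T) X = N := by
  have h1 : IsNoetherianRing (Algebra.adjoin K T) := isNoetherianRing_of_fg (Subalgebra.fg_def.2 ⟨T, hT, rfl⟩)
  have h2 : IsNoetherian (Algebra.adjoin K T) (Submodule.span (Algebra.adjoin K T) U) := isNoetherian_span_of_finite _ hU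
  have h3 := (isNoetherian_submodule.1 h2) N hN
  obtain ⟨X, h⟩ := h3
  exact ⟨X, X.finite_toSet, h⟩
variable (hG : ∀ g ∈ G, Grd g)
lemma InvJ_hc (hG : ∀ g ∈ G, Grd g) {J : Ideal (MvPolynomial σ K)} (hJ : Hom J) {x} (hx : x ∈ InvJ G J) (k : ℕ) : homogeneousComponent k x ∈ InvJ G J := by
  intro g hg
  rw [← (hG g hg).hc, ← map_sub]; exact hJ _ (hx g hg) k
lemma nag_step {J J1 : Ideal (MvPolynomial σ K)} (h01 : J ≤ J1) {f : MvPolynomial σ K} 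
    (h1 : Clm G J1) : ∃ T X : Set (MvPolynomial σ K), T.Finite ∧ X.Finite ∧ (∀ t ∈ T, t ∈ InvJ G ⊥ ∧ ∃ d, t.IsHomogeneous d) ∧
      (∀ x ∈ X, x ∈ InvJ G J) ∧ ∀ x ∈ InvJ G J, ∃ w ∈ Submodule.span (Algebra.adjoin K T) X, w ∈ InvJ G J ∧ x - w ∈ J1 := by
  obtain ⟨T, U, hT, hU, hTR, h⟩ := h1
  have hTJ : Algebra.adjoin K T ≤ InvJ G J := Algebra.adjoin_le fun t ht => InvJ_bot bot_le (hTR t ht).1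
  let N : Submodule (Algebra.adjoin K T) (MvPolynomial σ K) :=
    { carrier := {m | m ∈ Submodule.span (Algebra.adjoin K T) U ∧ ∃ x ∈ InvJ G J, x - m ∈ J1}
      add_mem' := fun {a b} ⟨ha, x, hx, hxa⟩ ⟨hb, y, hy, hyb⟩ => ⟨add_mem ha hb, x + y, add_mem hx hy, by
        rw [add_sub_add_comm]; exact J1.add_mem hxa hyb⟩
      zero_mem' := ⟨zero_mem _, 0, zero_mem _, by simp⟩
      smul_mem' := fun c a ⟨ha, x, hx, hxa⟩ => ⟨Submodule.smul_mem _ c ha, c * x, mul_mem (hTJ c.2) hx, by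
        rw [Subalgebra.smul_def, smul_eq_mul, ← mul_sub]; exact J1.mul_mem_left _ hxa⟩ }
  obtain ⟨M, hM, hMN⟩ := noeth hT hU N (fun m hm => hm.1)
  have hMl : ∀ m : MvPolynomial σ K, ∃ x, x ∈ InvJ G J ∧ (m ∈ M → x - m ∈ J1) := by
    intro m
    by_cases hm : m ∈ M
    · obtain ⟨x, hx, h⟩ := (show m ∈ N by rw [← hMN]; exact Submodule.subset_span hm).2
      exact ⟨x, hx, fun _ => h⟩
    · exact ⟨0, zero_mem _, fun h => absurd h hm⟩
  choose L hL1 hL2 using hMl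
  refine ⟨T, L '' M, hT, hM.image L, hTR, ?_, ?_⟩
  · rintro _ ⟨m, _, rfl⟩; exact hL1 m
  · intro x hx
    obtain ⟨m, hm, hxm⟩ := h x (InvJ_bot h01 hx)
    have hm' : m ∈ Submodule.span (Algebra.adjoin K T) M := by rw [hMN]; exact ⟨hm, x, hx, hxm⟩
    have key : ∃ w ∈ Submodule.span (Algebra.adjoin K T) (L '' M), w ∈ InvJ G J ∧ m - w ∈ J1 := by
      clear hxm hm
      induction hm' using Submodule.span_induction with
      | mem m hm => exact ⟨L m, Submodule.subset_span ⟨m, hm, rfl⟩, hL1 m, by rw [← neg_sub]; exact J1.neg_mem (hL2 m hm)⟩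
      | zero => exact ⟨0, zero_mem _, zero_mem _, by simp⟩
      | add a b _ _ ha hb =>
        obtain ⟨w, h1, h2, h3⟩ := ha
        obtain ⟨w', h1', h2', h3'⟩ := hb
        exact ⟨w + w', add_mem h1 h1', add_mem h2 h2', by rw [add_sub_add_comm]; exact J1.add_mem h3 h3'⟩
      | smul c a _ ha =>
        obtain ⟨w, h1, h2, h3⟩ := ha
        exact ⟨c • w, Submodule.smul_mem _ c h1, mul_mem (hTJ c.2) h2, by rw [← smul_sub]; exact J1.mul_mem_left _ h3⟩
    obtain ⟨w, h1, h2, h3⟩ := key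
    exact ⟨w, h1, h2, by have := J1.add_mem hxm h3; simpa using this⟩
lemma nag_inter {J : Ideal (MvPolynomial σ K)} (hS : Stb G J) {f : MvPolynomial σ K} (hf : f ∈ InvJ G J) {x : MvPolynomial σ K}
    (hx : x ∈ InvJ G J) (hx1 : x ∈ J ⊔ Ideal.span {f}) (J2 : Ideal (MvPolynomial σ K)) (hJ2 : ∀ y, y ∈ J2 ↔ f * y ∈ J) :
    ∃ y ∈ InvJ G J2, x - f * y ∈ J := by
  obtain ⟨j, hj, z, hz, rfl⟩ := Submodule.mem_sup.1 hx1
  obtain ⟨y, rfl⟩ := Ideal.mem_span_singleton'.1 hz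
  refine ⟨y, fun g hg => ?_, by rw [mul_comm f]; simpa using hj⟩
  rw [hJ2]
  have h1 := hx g hg
  have h2 := J.sub_mem (J.sub_mem (J.add_mem h1 hj) (hS g hg j hj)) (J.mul_mem_left (g y) (hf g hg))
  rw [map_add, map_mul] at h2
  ring_nf at h2 ⊢
  exact h2
theorem nagata [Finite σ] (hG : ∀ g ∈ G, Grd g)
    (hGR : ∀ J : Ideal (MvPolynomial σ K), Hom J → Stb G J → ∀ (f : MvPolynomial σ K) (d : ℕ), f.IsHomogeneous d → f ∈ InvJ G J →
      ∃ (N : ℕ) (t : MvPolynomial σ K), 0 < N ∧ t.IsHomogeneous (N * d) ∧ t ∈ InvJ G ⊥ ∧ t - f ^ N ∈ J)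
    (J : Ideal (MvPolynomial σ K)) (hJ : Hom J) (hS : Stb G J) : Clm G J := by
  induction J using WellFoundedGT.induction with
  | ind J ih =>
  by_cases hA : ∀ (f : MvPolynomial σ K) (d : ℕ), 0 < d → f.IsHomogeneous d → f ∈ InvJ G J → f ∈ J
  · refine ⟨∅, {1}, Set.finite_empty, Set.finite_singleton _, by simp, fun x hx => ?_⟩
    refine ⟨C (coeff 0 x), ?_, ?_⟩
    · have : C (coeff 0 x) = (algebraMap K (Algebra.adjoin K (∅ : Set (MvPolynomial σ K))) (coeff 0 x)) • (1 : MvPolynomial σ K) := by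
        rw [Subalgebra.smul_def]; simp [algebraMap_eq]
      rw [this]
      exact Submodule.smul_mem _ _ (Submodule.subset_span rfl)
    · rw [← homogeneousComponent_zero]
      have h1 := sum_homogeneousComponent x
      rw [Finset.sum_range_succ'] at h1
      rw [← eq_sub_iff_add_eq.2 h1]
      exact J.sum_mem fun i _ => hA _ (i + 1) (by omega) (homogeneousComponent_isHomogeneous _ _) (InvJ_hc hG hJ hx _)
  · push Not at hA
    obtain ⟨f, d, hd, hfd, hf, hfJ⟩ := hA
    have hJ1h : Hom (J ⊔ Ideal.span {f}) := by
      intro x hx k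
      obtain ⟨j, hj, z, hz, rfl⟩ := Submodule.mem_sup.1 hx
      obtain ⟨y, rfl⟩ := Ideal.mem_span_singleton'.1 hz
      rw [map_add, hc_mul hfd]
      refine Ideal.add_mem _ (Ideal.mem_sup_left (hJ j hj k)) ?_
      split_ifs
      · exact Ideal.mem_sup_right (Ideal.mem_span_singleton'.2 ⟨_, rfl⟩)
      · exact zero_mem _
    have hJ1s : Stb G (J ⊔ Ideal.span {f}) := by
      intro g hg x hx
      obtain ⟨j, hj, z, hz, rfl⟩ := Submodule.mem_sup.1 hx
      obtain ⟨y, rfl⟩ := Ideal.mem_span_singleton'.1 hz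
      rw [map_add, map_mul]
      refine Ideal.add_mem _ (Ideal.mem_sup_left (hS g hg j hj)) (Ideal.mul_mem_left _ _ ?_)
      have := Ideal.add_mem _ (Ideal.mem_sup_left (hf g hg)) (Ideal.mem_sup_right (S := J) (Ideal.mem_span_singleton_self f))
      simpa using this
    have hJ1 : J < J ⊔ Ideal.span {f} := lt_of_le_of_ne le_sup_left fun h =>
      hfJ (by rw [h]; exact Ideal.mem_sup_right (Ideal.mem_span_singleton_self f))
    obtain ⟨T1, X, hT1, hX, hT1R, hXJ, h1⟩ := nag_step hJ1.le (f := f) (ih _ hJ1 hJ1h hJ1s)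
    let J2 : Ideal (MvPolynomial σ K) := Submodule.comap (LinearMap.mulLeft (MvPolynomial σ K) f) J
    have hJ2 : ∀ y, y ∈ J2 ↔ f * y ∈ J := fun y => Iff.rfl
    have h2 : ∀ x ∈ InvJ G J, ∃ w ∈ Submodule.span (Algebra.adjoin K T1) X, ∃ y ∈ InvJ G J2, x - w - f * y ∈ J := by
      intro x hx
      obtain ⟨w, hw, hwJ, hxw⟩ := h1 x hx
      obtain ⟨y, hy, h⟩ := nag_inter hS hf (sub_mem hx hwJ) hxw J2 hJ2
      exact ⟨w, hw, y, hy, h⟩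
    have hJJ2 : J ≤ J2 := fun y hy => J.mul_mem_left f hy
    rcases hJJ2.lt_or_eq with hlt | heq
    · have hJ2h : Hom J2 := by
        intro y hy k
        have := hJ _ ((hJ2 y).1 hy) (k + d)
        rw [mul_comm, hc_mul hfd, if_pos (by omega), Nat.add_sub_cancel, mul_comm] at this
        exact this
      have hJ2s : Stb G J2 := by
        intro g hg y hy
        rw [hJ2]
        have := J.sub_mem (hS g hg _ hy) (J.mul_mem_right (g y) (hf g hg))
        simp only [LinearMap.mulLeft_apply, map_mul] at this
        ring_nf at this ⊢
        exact this
      obtain ⟨T2, U2, hT2, hU2, hT2R, h3⟩ := ih J2 hlt hJ2h hJ2s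
      refine ⟨T1 ∪ T2, X ∪ (f * ·) '' U2, hT1.union hT2, hX.union (hU2.image _), ?_, fun x hx => ?_⟩
      · rintro t (ht | ht)
        · exact hT1R t ht
        · exact hT2R t ht
      · obtain ⟨w, hw, y, hy, hxy⟩ := h2 x hx
        obtain ⟨w2, hw2, hyw⟩ := h3 y hy
        refine ⟨1 * w + f * w2, add_mem ?_ ?_, ?_⟩
        · exact span_adj (Algebra.adjoin_mono Set.subset_union_left) _ 1 (fun u hu => by rw [one_mul]; exact Submodule.subset_span (Or.inl hu)) hw
        · exact span_adj (Algebra.adjoin_mono Set.subset_union_right) _ f (fun u hu => Submodule.subset_span (Or.inr ⟨u, hu, rfl⟩)) hw2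
        · have := J.add_mem hxy ((hJ2 _).1 hyw)
          ring_nf at this ⊢
          exact this
    · rw [← heq] at h2
      obtain ⟨N, t, hN, htd, htR, htf⟩ := hGR J hJ hS f d hfd hf
      let X' : Set (MvPolynomial σ K) := ⋃ x ∈ X, (fun k => homogeneousComponent k x) '' (Set.Iio (x.totalDegree + 1))
      have hX'f : X'.Finite := hX.biUnion fun x _ => (Set.finite_Iio _).image _
      have hX'h : ∀ x ∈ X', ∃ d, x.IsHomogeneous d := by
        intro x hx
        simp only [X', Set.mem_iUnion] at hx
        obtain ⟨y, _, k, _, rfl⟩ := hx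
        exact ⟨k, homogeneousComponent_isHomogeneous _ _⟩
      have hXX' : ∀ x ∈ X, x ∈ Submodule.span (Algebra.adjoin K T1) X' := by
        intro x hx
        conv => rw [← sum_homogeneousComponent x]
        refine sum_mem fun i hi => Submodule.subset_span ?_
        simp only [X', Set.mem_iUnion]
        exact ⟨x, hx, i, by simpa using hi, rfl⟩
      let U : Set (MvPolynomial σ K) := ⋃ i ∈ Set.Iio N, (f ^ i * ·) '' X'
      let T : Set (MvPolynomial σ K) := T1 ∪ {t}
      let V : Submodule (Algebra.adjoin K T) (MvPolynomial σ K) := Submodule.span (Algebra.adjoin K T) U ⊔ J.restrictScalars (Algebra.adjoin K T)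
      have hJV : ∀ j ∈ J, j ∈ V := fun j hj => Submodule.mem_sup_right hj
      have ht : t ∈ Algebra.adjoin K T := Algebra.subset_adjoin (Or.inr rfl)
      have hV1 : ∀ i, ∀ x ∈ X', f ^ i * x ∈ V := by
        intro i x hx
        have e1 : f ^ i * x = t ^ (i / N) * (f ^ (i % N) * x) - (t ^ (i / N) - (f ^ N) ^ (i / N)) * (f ^ (i % N) * x) := by
          rw [sub_mul, sub_sub_cancel, ← pow_mul, ← mul_assoc, ← pow_add, Nat.div_add_mod]
        rw [e1]
        refine V.sub_mem ?_ (hJV _ (J.mul_mem_right _ (Ideal.mem_of_dvd _ (sub_dvd_pow_sub_pow _ _ _) htf)))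
        refine V.smul_mem (⟨t ^ (i / N), pow_mem ht _⟩ : Algebra.adjoin K T) (Submodule.mem_sup_left (Submodule.subset_span ?_))
        simp only [U, Set.mem_iUnion]
        exact ⟨i % N, Nat.mod_lt _ hN, x, hx, rfl⟩
      have hV2 : ∀ i, ∀ w ∈ Submodule.span (Algebra.adjoin K T1) X', f ^ i * w ∈ V := fun i w hw =>
        span_adj (Algebra.adjoin_mono Set.subset_union_left) V _ (hV1 i) hw
      have hV3 : ∀ e, ∀ x ∈ InvJ G J, x.IsHomogeneous e → ∀ i, f ^ i * x ∈ V := by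
        intro e
        induction e using Nat.strong_induction_on with
        | _ e ihe =>
        intro x hx hxe i
        obtain ⟨w, hw, y, hy, hxy⟩ := h2 x hx
        have hw' : w ∈ Submodule.span (Algebra.adjoin K T1) X' := by
          have := span_adj le_rfl (Submodule.span (Algebra.adjoin K T1) X') 1 (fun u hu => by rw [one_mul]; exact hXX' u hu) hw
          rwa [one_mul] at this
        have h4 := hJ _ hxy e
        rw [map_sub, map_sub, homogeneousComponent_of_mem hxe, if_pos rfl, mul_comm f, hc_mul hfd] at h4
        have h5 := hV2 i _ (hc_span (fun t ht => (hT1R t ht).2) hX'h hw' e)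
        have h6 := hJV _ (J.mul_mem_left (f ^ i) h4)
        split_ifs at h6 with hde
        · have h7 := ihe (e - d) (by omega) _ (InvJ_hc hG hJ hy (e - d)) (homogeneousComponent_isHomogeneous _ _) (i + 1)
          have := V.add_mem (V.add_mem h5 h6) h7
          ring_nf at this ⊢
          exact this
        · have := V.add_mem h5 h6
          ring_nf at this ⊢
          exact this
      refine ⟨T, U, hT1.union (Set.finite_singleton _), (Set.finite_Iio N).biUnion fun i _ => hX'f.image _, ?_, fun x hx => ?_⟩
      · rintro s (hs | rfl)
        · exact hT1R s hs
        · exact ⟨htR, _, htd⟩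
      · have hxV : x ∈ V := by
          rw [← sum_homogeneousComponent x]
          refine sum_mem fun k _ => ?_
          have := hV3 k _ (InvJ_hc hG hJ hx k) (homogeneousComponent_isHomogeneous _ _) 0
          simpa using this
        obtain ⟨w, hw, j, hj, rfl⟩ := Submodule.mem_sup.1 hxV
        exact ⟨w, hw, by simpa using hj⟩
theorem nagata_fg [Finite σ] (hG : ∀ g ∈ G, Grd g)
    (hGR : ∀ J : Ideal (MvPolynomial σ K), Hom J → Stb G J → ∀ (f : MvPolynomial σ K) (d : ℕ), f.IsHomogeneous d → f ∈ InvJ G J →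
      ∃ (N : ℕ) (t : MvPolynomial σ K), 0 < N ∧ t.IsHomogeneous (N * d) ∧ t ∈ InvJ G ⊥ ∧ t - f ^ N ∈ J) :
    (InvJ G (⊥ : Ideal (MvPolynomial σ K))).FG := by
  obtain ⟨T, U, hT, hU, hTR, h⟩ := nagata hG hGR ⊥ (by intro f hf k; rw [Ideal.mem_bot] at hf ⊢; rw [hf, map_zero])
    (by intro g _ f hf; rw [Ideal.mem_bot] at hf ⊢; rw [hf, map_zero])
  have hTJ : Algebra.adjoin K T ≤ InvJ G ⊥ := Algebra.adjoin_le fun t ht => (hTR t ht).1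
  let N : Submodule (Algebra.adjoin K T) (MvPolynomial σ K) :=
    { carrier := InvJ G ⊥
      add_mem' := add_mem
      zero_mem' := zero_mem _
      smul_mem' := fun c x hx => mul_mem (hTJ c.2) hx }
  obtain ⟨X, hX, hXN⟩ := noeth hT hU N (fun x hx => by
    obtain ⟨w, hw, hxw⟩ := h x hx
    rw [Ideal.mem_bot, sub_eq_zero] at hxw
    rwa [hxw])
  refine Subalgebra.fg_def.2 ⟨T ∪ X, hT.union hX, le_antisymm (Algebra.adjoin_le ?_) ?_⟩
  · rintro x (hx | hx)
    · exact (hTR x hx).1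
    · exact (show x ∈ N by rw [← hXN]; exact Submodule.subset_span hx)
  · intro x hx
    have : x ∈ Submodule.span (Algebra.adjoin K T) X := by rw [hXN]; exact hx
    induction this using Submodule.span_induction with
    | mem x hx' => exact Algebra.subset_adjoin (Or.inr hx')
    | zero => exact zero_mem _
    | add a b ha' hb' ha hb => exact add_mem (ha (by rw [hXN] at ha'; exact ha')) (hb (by rw [hXN] at hb'; exact hb'))
    | smul c a ha' ha => exact mul_mem (Algebra.adjoin_mono Set.subset_union_left c.2) (ha (by rw [hXN] at ha'; exact ha'))
end nag2
theorem FT {K : Type} [Field K] [IsAlgClosed K] {n m : ℕ} (H : GRL K n (Fin m)) (hn : 0 < n) :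
    Algebra.FiniteType K ↥(matrixSemiInvariants K n m) := by
  have hinf := IsAlgClosed.instInfinite (K := K)
  rw [← Subalgebra.fg_iff_finiteType]
  let G : Set (Sr K (Fin m) n →ₐ[K] Sr K (Fin m) n) := {g | ∃ a b : Mt n K, a.det = 1 ∧ b.det = 1 ∧ g = sbs (K := K) a b}
  have e : matrixSemiInvariants K n m = InvJ G ⊥ := by
    ext f
    rw [mem_R]
    constructor
    · rintro h _ ⟨a, b, ha, hb, rfl⟩
      rw [h a b ha hb, sub_self]; exact zero_mem _
    · intro h a b ha hb
      have := h _ ⟨a, b, ha, hb, rfl⟩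
      rwa [Ideal.mem_bot, sub_eq_zero] at this
  rw [e]
  refine nagata_fg ?_ ?_
  · rintro _ ⟨a, b, ha, hb, rfl⟩
    exact sbs_Grd a b
  · intro J hJ hS f d hfd hf
    obtain ⟨N, t, h1, h2, h3, h4⟩ := GR H hn J hJ (fun a b ha hb f hf => hS _ ⟨a, b, ha, hb, rfl⟩ f hf) f d hfd
      (fun a b ha hb => hf _ ⟨a, b, ha, hb, rfl⟩)
    refine ⟨N, t, h1, h2, ?_, h4⟩
    rintro _ ⟨a, b, ha, hb, rfl⟩
    rw [h3 a b ha hb, sub_self]; exact zero_mem _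
section rey
variable {σ R : Type} [CommRing R]
noncomputable def lam (w : (σ →₀ ℕ) → R) : MvPolynomial σ R →ₗ[R] R := (basisMonomials σ R).constr R w
lemma lam_mon (w : (σ →₀ ℕ) → R) (μ c) : lam w (monomial μ c) = c * w μ := by
  have : monomial μ c = c • basisMonomials σ R μ := by simp [smul_monomial]
  rw [this, map_smul, lam, Module.Basis.constr_basis, smul_eq_mul]
lemma lam_eq (w : (σ →₀ ℕ) → R) (f : MvPolynomial σ R) : lam w f = ∑ μ ∈ f.support, coeff μ f * w μ := by
  conv_lhs => rw [f.as_sum, map_sum]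
  simp only [lam_mon]
def fac [Fintype σ] (μ : σ →₀ ℕ) : ℕ := ∏ v, (μ v).factorial
lemma fac_pos [Fintype σ] (μ : σ →₀ ℕ) : 0 < fac μ := Finset.prod_pos fun v _ => Nat.factorial_pos _
lemma fac_succ [Fintype σ] [DecidableEq σ] (μ : σ →₀ ℕ) (v) : fac (μ + Finsupp.single v 1) = (μ v + 1) * fac μ := by
  rw [fac, fac, ← Finset.mul_prod_erase _ _ (Finset.mem_univ v), ← Finset.mul_prod_erase (Finset.univ) (fun x => (μ x).factorial) (Finset.mem_univ v), ← mul_assoc]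
  congr 1
  · simp [Nat.factorial_succ]
  · refine Finset.prod_congr rfl fun x hx => ?_
    rw [Finset.mem_erase] at hx
    simp [Finsupp.single_apply, hx.1.symm]
noncomputable def pr [Fintype σ] (g : MvPolynomial σ R) : MvPolynomial σ R →ₗ[R] R := lam fun μ => fac μ * coeff μ g
lemma pr_X [Fintype σ] [DecidableEq σ] (f g : MvPolynomial σ R) (v) : pr g (f * X v) = pr (pderiv v g) f := by
  induction f using MvPolynomial.induction_on' with
  | monomial μ c =>
    rw [← pow_one (X v), ← monomial_add_single, pr, pr, lam_mon, lam_mon, coeff_pderiv, fac_succ]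
    push_cast; ring
  | add f g hf hg => rw [add_mul, map_add, map_add, hf, hg]
lemma pr_C [Fintype σ] (f g : MvPolynomial σ R) (c : R) : pr (C c * g) f = c * pr g f := by
  simp only [pr, lam_eq, coeff_C_mul, Finset.mul_sum]
  exact Finset.sum_congr rfl fun x _ => by ring
lemma pr_sum [Fintype σ] {ι : Type} (s : Finset ι) (f) (g : ι → MvPolynomial σ R) : pr (∑ i ∈ s, g i) f = ∑ i ∈ s, pr (g i) f := by
  simp only [pr, lam_eq, coeff_sum, Finset.mul_sum]
  rw [Finset.sum_comm]
variable {K : Type} [Field K] {n : ℕ}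
lemma sbs1_X (a : Mt n K) (i j) : sbs (K := K) 1 a (X ((), i, j) : Zr K n) = ∑ l, C (a l j) * X ((), i, l) := by
  rw [sbs_X, Matrix.map_one _ (map_zero _) (map_one _), one_mul, Matrix.mul_apply]
  simp [gX, mul_comm]
lemma pder_sbs (a : Mt n K) (g : Zr K n) (i j) :
    pderiv ((), i, j) (sbs (K := K) 1 aᵀ g) = ∑ l, C (a l j) * sbs (K := K) 1 aᵀ (pderiv ((), i, l) g) := by
  induction g using MvPolynomial.induction_on with
  | C c =>
    have : sbs (K := K) 1 aᵀ (C c : Zr K n) = C c := (sbs (K := K) 1 aᵀ).commutes c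
    simp [this]
  | add f g hf hg => simp only [map_add, hf, hg, mul_add, Finset.sum_add_distrib]
  | mul_X f v h =>
    obtain ⟨⟨⟩, i', j'⟩ := v
    have hx : pderiv ((), i, j) (sbs (K := K) 1 aᵀ (X ((), i', j') : Zr K n)) =
        ∑ l, C (a l j) * sbs (K := K) 1 aᵀ (pderiv ((), i, l) (X ((), i', j'))) := by
      have e : ∀ l, sbs (K := K) 1 aᵀ (pderiv ((), i, l) (X ((), i', j') : Zr K n)) = if i' = i ∧ j' = l then 1 else 0 := by
        intro l
        rw [pderiv_X, Pi.single_apply, apply_ite (sbs (K := K) 1 aᵀ), map_one, map_zero]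
        simp only [Prod.mk.injEq, true_and]
      have e2 : ∀ l, pderiv ((), i, j) (C (aᵀ l j') * X ((), i', l) : Zr K n) = if i' = i ∧ l = j then C (a j' l) else 0 := by
        intro l
        rw [pderiv_C_mul, pderiv_X, Pi.single_apply, mul_ite, mul_one, mul_zero, transpose_apply]
        simp only [Prod.mk.injEq, true_and]
      rw [sbs1_X, map_sum, Finset.sum_congr rfl fun l _ => e2 l]
      simp only [e]
      by_cases hi : i' = i
      · simp [hi]
      · simp [hi]
    rw [map_mul, pderiv_mul, h, hx, Finset.sum_mul, Finset.mul_sum, ← Finset.sum_add_distrib]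
    refine Finset.sum_congr rfl fun l _ => ?_
    rw [pderiv_mul, map_add, map_mul, map_mul]
    ring
lemma pr_adj (a : Mt n K) (f g : Zr K n) : pr g (sbs (K := K) 1 a f) = pr (sbs (K := K) 1 aᵀ g) f := by
  induction f using MvPolynomial.induction_on generalizing g with
  | C c =>
    have : sbs (K := K) 1 a (C c : Zr K n) = C c := (sbs (K := K) 1 a).commutes c
    rw [this, ← monomial_zero', pr, pr, lam_mon, lam_mon]
    congr 2
    rw [← constantCoeff_eq]
    induction g using MvPolynomial.induction_on with
    | C c =>
      have : sbs (K := K) 1 aᵀ (C c : Zr K n) = C c := (sbs (K := K) 1 aᵀ).commutes c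
      rw [this]
    | add f g hf hg => simp only [map_add, hf, hg]
    | mul_X f v h =>
      obtain ⟨⟨⟩, i', j'⟩ := v
      simp [sbs1_X]
  | add f1 f2 h1 h2 => simp only [map_add, h1, h2]
  | mul_X f v h =>
    obtain ⟨⟨⟩, i', j'⟩ := v
    rw [map_mul, sbs1_X, pr_X, pder_sbs, pr_sum, Finset.mul_sum, map_sum]
    refine Finset.sum_congr rfl fun l _ => ?_
    rw [pr_C, ← h, mul_left_comm, ← smul_eq_C_mul, map_smul, pr_X, smul_eq_mul]
    
lemma pD_homog : (pD K () : Zr K n).IsHomogeneous n := by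
  rw [pD, vdet, det_apply]
  refine IsHomogeneous.sum _ _ _ fun τ _ => ?_
  rw [Units.smul_def, zsmul_eq_mul]
  have e : 0 + ∑ i : Fin n, 1 = n := by simp
  have := IsHomogeneous.mul (m := 0) (φ := ((Equiv.Perm.sign τ : ℤ) : Zr K n)) ?_ (IsHomogeneous.prod Finset.univ (fun i : Fin n => (X ((), τ i, i) : Zr K n)) (fun _ => 1) fun i _ => ?_)
  · rw [e] at this; exact this
  · rw [← map_intCast (C (σ := Unit ⊠ₙ n) (R := K))]; exact isHomogeneous_C _ _
  · exact isHomogeneous_X _ _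
lemma pD_map [CharZero K] : (pD K () : Zr K n) = map (algebraMap ℚ K) (pD ℚ ()) := by
  rw [pD, pD, vdet, vdet, RingHom.map_det]
  congr 1
  refine Matrix.ext fun i j => ?_
  simp
noncomputable def Nn (K : Type) [Field K] (n δ : ℕ) : K := pr (pD K () ^ δ : Zr K n) (pD K () ^ δ)
lemma Nn_ne [CharZero K] (δ) : Nn K n δ ≠ 0 := by
  have h1 : Nn K n δ = algebraMap ℚ K (Nn ℚ n δ) := by
    rw [Nn, Nn, pr, pr, lam_eq, lam_eq, map_sum]
    rw [pD_map, ← (MvPolynomial.map (algebraMap ℚ K)).map_pow, support_map_of_injective _ (algebraMap ℚ K).injective]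
    simp only [coeff_map, map_mul, map_natCast]
  have h2 : 0 < Nn ℚ n δ := by
    rw [Nn, pr, lam_eq]
    refine Finset.sum_pos (fun μ hμ => ?_) ?_
    · have := fac_pos μ
      have h3 := mem_support_iff.1 hμ
      rw [mul_left_comm]
      exact mul_pos (by exact_mod_cast this) (mul_self_pos.2 h3)
    · rw [Finset.nonempty_iff_ne_empty, Ne, support_eq_empty]
      intro h
      have := congrArg (ev (1 : Mt n ℚ)) h
      rw [map_pow, ev_pD] at this; simp at this
  rw [h1, Ne, map_eq_zero_iff _ (algebraMap ℚ K).injective]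
  exact h2.ne'
end rey
section rey2
variable {K : Type} [Field K] {n : ℕ}
noncomputable def rw0 (K : Type) [Field K] (n : ℕ) (μ : Unit ⊠ₙ n →₀ ℕ) : K :=
  fac μ * coeff μ (pD K () ^ (μ.degree / n)) / Nn K n (μ.degree / n)
lemma hdg {f : Zr K n} {d : ℕ} (hf : f.IsHomogeneous d) {μ} (hμ : μ ∈ f.support) : μ.degree = d := by
  by_contra h; exact mem_support_iff.1 hμ (hf.coeff_eq_zero h)
lemma rw0_homog {f : Zr K n} {d : ℕ} (hf : f.IsHomogeneous d) : lam (rw0 K n) f = pr (pD K () ^ (d / n)) f / Nn K n (d / n) := by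
  rw [pr, lam_eq, lam_eq, Finset.sum_div]
  refine Finset.sum_congr rfl fun μ hμ => ?_
  have h := hdg hf hμ
  rw [rw0, mul_div_assoc, h]; ring
lemma lam_ind {V : Type} [AddCommGroup V] [Module K V] (A B : Zr K n →ₗ[K] V) (h : ∀ d f, f.IsHomogeneous d → A f = B f) (f) : A f = B f := by
  rw [← sum_homogeneousComponent f, map_sum, map_sum]
  exact Finset.sum_congr rfl fun i _ => h i _ (homogeneousComponent_isHomogeneous _ _)
lemma pDpow (δ) : (pD K () ^ δ : Zr K n).IsHomogeneous (n * δ) := pD_homog.pow δ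
lemma rw0_inv [Infinite K] (a : Mt n K) (ha : a.det = 1) (f : Zr K n) : lam (rw0 K n) (sbs (K := K) 1 a f) = lam (rw0 K n) f := by
  let L : Zr K n →ₗ[K] K := lam (rw0 K n) ∘ₗ (sbs (K := K) 1 a : Zr K n →ₐ[K] Zr K n).toLinearMap
  have hL : ∀ f, L f = lam (rw0 K n) (sbs (K := K) 1 a f) := fun f => rfl
  rw [← hL]
  refine lam_ind L (lam (rw0 K n)) (fun d f hf => ?_) f
  rw [hL, rw0_homog (sbs_Grd 1 a f d hf), rw0_homog hf, pr_adj, map_pow, sbs_pD, det_transpose, ha, det_one, one_mul, one_smul]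
lemma rw0_zero {f : Zr K n} {d : ℕ} (hf : f.IsHomogeneous d) (hd : ¬ n ∣ d) : lam (rw0 K n) f = 0 := by
  rw [rw0_homog hf, pr, lam_eq, Finset.sum_eq_zero, zero_div]
  intro μ hμ
  have h := hdg hf hμ
  rw [(pDpow _).coeff_eq_zero, mul_zero, mul_zero]
  rw [h]; rintro h2; exact hd ⟨_, h2⟩
lemma rw0_pD [CharZero K] (hn : 0 < n) (δ) : lam (rw0 K n) (pD K () ^ δ) = 1 := by
  rw [rw0_homog (pDpow δ), Nat.mul_div_cancel_left _ hn]
  exact div_self (Nn_ne δ)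
lemma uniq_pD [IsAlgClosed K] (hn : 0 < n) {g : Zr K n} {δ : ℕ} (hg : g.IsHomogeneous (n * δ))
    (h : ∀ b : Mt n K, b.det = 1 → sbs (K := K) 1 b g = g) : g = C (ev 1 g) * pD K () ^ δ := by
  have hinf := IsAlgClosed.instInfinite (K := K)
  have h0 : pD K () * (g - C (ev 1 g) * pD K () ^ δ) = 0 := ev_ext fun z => by
    have e : ev z (C (ev 1 g)) = ev 1 g := (ev z).commutes _
    rw [map_mul, map_sub, map_mul, map_pow, ev_pD, map_zero, e]
    by_cases hz : z.det = 0
    · rw [hz, zero_mul]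
    · obtain ⟨c, b1, h1, h2, h3, rfl⟩ := GL_SL hn z hz
      have h4 := ev_sbs (c • 1) b1 1 g
      rw [sbs_homog hg, h b1 h3, map_smul, pow_mul, h2] at h4
      simp only [smul_mul, one_mul] at h4
      rw [← h4, smul_eq_mul]; ring
  rcases mul_eq_zero.1 h0 with h | h
  · have := congrArg (ev (1 : Mt n K)) h
    rw [ev_pD] at this; simp at this
  · exact sub_eq_zero.1 h
lemma rw0_mul [IsAlgClosed K] [CharZero K] (hn : 0 < n) (f : Zr K n) : lam (rw0 K n) (pD K () * f) = lam (rw0 K n) f := by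
  have hinf := IsAlgClosed.instInfinite (K := K)
  let L := lam (rw0 K n) ∘ₗ LinearMap.mulLeft K (pD K ())
  have hL : ∀ f, L f = lam (rw0 K n) (pD K () * f) := fun f => rfl
  refine lam_ind L (lam (rw0 K n)) (fun d f hf => ?_) f
  rw [hL]
  by_cases hd : n ∣ d
  swap
  · rw [rw0_zero hf hd, rw0_zero (pD_homog.mul hf) (by rwa [Nat.dvd_add_right (dvd_refl n)])]
  obtain ⟨δ, rfl⟩ := hd
  have hLi : ∀ (b : Mt n K), b.det = 1 → ∀ f, L (sbs (K := K) 1 b f) = L f := by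
    intro b hb f
    rw [hL, hL, ← rw0_inv b hb (pD K () * f), map_mul (sbs (K := K) 1 b), sbs_pD, hb, det_one, one_mul, one_smul]
  let S := (Finsupp.finite_of_degree_eq (σ := Unit ⊠ₙ n) (n * δ)).toFinset
  have hS : ∀ μ, μ ∈ S ↔ μ.degree = n * δ := fun μ => by simp [S]
  let g : Zr K n := ∑ μ ∈ S, monomial μ (L (monomial μ 1) / fac μ)
  have hgh : g.IsHomogeneous (n * δ) := by
    refine IsHomogeneous.sum _ _ _ fun μ hμ => isHomogeneous_monomial _ ?_
    exact (hS μ).1 hμ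
  have hf0 : ∀ μ : Unit ⊠ₙ n →₀ ℕ, (fac μ : K) ≠ 0 := fun μ => by exact_mod_cast (fac_pos μ).ne'
  have hg : ∀ f : Zr K n, f.IsHomogeneous (n * δ) → pr g f = L f := by
    intro f hf
    conv_rhs => rw [f.as_sum, map_sum]
    rw [pr, lam_eq]
    refine Finset.sum_congr rfl fun μ hμ => ?_
    have h := hdg hf hμ
    have e : monomial μ (coeff μ f) = coeff μ f • monomial μ (1 : K) := by simp [smul_monomial]
    rw [e, map_smul, smul_eq_mul, coeff_sum, Finset.sum_eq_single μ]
    · rw [coeff_monomial, if_pos rfl, mul_div_cancel₀ _ (hf0 μ)]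
    · intro ν _ hν; rw [coeff_monomial, if_neg hν]
    · intro h2; exact absurd ((hS μ).2 h) h2
  have hgi : ∀ b : Mt n K, b.det = 1 → sbs (K := K) 1 b g = g := by
    intro b hb
    ext μ
    by_cases hμ : μ.degree = n * δ
    · have hm : (monomial μ (1 : K)).IsHomogeneous (n * δ) := isHomogeneous_monomial _ hμ
      have h1 := pr_adj bᵀ (monomial μ (1 : K)) g
      rw [hg _ (sbs_Grd _ _ _ _ hm), hLi _ (by rwa [det_transpose]), ← hg _ hm, transpose_transpose, pr, pr, lam_mon, lam_mon, one_mul, one_mul] at h1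
      exact (mul_left_cancel₀ (hf0 μ) h1).symm
    · rw [(sbs_Grd 1 b g _ hgh).coeff_eq_zero hμ, hgh.coeff_eq_zero hμ]
  have hgp := uniq_pD hn hgh hgi
  have key : ∀ f : Zr K n, f.IsHomogeneous (n * δ) → L f = ev 1 g * (Nn K n δ * lam (rw0 K n) f) := by
    intro f hf
    rw [← hg f hf, rw0_homog hf, Nat.mul_div_cancel_left _ hn, mul_div_cancel₀ _ (Nn_ne δ)]
    conv_lhs => rw [hgp, pr_C]
  have h1 := key _ (pDpow δ)
  rw [hL, ← pow_succ', rw0_pD hn, rw0_pD hn, mul_one] at h1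
  rw [← hL, key f hf, ← mul_assoc, ← h1, one_mul]
end rey2
section rey3
variable {K : Type} [Field K] {n : ℕ} {β : Type}
noncomputable def LS : ZS K β n →ₗ[Sr K β n] Sr K β n := lam fun μ => C (rw0 K n μ)
lemma LS_iZ (c : Sr K β n) (f : Zr K n) : LS (C c * iZ f) = c * C (lam (rw0 K n) f) := by
  rw [← smul_eq_C_mul, map_smul, smul_eq_mul]
  congr 1
  induction f using MvPolynomial.induction_on' with
  | monomial μ k =>
    have : iZ (β := β) (monomial μ k) = monomial μ (C k) := by simp [iZ]
    rw [this, LS, lam_mon, lam_mon, map_mul]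
  | add f g hf hg => simp only [map_add, hf, hg]
lemma ZS_ind {P : ZS K β n → Prop} (h1 : ∀ c f, P (C c * iZ f)) (h2 : ∀ f g, P f → P g → P (f + g)) (F) : P F := by
  induction F using MvPolynomial.induction_on' with
  | monomial μ c =>
    have : monomial μ c = C c * iZ (β := β) (monomial μ (1 : K)) := by simp [iZ, C_mul_monomial]
    rw [this]; exact h1 _ _
  | add f g hf hg => exact h2 _ _ hf hg
lemma LS_rZ [Infinite K] (a : Mt n K) (ha : a.det = 1) (F : ZS K β n) : LS (rZ a F) = LS F := by
  induction F using ZS_ind with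
  | h1 c f =>
    have h2 : rZ a (C c) = C c := (rZ a).commutes c
    rw [map_mul, h2, rZ_iZ, LS_iZ, LS_iZ, rw0_inv a ha]
  | h2 f g hf hg => rw [map_add, map_add, map_add, hf, hg]
lemma LS_map (g : Sr K β n →ₐ[K] Sr K β n) (F : ZS K β n) : LS (mapAlgHom (σ := Unit ⊠ₙ n) g F) = g (LS F) := by
  induction F using ZS_ind with
  | h1 c f =>
    have h2 : mapAlgHom (σ := Unit ⊠ₙ n) g (C c : ZS K β n) = C (g c) := by simp
    have h3 : ∀ k, g (C k) = C k := fun k => g.commutes k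
    rw [map_mul, map_iZ, h2, LS_iZ, LS_iZ, map_mul, h3]
  | h2 f g hf hg => rw [map_add, map_add, map_add, map_add, hf, hg]
noncomputable def EL (s : Sr K β n) : Sr K β n := LS (sL s)
lemma EL_left [Infinite K] (s : Sr K β n) (a : Mt n K) (ha : a.det = 1) : sbs (K := K) a 1 (EL s) = EL s := by
  rw [EL, ← LS_map, map_sL_left, LS_rZ a ha]
lemma EL_right (s : Sr K β n) (b : Mt n K) : sbs (K := K) 1 b (EL s) = EL (sbs (K := K) 1 b s) := by
  rw [EL, ← LS_map, map_sL_right, EL]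
variable [IsAlgClosed K] [CharZero K]
lemma LS_pD (hn : 0 < n) (δ : ℕ) (F : ZS K β n) : LS (iZ (pD K () ^ δ) * F) = LS F := by
  induction F using ZS_ind with
  | h1 c f =>
    rw [mul_left_comm, ← map_mul, LS_iZ, LS_iZ]
    congr 2
    induction δ with
    | zero => simp
    | succ k ih => rw [pow_succ', mul_assoc, rw0_mul hn, ih]
  | h2 f g hf hg => rw [mul_add, map_add, map_add, hf, hg]
lemma inv_sL (hn : 0 < n) (r : Sr K β n) (d : ℕ) (hr : r.IsHomogeneous d)
    (h : ∀ a : Mt n K, a.det = 1 → sbs (K := K) a 1 r = r) : ∃ δ : ℕ, sL r = C r * iZ (pD K () ^ δ) := by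
  by_cases hd : n ∣ d
  · obtain ⟨δ, rfl⟩ := hd
    refine ⟨δ, MvPolynomial.ext _ _ fun μ => ?_⟩
    have := gr_mod hn ⊥ r δ hr (fun a ha => by rw [h a ha, sub_self]; exact zero_mem _) 1 μ
    rw [Ideal.mem_bot, sub_eq_zero, map_one, mul_one, mul_one] at this
    rw [this, coeff_C_mul, iZ_coeff]
  · have : NeZero (n : K) := ⟨by exact_mod_cast hn.ne'⟩
    have : NeZero n := ⟨hn.ne'⟩
    obtain ⟨ζ, hζ⟩ := HasEnoughRootsOfUnity.exists_primitiveRoot K n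
    have h1 := sbs_homog hr ζ 1 1
    rw [h _ (by simp [hζ.pow_eq_one]), sbs_one] at h1
    have h2 : (ζ ^ d - 1) • r = 0 := by rw [sub_smul, one_smul, ← h1, sub_self]
    rcases smul_eq_zero.1 h2 with h3 | h3
    · exact absurd ((hζ.pow_eq_one_iff_dvd d).1 (sub_eq_zero.1 h3)) hd
    · exact ⟨0, by simp [h3]⟩
lemma LS_mul (hn : 0 < n) (r : Sr K β n) (h : ∀ a : Mt n K, a.det = 1 → sbs (K := K) a 1 r = r)
    (F : ZS K β n) : LS (sL r * F) = r * LS F := by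
  conv_lhs => rw [← sum_homogeneousComponent r, map_sum, Finset.sum_mul, map_sum]
  conv_rhs => rw [← sum_homogeneousComponent r, Finset.sum_mul]
  refine Finset.sum_congr rfl fun i _ => ?_
  obtain ⟨δ, hδ⟩ := inv_sL hn (homogeneousComponent i r) i (homogeneousComponent_isHomogeneous _ _)
    (fun a ha => by rw [← (sbs_Grd a 1).hc, h a ha])
  rw [hδ, mul_assoc, ← smul_eq_C_mul, map_smul, LS_pD hn, smul_eq_mul]
lemma EL_mul (hn : 0 < n) (r s : Sr K β n) (h : ∀ a : Mt n K, a.det = 1 → sbs (K := K) a 1 r = r) :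
    EL (r * s) = r * EL s := by rw [EL, map_mul, LS_mul hn r h, EL]
lemma EL_one (hn : 0 < n) : EL (1 : Sr K β n) = 1 := by
  have := LS_iZ (β := β) (n := n) (K := K) 1 1
  have h2 := rw0_pD (K := K) hn 0
  rw [pow_zero] at h2
  rw [h2] at this
  rw [EL, map_one]
  simpa using this
theorem GR_zero (hn : 0 < n) : GRL K n β := by
  have hinf := IsAlgClosed.instInfinite (K := K)
  intro J s δ hs hJ
  refine ⟨1, EL s, one_pos, EL_left s, ?_, fun b hb => by rw [EL_right, hb]⟩
  have h1 : EL s - s = LS (sL s - C s * iZ (pD K () ^ δ)) := by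
    rw [map_sub, LS_iZ, rw0_pD hn, map_one, mul_one]; rfl
  rw [pow_one, h1, LS, lam_eq]
  refine Ideal.sum_mem _ fun μ _ => Ideal.mul_mem_right _ _ ?_
  have := gr_mod hn J s δ hs hJ 1 μ
  rw [map_one, mul_one, mul_one] at this
  rwa [coeff_sub, coeff_C_mul, iZ_coeff]
noncomputable def ELR (s : Sr K β n) : Sr K β n := trp (EL (trp (EL s)))
lemma LRinv {f : Sr K β n} (h : GInv f) (a : Mt n K) (ha : a.det = 1) :
    sbs (K := K) a 1 f = f ∧ sbs (K := K) a 1 (trp f) = trp f := by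
  refine ⟨h a 1 ha det_one, ?_⟩
  have := congrArg trp (h 1 aᵀ det_one (by rwa [det_transpose]))
  rw [trp_sbs] at this; simpa using this
lemma ELR_inv (s : Sr K β n) : GInv (ELR s) := by
  have hinf := IsAlgClosed.instInfinite (K := K)
  intro a b ha hb
  rw [sbs_split]
  have h1 : sbs (K := K) 1 b (ELR s) = ELR s := by
    have := congrArg trp (EL_left (trp (EL s)) bᵀ (by rwa [det_transpose]))
    rw [trp_sbs] at this; simpa [ELR] using this
  rw [h1]
  have h2 : sbs (K := K) a 1 (ELR s) = trp (sbs (K := K) 1 aᵀ (EL (trp (EL s)))) := by rw [trp_sbs]; simp [ELR]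
  have h3 := trp_sbs a 1 (EL s)
  rw [EL_left _ a ha, transpose_one] at h3
  rw [h2, EL_right, ← h3, ELR]
lemma ELR_mul (hn : 0 < n) (r s : Sr K β n) (h : GInv r) : ELR (r * s) = r * ELR s := by
  rw [ELR, EL_mul hn r s fun a ha => (LRinv h a ha).1, map_mul, EL_mul hn _ _ fun a ha => (LRinv h a ha).2, map_mul, trp_trp, ELR]
lemma ELR_sum {ι : Type} (S : Finset ι) (f : ι → Sr K β n) : ELR (∑ i ∈ S, f i) = ∑ i ∈ S, ELR (f i) := by
  simp only [ELR, EL, map_sum]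
lemma ELR_one (hn : 0 < n) : ELR (1 : Sr K β n) = 1 := by
  rw [ELR, EL_one hn, map_one, EL_one hn, map_one]
end rey3
lemma jacZ : IsJacobsonRing ℤ := by
  rw [isJacobsonRing_iff_prime_eq]
  intro P hP
  by_cases h : P = ⊥
  · subst h
    refine le_antisymm (fun x hx => ?_) Ideal.le_jacobson
    have := (Ideal.mem_jacobson_bot.1 hx) x
    rw [Int.isUnit_iff] at this
    rw [Ideal.mem_bot]
    nlinarith [this.resolve_right (by nlinarith [mul_self_nonneg x])]
  · have : P.IsMaximal := IsPrime.to_maximal_ideal h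
    exact Ideal.jacobson_eq_self_of_isMaximal
lemma specialize {K : Type} [Field K] (F : Set K) (hF : F.Finite) :
    ∃ (p : ℕ) (κ : Type) (_ : Field κ) (_ : IsAlgClosed κ) (_ : Fact p.Prime) (_ : CharP κ p), 
      Nonempty ((Algebra.adjoin ℤ F) →+* κ) := by
  haveI := jacZ
  haveI : Algebra.FiniteType ℤ (Algebra.adjoin ℤ F) := (Subalgebra.fg_iff_finiteType _).1 (Subalgebra.fg_def.2 ⟨F, hF, rfl⟩)
  obtain ⟨m, hm⟩ := Ideal.exists_maximal (Algebra.adjoin ℤ F)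
  letI : Field (Algebra.adjoin ℤ F ⧸ m) := Ideal.Quotient.field m
  haveI : Algebra.FiniteType ℤ (Algebra.adjoin ℤ F ⧸ m) := Algebra.FiniteType.of_surjective (Ideal.Quotient.mkₐ ℤ m) (Ideal.Quotient.mkₐ_surjective ℤ m)
  haveI := finite_of_finite_type_of_isJacobsonRing ℤ (Algebra.adjoin ℤ F ⧸ m)
  obtain ⟨p, hp⟩ := CharP.exists (Algebra.adjoin ℤ F ⧸ m)
  rcases CharP.char_is_prime_or_zero (Algebra.adjoin ℤ F ⧸ m) p with h | h
  · haveI : Fact p.Prime := ⟨h⟩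
    haveI : CharP (AlgebraicClosure (Algebra.adjoin ℤ F ⧸ m)) p := charP_of_injective_algebraMap (algebraMap (Algebra.adjoin ℤ F ⧸ m) _).injective p
    exact ⟨p, AlgebraicClosure (Algebra.adjoin ℤ F ⧸ m), inferInstance, inferInstance, inferInstance, inferInstance,
      ⟨(algebraMap (Algebra.adjoin ℤ F ⧸ m) _).comp (Ideal.Quotient.mk m)⟩⟩
  · exfalso
    subst h
    haveI : CharZero (Algebra.adjoin ℤ F ⧸ m) := CharP.charP_to_charZero _
    have hint : IsIntegral ℤ ((2 : Algebra.adjoin ℤ F ⧸ m)⁻¹) := Algebra.IsIntegral.isIntegral _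
    have h2 : IsIntegral ℤ ((2 : ℚ)⁻¹) := by
      have : algebraMap ℚ (Algebra.adjoin ℤ F ⧸ m) (2⁻¹) = 2⁻¹ := by simp
      rw [← this] at hint
      exact (isIntegral_algHom_iff ((algebraMap ℚ (Algebra.adjoin ℤ F ⧸ m)).toIntAlgHom) (algebraMap ℚ (Algebra.adjoin ℤ F ⧸ m)).injective).1 hint
    obtain ⟨z, hz⟩ := IsIntegrallyClosed.isIntegral_iff.1 h2
    have h3 : (z : ℚ) * 2 = 1 := by
      have : (z : ℚ) = 2⁻¹ := hz
      rw [this]; norm_num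
    have h4 : z * 2 = 1 := by exact_mod_cast h3
    omega
lemma tau_unit {κ σ : Type} [Field κ] [IsAlgClosed κ] [Fintype σ] (p : ℕ) [Fact p.Prime] [CharP κ p]
    (c : MvPolynomial σ κ) (hc : c ≠ 0) : ∃ (e : ℕ) (b : MvPolynomial σ κ) (u : κ), u ≠ 0 ∧ tau p e (c * b) = C u := by
  classical
  obtain ⟨μ, hμ⟩ := support_nonempty.2 hc
  obtain ⟨e, he⟩ : ∃ e, c.totalDegree < p ^ e := ⟨_, Nat.lt_pow_self (Nat.Prime.one_lt Fact.out)⟩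
  have hlt : ∀ α ∈ c.support, ∀ i, α i < p ^ e := fun α hα i =>
    lt_of_le_of_lt ((Finsupp.le_degree i α).trans (le_totalDegree hα)) he
  have hle : ∀ i, μ i ≤ p ^ e - 1 := fun i => by
    have := hlt μ hμ i
    omega
  rw [mem_support_iff] at hμ
  refine ⟨e, monomial (cst σ (p ^ e - 1) - μ) 1, (iterateFrobeniusEquiv κ p e).symm (coeff μ c), ?_, ?_⟩
  · simpa using hμ
  · ext β
    have hA : cst σ (p ^ e - 1) - μ ≤ cst σ (p ^ e - 1) + p ^ e • β := fun i => by
      simp only [Finsupp.tsub_apply, Finsupp.add_apply]; omega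
    have hB : cst σ (p ^ e - 1) + p ^ e • β - (cst σ (p ^ e - 1) - μ) = μ + p ^ e • β := by
      ext i
      have := hle i
      simp only [Finsupp.tsub_apply, Finsupp.add_apply, cst_apply]; omega
    rw [coeff_tau, coeff_C, coeff_mul_monomial', mul_one, if_pos hA, hB]
    by_cases hβ : 0 = β
    · subst hβ
      simp
    · rw [if_neg hβ]
      rw [(notMem_support_iff (p := c)).1, map_zero]
      intro hm
      apply hβ
      ext i
      have := hlt _ hm i
      simp only [Finsupp.add_apply, Finsupp.smul_apply, smul_eq_mul] at this
      by_contra h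
      have h1 : 1 ≤ β i := Nat.one_le_iff_ne_zero.2 (fun h' => h (by simp [h']))
      nlinarith [Nat.mul_le_mul_left (p ^ e) h1]
noncomputable def shf {K σ : Type} [Field K] (a : σ → K) : MvPolynomial σ K →ₐ[K] MvPolynomial σ K :=
  aeval fun v => X v + C (a v)
lemma shf_shf {K σ : Type} [Field K] (a : σ → K) (f : MvPolynomial σ K) : shf (-a) (shf a f) = f := by
  have : (shf (-a)).comp (shf a) = AlgHom.id K (MvPolynomial σ K) := by
    refine MvPolynomial.algHom_ext fun v => ?_
    simp [shf]
  exact DFunLike.congr_fun this f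
lemma detect {K σ : Type} [Field K] [IsAlgClosed K] [Finite σ] (I : Ideal (MvPolynomial σ K)) (s : MvPolynomial σ K)
    (hs : s ∉ I) : ∃ (a : σ → K) (k : ℕ) (l : MvPolynomial σ K →ₗ[K] K), (∀ f ∈ I, l f = 0) ∧ l s = 1 ∧
      ∀ μ : σ →₀ ℕ, k ≤ μ.degree → l (shf (-a) (monomial μ 1)) = 0 := by
  classical
  set J : Ideal (MvPolynomial σ K) := I.colon {s} with hJ
  have hJ1 : J ≠ ⊤ := by
    rw [Ne, Ideal.eq_top_iff_one, hJ, Submodule.mem_colon_singleton]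
    simpa using hs
  obtain ⟨n, hn, hJn⟩ := Ideal.exists_le_maximal J hJ1
  obtain ⟨a, ha⟩ := MvPolynomial.isMaximal_iff_eq_vanishingIdeal_singleton.1 hn
  have h1 : ∃ k, Ideal.Quotient.mk I s ∉ (n ^ k • ⊤ : Submodule (MvPolynomial σ K) (MvPolynomial σ K ⧸ I)) := by
    by_contra hcon
    push Not at hcon
    obtain ⟨r, hr⟩ := (Ideal.mem_iInf_smul_pow_eq_bot_iff n (Ideal.Quotient.mk I s)).1 ((Submodule.mem_iInf _).2 hcon)
    have h2 : (1 - (r : MvPolynomial σ K)) ∈ J := by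
      rw [hJ, Submodule.mem_colon_singleton, smul_eq_mul, sub_mul, one_mul, ← Ideal.Quotient.eq]
      rw [map_mul]
      exact hr.symm
    have h3 : (1 : MvPolynomial σ K) ∈ n := by
      have := n.add_mem (hJn h2) r.2
      simpa using this
    exact hn.ne_top ((Ideal.eq_top_iff_one _).2 h3)
  obtain ⟨k, hk⟩ := h1
  set W := (n ^ k • ⊤ : Submodule (MvPolynomial σ K) (MvPolynomial σ K ⧸ I)).restrictScalars K
  have hk' : Ideal.Quotient.mk I s ∉ W := hk
  obtain ⟨l, hl1, hl2⟩ := Submodule.exists_le_ker_of_notMem hk'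
  have hl3 : ∀ w ∈ W, l w = 0 := fun w hw => hl2 hw
  refine ⟨a, k, (l (Ideal.Quotient.mk I s))⁻¹ • l ∘ₗ (Ideal.Quotient.mkₐ K I).toLinearMap, ?_, ?_, ?_⟩
  · intro f hf
    simp [Ideal.Quotient.eq_zero_iff_mem.2 hf]
  · simp [hl1]
  · intro μ hμ
    have h4 : shf (-a) (monomial μ 1) ∈ n ^ k := by
      refine Ideal.pow_le_pow_right hμ ?_
      rw [shf, aeval_monomial, map_one, one_mul, Finsupp.degree_apply, Finsupp.prod, ← Finset.prod_pow_eq_pow_sum]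
      refine Ideal.prod_mem_prod fun v _ => Ideal.pow_mem_pow ?_ _
      rw [ha, MvPolynomial.mem_vanishingIdeal_singleton_iff]
      simp
    have h5 : Ideal.Quotient.mk I (shf (-a) (monomial μ 1)) ∈ W := by
      have := Submodule.smul_mem_smul h4 (Submodule.mem_top (x := (1 : MvPolynomial σ K ⧸ I)))
      have e : shf (-a) (monomial μ 1) • (1 : MvPolynomial σ K ⧸ I) = Ideal.Quotient.mk I (shf (-a) (monomial μ 1)) := by
        change Ideal.Quotient.mk I (shf (-a) (monomial μ 1) * 1) = _
        rw [mul_one]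
      rw [e] at this
      exact this
    simp [hl3 _ h5]
lemma dvd_sum_pow {T ι : Type} [CommRing T] {p : ℕ} (hp : p.Prime) (e : ℕ) (s : Finset ι) (g : ι → T) :
    ∃ z, (∑ j ∈ s, g j) ^ p ^ e = ∑ j ∈ s, g j ^ p ^ e + p * z := by
  classical
  induction s using Finset.induction_on with
  | empty => exact ⟨0, by simp [hp.ne_zero]⟩
  | insert a s ha ih =>
    obtain ⟨z, hz⟩ := ih
    obtain ⟨w, hw⟩ := exists_add_pow_prime_pow_eq hp (g a) (∑ j ∈ s, g j) e
    refine ⟨z + g a * (∑ j ∈ s, g j) * w, ?_⟩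
    rw [Finset.sum_insert ha, Finset.sum_insert ha, hw, hz]; ring
section core
variable {K D κ R σ : Type} [Field K] [CommRing D] [Field κ] [CommRing R] [Algebra K R] [Fintype σ]
  (inc : D →+* K) {d N k : ℕ} (θ : MvPolynomial (Fin d) K →ₐ[K] R)
def InD (y : Fin N → R) (z : R) : Prop := ∃ a : Fin N → MvPolynomial (Fin d) D, z = ∑ l, θ (map inc (a l)) * y l
def ringD (y : Fin N → R) (h1 : InD inc θ y 1) (hy : ∀ a b, InD inc θ y (y a * y b)) : Subring R where
  carrier := {z | InD inc θ y z}
  one_mem' := h1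
  zero_mem' := ⟨0, by simp⟩
  add_mem' := by
    rintro _ _ ⟨a, rfl⟩ ⟨b, rfl⟩
    exact ⟨a + b, by simp [add_mul, Finset.sum_add_distrib]⟩
  neg_mem' := by
    rintro _ ⟨a, rfl⟩
    exact ⟨-a, by simp⟩
  mul_mem' := by
    rintro _ _ ⟨a, rfl⟩ ⟨b, rfl⟩
    choose g hg using hy
    refine ⟨fun l => ∑ i, ∑ j, a i * b j * g i j l, ?_⟩
    rw [Finset.sum_mul_sum]
    have : ∀ i j, θ (map inc (a i)) * y i * (θ (map inc (b j)) * y j) =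
        ∑ l, θ (map inc (a i * b j * g i j l)) * y l := by
      intro i j
      rw [mul_mul_mul_comm, hg, Finset.mul_sum]
      simp [mul_assoc]
    simp only [this, map_sum, Finset.sum_mul]
    rw [Finset.sum_comm (γ := Fin N) (s := Finset.univ (α := Fin N)) (f := fun l i => ∑ j, θ (map inc (a i * b j * g i j l)) * y l)]
    refine Finset.sum_congr rfl fun i _ => ?_
    rw [Finset.sum_comm]
lemma heta (ι : R →ₐ[K] MvPolynomial σ K) (xs : Fin d → MvPolynomial σ D) (hxs : ∀ j, ι (θ (X j)) = map inc (xs j)) :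
    ∀ a : MvPolynomial (Fin d) D, ι (θ (map inc a)) = map inc (aeval xs a) := by
  intro a
  have : ((ι : R →+* MvPolynomial σ K).comp ((θ : _ →+* R).comp (map inc))) =
      (map inc).comp (aeval xs : MvPolynomial (Fin d) D →ₐ[D] MvPolynomial σ D).toRingHom := by
    refine MvPolynomial.ringHom_ext (fun t => ?_) (fun j => ?_)
    · simp [← algebraMap_eq]
    · simp [hxs]
  exact DFunLike.congr_fun this a
theorem core (ψ : D →+* κ) [IsAlgClosed κ] (p : ℕ) [Fact p.Prime] [CharP κ p] (hinc : Function.Injective inc)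
    (hinj : Function.Injective θ) (ι : R →ₐ[K] MvPolynomial σ K)
    (y : Fin N → R) (h1 : InD inc θ y 1) (hy : ∀ a b, InD inc θ y (y a * y b))
    (e : Fin k → R) (he : ∀ a : Fin k → MvPolynomial (Fin d) K, ∑ l, θ (a l) * e l = 0 → ∀ l, a l = 0)
    (c : MvPolynomial (Fin d) D) (hc : ∀ a, InD inc θ e (θ (map inc c) * y a))
    (i : Fin d) (r : R) (hr : InD inc θ y r) (f : Fin d → R) (hf : ∀ j, InD inc θ y (f j))
    (hrf : r * θ (X i) = ∑ j with j < i, f j * θ (X j))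
    (xs : Fin d → MvPolynomial σ D) (hxs : ∀ j, ι (θ (X j)) = map inc (xs j))
    (es : Fin k → MvPolynomial σ D) (hes : ∀ l, ι (e l) = map inc (es l))
    (rs : MvPolynomial σ D) (hrs : ι r = map inc rs)
    (hcne : map ψ (aeval xs c) ≠ 0) :
    map ψ rs ∈ Ideal.span ((fun j => map ψ (xs j)) '' {j | j < i}) := by
  classical
  have hincX : Function.Injective (map inc : MvPolynomial (Fin d) D →+* _) := map_injective _ hinc
  have hincS : Function.Injective (map inc : MvPolynomial σ D →+* _) := map_injective _ hinc
  have hη := heta inc θ ι xs hxs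
  have hη' : ∀ a : MvPolynomial (Fin d) D, map ψ (aeval xs a) = aeval (fun j => map ψ (xs j)) (map ψ a) := by
    intro a
    have : ((map ψ).comp (aeval xs : MvPolynomial (Fin d) D →ₐ[D] MvPolynomial σ D).toRingHom) =
        (aeval (fun j => map ψ (xs j)) : MvPolynomial (Fin d) κ →ₐ[κ] MvPolynomial σ κ).toRingHom.comp (map ψ) := by
      refine MvPolynomial.ringHom_ext (fun t => ?_) (fun j => ?_)
      · simp
      · simp
    exact DFunLike.congr_fun this a
  obtain ⟨E, b, u, hu, hτ⟩ := tau_unit p _ hcne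
  set M := p ^ E with hM
  have hcD : ∀ z ∈ ringD inc θ y h1 hy, InD inc θ e (θ (map inc c) * z) := by
    rintro _ ⟨a, rfl⟩
    choose g hg using hc
    refine ⟨fun l => ∑ i, a i * g i l, ?_⟩
    rw [Finset.mul_sum]
    simp only [map_sum, Finset.sum_mul]
    rw [Finset.sum_comm]
    refine Finset.sum_congr rfl fun i _ => ?_
    rw [mul_left_comm, hg, Finset.mul_sum]
    simp [mul_assoc]
  have hxD : ∀ j, θ (X j) ∈ ringD inc θ y h1 hy := by
    intro j
    obtain ⟨a, ha⟩ := h1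
    refine ⟨fun l => X j * a l, ?_⟩
    simp only [map_mul, map_X, mul_assoc, ← Finset.mul_sum, ← ha, mul_one]
  obtain ⟨z, hz⟩ := dvd_sum_pow (T := ringD inc θ y h1 hy) (Fact.out : p.Prime) E (Finset.univ.filter (· < i))
    (fun j => ⟨f j, hf j⟩ * ⟨_, hxD j⟩)
  have hz' : r ^ M * θ (X i) ^ M = ∑ j with j < i, f j ^ M * θ (X j) ^ M + p * z := by
    rw [← mul_pow, hrf]
    have := congrArg (Subtype.val) hz
    simpa [mul_pow] using this
  obtain ⟨P, hP⟩ := hcD _ (pow_mem (show r ∈ ringD inc θ y h1 hy from hr) M)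
  choose G hG using fun j => hcD _ (pow_mem (show f j ∈ ringD inc θ y h1 hy from hf j) M)
  obtain ⟨W, hW⟩ := hcD _ z.2
  have hlin : ∀ l, P l * X i ^ M = ∑ j with j < i, G j l * X j ^ M + (p : MvPolynomial (Fin d) D) * W l := by
    intro l
    apply hincX
    rw [← sub_eq_zero, ← map_sub]
    refine he (fun l => map inc (P l * X i ^ M - (∑ j with j < i, G j l * X j ^ M + (p : MvPolynomial (Fin d) D) * W l))) ?_ l
    have h2 : (θ (map inc c) * r ^ M) * θ (X i) ^ M - (∑ j with j < i, θ (map inc c) * f j ^ M * θ (X j) ^ M + p * (θ (map inc c) * z)) = 0 := by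
      rw [mul_assoc, hz', mul_add, Finset.mul_sum]
      simp only [mul_assoc]
      ring
    rw [hP, hW] at h2
    simp only [hG] at h2
    rw [← h2]
    simp only [map_sub, map_add, map_sum, map_mul, map_pow, map_X, map_natCast, sub_mul, add_mul, Finset.sum_mul, Finset.sum_sub_distrib, Finset.sum_add_distrib, Finset.mul_sum]
    congr 1
    · exact Finset.sum_congr rfl fun l _ => by ring
    · congr 1
      · rw [Finset.sum_comm]
        exact Finset.sum_congr rfl fun j _ => Finset.sum_congr rfl fun l _ => by ring
      · exact Finset.sum_congr rfl fun l _ => by ring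
  have hPbar : ∀ l, map ψ (P l) ∈ Ideal.span ((fun j => (X j : MvPolynomial (Fin d) κ) ^ M) '' {j | j < i}) := by
    intro l
    apply mono_reg
    rw [mem_span_lt]
    refine ⟨fun j => map ψ (G j l), ?_⟩
    have := congrArg (map ψ) (hlin l)
    simpa using this
  choose H hH using fun l => (mem_span_lt _ _ _).1 (hPbar l)
  have hfin : map ψ (aeval xs c) * map ψ rs ^ M = ∑ l, map ψ (aeval xs (P l)) * map ψ (es l) := by
    rw [← map_pow, ← map_mul]
    simp only [← map_mul, ← map_sum]
    congr 1
    apply hincS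
    have := congrArg ι hP
    simpa [hη, hrs, hes] using this
  have h3 := congrArg (tau p E) (congrArg (· * b) hfin)
  beta_reduce at h3
  rw [show map ψ (aeval xs c) * map ψ rs ^ M * b = map ψ rs ^ p ^ E * (map ψ (aeval xs c) * b) by rw [hM]; ring, tau_pow_mul, hτ] at h3
  have h4 : map ψ rs * C u ∈ Ideal.span ((fun j => map ψ (xs j)) '' {j | j < i}) := by
    rw [h3, Finset.sum_mul, tau_sum]
    refine Ideal.sum_mem _ fun l _ => ?_
    rw [hη', hH, map_sum, Finset.sum_mul, Finset.sum_mul, tau_sum]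
    refine Ideal.sum_mem _ fun j hj => ?_
    rw [map_mul, map_pow, aeval_X, mul_comm _ (_ ^ M), mul_assoc, mul_assoc, hM, tau_pow_mul]
    exact Ideal.mul_mem_right _ _ (Ideal.subset_span ⟨j, by simpa using hj, rfl⟩)
  have h5 := Ideal.mul_mem_right (C u⁻¹) _ h4
  rwa [mul_assoc, ← C_mul, mul_inv_cancel₀ hu, C_1, mul_one] at h5
end core
lemma noCert {K D κ σ : Type} [Field K] [CommRing D] [Field κ] (inc : D →+* K) (hinc : Function.Injective inc)
    (ψ : D →+* κ) (L : MvPolynomial σ K →ₗ[K] K) (B : Finset (σ →₀ ℕ)) (w : (σ →₀ ℕ) → D)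
    (hw : ∀ μ ∈ B, L (monomial μ 1) = inc (w μ)) (hw' : ∀ μ ∉ B, L (monomial μ 1) = 0)
    {d : ℕ} (i : Fin d) (xs : Fin d → MvPolynomial σ D) (rs : MvPolynomial σ D)
    (h0 : ∀ j < i, ∀ g, L (map inc (xs j) * g) = 0) (h1 : L (map inc rs) = 1)
    (h : map ψ rs ∈ Ideal.span ((fun j => map ψ (xs j)) '' {j | j < i})) : False := by
  classical
  have hL : ∀ g, L g = ∑ μ ∈ B, coeff μ g * L (monomial μ 1) := by
    intro g
    induction g using MvPolynomial.induction_on' with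
    | monomial ν t =>
      have : L (monomial ν t) = t * L (monomial ν 1) := by
        rw [← smul_eq_mul, ← map_smul, smul_monomial, smul_eq_mul, mul_one]
      rw [this]
      by_cases hν : ν ∈ B
      · simp [coeff_monomial, hν]
      · simp [coeff_monomial, hν, hw' ν hν]
    | add p q hp hq => rw [map_add, hp, hq]; simp [add_mul, Finset.sum_add_distrib]
  have hD : ∀ s : MvPolynomial σ D, L (map inc s) = inc (∑ μ ∈ B, coeff μ s * w μ) := by
    intro s
    rw [hL, map_sum]
    refine Finset.sum_congr rfl fun μ hμ => ?_
    rw [hw μ hμ, coeff_map, map_mul]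
  let Lb : MvPolynomial σ κ → κ := fun g => ∑ μ ∈ B, coeff μ g * ψ (w μ)
  have hadd : ∀ g g', Lb (g + g') = Lb g + Lb g' := fun g g' => by simp [Lb, add_mul, Finset.sum_add_distrib]
  have hsm : ∀ t g, Lb (C t * g) = t * Lb g := fun t g => by simp [Lb, coeff_C_mul, Finset.mul_sum, mul_assoc]
  have hψ : ∀ s : MvPolynomial σ D, Lb (map ψ s) = ψ (∑ μ ∈ B, coeff μ s * w μ) := fun s => by simp [Lb, coeff_map]
  have hx : ∀ j < i, ∀ g, Lb (map ψ (xs j) * g) = 0 := by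
    intro j hj g
    induction g using MvPolynomial.induction_on' with
    | monomial ν t =>
      have e : map ψ (xs j) * monomial ν t = C t * map ψ (xs j * monomial ν 1) := by
        rw [map_mul, map_monomial, map_one, mul_left_comm, C_mul_monomial, mul_one]
      have e2 : ∑ μ ∈ B, coeff μ (xs j * monomial ν 1) * w μ = 0 := by
        apply hinc
        rw [← hD, map_mul, h0 j hj, map_zero]
      rw [e, hsm, hψ, e2, map_zero, mul_zero]
    | add p q hp hq => rw [mul_add, hadd, hp, hq, add_zero]
  obtain ⟨g, hg⟩ := (mem_span_lt _ _ _).1 h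
  have e1 : Lb (map ψ rs) = 1 := by
    rw [hψ, show ∑ μ ∈ B, coeff μ rs * w μ = 1 from hinc (by rw [← hD, h1, map_one]), map_one]
  have e2 : Lb (map ψ rs) = 0 := by
    rw [hg]
    have : ∀ s : Finset (Fin d), (∀ j ∈ s, j < i) → Lb (∑ j ∈ s, g j * map ψ (xs j)) = 0 := by
      intro s
      induction s using Finset.induction_on with
      | empty => intro _; simp [Lb]
      | insert a s ha ih =>
        intro hs
        rw [Finset.sum_insert ha, hadd, mul_comm, hx _ (hs a (Finset.mem_insert_self _ _)), ih (fun j hj => hs j (Finset.mem_insert_of_mem hj)), add_zero]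
    exact this _ (by simp)
  rw [e1] at e2
  exact one_ne_zero e2
set_option maxHeartbeats 800000 in
theorem SopReg_zero {K R σ : Type} [Field K] [IsAlgClosed K] [CommRing R] [Algebra K R] [Fintype σ]
    (ι : R →ₐ[K] MvPolynomial σ K) (hι : Function.Injective ι)
    (pure : ∀ (d : ℕ) (x : Fin d → R) (i : Fin d) (r : R),
      ι r ∈ Ideal.span ((fun j => ι (x j)) '' {j | j < i}) → r ∈ Ideal.span (x '' {j | j < i})) : SopReg K R := by
  classical
  intro d θ hinj hfin i r hr
  apply pure
  by_contra hcon
  obtain ⟨f, hf⟩ := (mem_span_lt _ _ _).1 hr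
  obtain ⟨a, k, l, hl1, hl2, hl3⟩ := detect _ _ hcon
  letI : Algebra (MvPolynomial (Fin d) K) R := θ.toRingHom.toAlgebra
  haveI : Module.Finite (MvPolynomial (Fin d) K) R := hfin
  have smul_def : ∀ (a : MvPolynomial (Fin d) K) (x : R), a • x = θ a * x := fun _ _ => rfl
  obtain ⟨N, y, hy⟩ := Module.Finite.exists_fin (R := MvPolynomial (Fin d) K) (M := R)
  have hy' : ∀ z : R, ∃ b : Fin N → MvPolynomial (Fin d) K, z = ∑ l, θ (b l) * y l := by
    intro z
    have : z ∈ Submodule.span (MvPolynomial (Fin d) K) (Set.range y) := by rw [hy]; trivial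
    rw [Submodule.mem_span_range_iff_exists_fun] at this
    obtain ⟨b, hb⟩ := this
    exact ⟨b, hb.symm⟩
  choose cf hcf using hy'
  obtain ⟨k', e, he, c, hc, hcov⟩ := free_cover (MvPolynomial (Fin d) K) R
  choose cc hcc using hcov
  set ι' := (shf a).comp ι with hι'
  have shfinj : Function.Injective (shf a) := fun f g h => by rw [← shf_shf a f, h, shf_shf]
  have hcne : ι' (θ c) ≠ 0 := fun h => hc (hinj (hι (shfinj (by simpa [hι'] using h))))
  obtain ⟨μ₀, hμ₀⟩ := support_nonempty.2 hcne
  rw [mem_support_iff] at hμ₀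
  have hBf : {μ : σ →₀ ℕ | μ.degree ≤ k}.Finite := Finsupp.finite_of_degree_le k
  set B := hBf.toFinset with hB
  let L : MvPolynomial σ K →ₗ[K] K := l ∘ₗ (shf (-a)).toLinearMap
  let F : Set K := (⋃ t, ((cf 1 t).coeffs : Set K)) ∪ (⋃ s, ⋃ s', ⋃ t, ((cf (y s * y s') t).coeffs : Set K)) ∪
    (⋃ t, ((cf r t).coeffs : Set K)) ∪ (⋃ j, ⋃ t, ((cf (f j) t).coeffs : Set K)) ∪ (c.coeffs : Set K) ∪
    (⋃ s, ⋃ t, ((cc (y s) t).coeffs : Set K)) ∪ (⋃ j, ((ι' (θ (X j))).coeffs : Set K)) ∪ (⋃ t, ((ι' (e t)).coeffs : Set K)) ∪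
    ((ι' r).coeffs : Set K) ∪ {(coeff μ₀ (ι' (θ c)))⁻¹} ∪ ((fun μ => L (monomial μ 1)) '' B)
  have hF : F.Finite := Set.toFinite _
  obtain ⟨p, κ, _, _, _, _, ⟨ψ⟩⟩ := specialize F hF
  set D := Algebra.adjoin ℤ F
  let inc : D →+* K := D.val.toRingHom
  have hinc : Function.Injective inc := Subtype.val_injective
  have hFD : ∀ v ∈ F, ∃ v' : D, v = inc v' := fun v hv => ⟨⟨v, Algebra.subset_adjoin hv⟩, rfl⟩
  have lift : ∀ {τ : Type} (g : MvPolynomial τ K), (g.coeffs : Set K) ⊆ F → ∃ g', g = map inc g' := by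
    intro τ g hg
    have : g ∈ Set.range (map inc) := by
      rw [mem_range_map_iff_coeffs_subset]
      intro v hv
      obtain ⟨v', rfl⟩ := hFD v (hg hv)
      exact ⟨v', rfl⟩
    obtain ⟨g', hg'⟩ := this
    exact ⟨g', hg'.symm⟩
  choose c' hc' using lift c (fun v hv => Or.inl (Or.inl (Or.inl (Or.inl (Or.inl (Or.inl (Or.inr (hv))))))))
  choose xs hxs using fun j => lift (ι' (θ (X j))) (fun v hv => Or.inl (Or.inl (Or.inl (Or.inl (Or.inr (Set.mem_iUnion.2 ⟨j, hv⟩))))))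
  choose es hes using fun j => lift (ι' (e j)) (fun v hv => Or.inl (Or.inl (Or.inl (Or.inr (Set.mem_iUnion.2 ⟨j, hv⟩)))))
  choose rs hrs using lift (ι' r) (fun v hv => Or.inl (Or.inl (Or.inr (hv))))
  choose q1 hq1 using fun j => lift (cf 1 j) (fun v hv => Or.inl (Or.inl (Or.inl (Or.inl (Or.inl (Or.inl (Or.inl (Or.inl (Or.inl (Or.inl (Set.mem_iUnion.2 ⟨j, hv⟩)))))))))))
  choose q2 hq2 using fun j => lift (cf r j) (fun v hv => Or.inl (Or.inl (Or.inl (Or.inl (Or.inl (Or.inl (Or.inl (Or.inl (Or.inr (Set.mem_iUnion.2 ⟨j, hv⟩))))))))))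
  choose q3 hq3 using fun s j => lift (cf (f s) j) (fun v hv => Or.inl (Or.inl (Or.inl (Or.inl (Or.inl (Or.inl (Or.inl (Or.inr (Set.mem_iUnion.2 ⟨s, Set.mem_iUnion.2 ⟨j, hv⟩⟩)))))))))
  choose q4 hq4 using fun s j => lift (cc (y s) j) (fun v hv => Or.inl (Or.inl (Or.inl (Or.inl (Or.inl (Or.inr (Set.mem_iUnion.2 ⟨s, Set.mem_iUnion.2 ⟨j, hv⟩⟩)))))))
  choose q5 hq5 using fun s s' j => lift (cf (y s * y s') j) (fun v hv => Or.inl (Or.inl (Or.inl (Or.inl (Or.inl (Or.inl (Or.inl (Or.inl (Or.inl (Or.inr (Set.mem_iUnion.2 ⟨s, Set.mem_iUnion.2 ⟨s', Set.mem_iUnion.2 ⟨j, hv⟩⟩⟩)))))))))))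
  obtain ⟨v, hv⟩ := hFD (coeff μ₀ (ι' (θ c)))⁻¹ (Or.inl (Or.inr rfl))
  have hw : ∀ μ, ∃ w : D, μ ∈ B → L (monomial μ 1) = inc w := by
    intro μ
    by_cases hμ : μ ∈ B
    · obtain ⟨w, hw⟩ := hFD (L (monomial μ 1)) (Or.inr ⟨μ, hμ, rfl⟩)
      exact ⟨w, fun _ => hw⟩
    · exact ⟨0, fun h => absurd h hμ⟩
  choose w hw using hw
  have hη := heta inc θ ι' xs hxs
  refine noCert inc hinc ψ L B w hw (fun μ hμ => ?_) i xs rs (fun j hj g => ?_) ?_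
    (core inc θ ψ p hinc hinj ι' y ⟨q1, ?_⟩ (fun s s' => ⟨q5 s s', ?_⟩) e ?_ c' (fun s => ⟨q4 s, ?_⟩) i r ⟨q2, ?_⟩ f
      (fun j => ⟨q3 j, ?_⟩) hf xs hxs es hes rs hrs ?_)
  · apply hl3
    rw [hB, Set.Finite.mem_toFinset] at hμ
    exact (not_le.1 hμ).le
  · rw [← hxs]
    change l (shf (-a) (shf a (ι (θ (X j))) * g)) = 0
    rw [map_mul, shf_shf]
    exact hl1 _ (Ideal.mul_mem_right _ _ (Ideal.subset_span ⟨j, hj, rfl⟩))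
  · rw [← hrs]
    change l (shf (-a) (shf a (ι r))) = 1
    rw [shf_shf, hl2]
  · simp only [← hq1]; exact hcf 1
  · simp only [← hq5]; exact hcf _
  · intro b hb
    exact Fintype.linearIndependent_iff.1 he b hb
  · simp only [← hq4, ← hc']; exact hcc _
  · simp only [← hq2]; exact hcf _
  · simp only [← hq3]; exact hcf _
  · intro h0
    have e1 := congrArg (coeff μ₀) h0
    rw [coeff_map, coeff_zero] at e1
    have e2 : coeff μ₀ (aeval xs c') * v = 1 := by
      apply hinc
      rw [map_mul, ← hv, ← coeff_map, ← hη, ← hc', map_one, mul_inv_cancel₀ hμ₀]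
    have e3 := congrArg ψ e2
    rw [map_mul, e1, zero_mul, map_one] at e3
    exact zero_ne_one e3
theorem Sop0 {K : Type} [Field K] [IsAlgClosed K] [CharZero K] {n m : ℕ} (hn : 0 < n) : SopReg K ↥(matrixSemiInvariants K n m) := by
  have hinf := IsAlgClosed.instInfinite (K := K)
  refine SopReg_zero (matrixSemiInvariants K n m).val Subtype.val_injective ?_
  intro d x i r hr
  obtain ⟨t, ht, c, hc⟩ := (Submodule.mem_span_image_iff_exists_fun _).1 hr
  have hg : ∀ r : ↥(matrixSemiInvariants K n m), GInv (r : Sr K (Fin m) n) := fun r => (mem_R _).1 r.2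
  let E : Sr K (Fin m) n → ↥(matrixSemiInvariants K n m) := fun s => ⟨ELR s, (mem_R _).2 (ELR_inv s)⟩
  have h2 : r = ∑ j, x j.1 * E (c j) := by
    apply Subtype.ext
    have h3 : ELR (r : Sr K (Fin m) n) = r := by
      have := ELR_mul hn (r : Sr K (Fin m) n) 1 (hg r)
      rwa [mul_one, ELR_one hn, mul_one] at this
    have hc' : (r : Sr K (Fin m) n) = ∑ j, (x j.1 : Sr K (Fin m) n) * c j := by
      rw [← Subalgebra.val_apply, ← hc]
      exact Finset.sum_congr rfl fun j _ => by rw [smul_eq_mul, mul_comm]; rfl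
    rw [← h3, hc', ELR_sum, AddSubmonoidClass.coe_finset_sum]
    exact Finset.sum_congr rfl fun j _ => ELR_mul hn _ _ (hg _)
  rw [h2]
  exact Ideal.sum_mem _ fun j _ => Ideal.mul_mem_right _ _ (Ideal.subset_span ⟨j.1, ht j.2, rfl⟩)
/-- The ring of matrix semi-invariants `R(n,m)` is Cohen-Macaulay in
arbitrary characteristic. -/
theorem stmt_12 (K : Type) [Field K] [IsAlgClosed K] (n m : ℕ) (hn : 0 < n) (hm : 0 < m) :
    IsCohenMacaulayRing ↥(matrixSemiInvariants K n m) := by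
  obtain ⟨p, hp⟩ := CharP.exists K
  rcases CharP.char_is_prime_or_zero K p with h | rfl
  · haveI : Fact p.Prime := ⟨h⟩
    haveI : Algebra.FiniteType K ↥(matrixSemiInvariants K n m) := FT (fun J s δ => GR_left p hn J s δ) hn
    exact CM_of_SopReg (SopReg_p p hn)
  · haveI : CharZero K := CharP.charP_to_charZero K
    haveI : Algebra.FiniteType K ↥(matrixSemiInvariants K n m) := FT (GR_zero hn) hn
    exact CM_of_SopReg (Sop0 hn)
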